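/- Let Ω ⊆ ℝ^N be a domain with nonempty boundary Γ, let 1 < p < ∞, and let z ∈ ℝ^N \ Ω̄. Set A_{N,p} = [p·e/(2(N+p−2))]^{(N+p−2)/(2(p−1))} and define U^z(x,t) = A_{N,p}·d_Γ(z)^{(N+p−2)/(p−1)}·t^{−(N+p−2)/(2(p−1))}·e^{−p'|x−z|²/(4t)} for (x,t) ∈ Ω̄×(0,∞). If u is a bounded viscosity solution of problem (P) in Ω, then U^z(x,t) ≤ u(x,t) for all (x,t) ∈ Ω̄×(0,∞). -/

import Mathlib

open MeasureTheory Metric Set Filter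
open scoped Topology ENNReal NNReal Real Classical

noncomputable section

/-- The Hessian matrix of a real-valued function, via the second iterated Fréchet derivative. -/
noncomputable def hess {N : ℕ} (f : EuclideanSpace ℝ (Fin N) → ℝ) (x : EuclideanSpace ℝ (Fin N)) :
    Matrix (Fin N) (Fin N) ℝ :=
  fun i j => iteratedFDeriv ℝ 2 f x ![EuclideanSpace.single i 1, EuclideanSpace.single j 1]

/-- The quadratic form ⟨Xv, v⟩ associated to a matrix. -/
noncomputable def qform {N : ℕ} (X : Matrix (Fin N) (Fin N) ℝ) (v : EuclideanSpace ℝ (Fin N)) : ℝ :=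
  ∑ i, ∑ j, X i j * v j * v i

/-- Smallest eigenvalue (via the Rayleigh quotient) of a symmetric matrix. -/
noncomputable def lamMin {N : ℕ} (X : Matrix (Fin N) (Fin N) ℝ) : ℝ :=
  sInf {r | ∃ v : EuclideanSpace ℝ (Fin N), ‖v‖ = 1 ∧ r = qform X v}

/-- Largest eigenvalue (via the Rayleigh quotient) of a symmetric matrix. -/
noncomputable def lamMax {N : ℕ} (X : Matrix (Fin N) (Fin N) ℝ) : ℝ :=
  sSup {r | ∃ v : EuclideanSpace ℝ (Fin N), ‖v‖ = 1 ∧ r = qform X v}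

/-- F(ξ, X) = (1/p)[tr X + (p−2)⟨Xξ,ξ⟩/|ξ|²]. -/
noncomputable def Fop {N : ℕ} (p : ℝ) (ξ : EuclideanSpace ℝ (Fin N))
    (X : Matrix (Fin N) (Fin N) ℝ) : ℝ :=
  (1/p) * (Matrix.trace X + (p - 2) * qform X ξ / ‖ξ‖^2)

/-- Lower semicontinuous relaxation F_*. -/
noncomputable def Flower {N : ℕ} (p : ℝ) (ξ : EuclideanSpace ℝ (Fin N))
    (X : Matrix (Fin N) (Fin N) ℝ) : ℝ :=
  if ξ = 0 then
    (1/p) * (Matrix.trace X + max (p - 2) 0 * lamMin X + min (p - 2) 0 * lamMax X)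
  else Fop p ξ X

/-- Upper semicontinuous relaxation F^*. -/
noncomputable def Fupper {N : ℕ} (p : ℝ) (ξ : EuclideanSpace ℝ (Fin N))
    (X : Matrix (Fin N) (Fin N) ℝ) : ℝ :=
  if ξ = 0 then
    (1/p) * (Matrix.trace X + min (p - 2) 0 * lamMin X + max (p - 2) 0 * lamMax X)
  else Fop p ξ X

/-- Viscosity solution of `u_t = Δ_p^G u` in `Ω × (0,∞)`. -/
def IsViscositySol {N : ℕ} (p : ℝ) (Ω : Set (EuclideanSpace ℝ (Fin N)))
    (u : EuclideanSpace ℝ (Fin N) → ℝ → ℝ) : Prop :=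
  ContinuousOn (fun q : EuclideanSpace ℝ (Fin N) × ℝ => u q.1 q.2) (Ω ×ˢ Set.Ioi 0) ∧
  (∀ φ : EuclideanSpace ℝ (Fin N) × ℝ → ℝ, ContDiff ℝ 2 φ →
    ∀ x ∈ Ω, ∀ t ∈ Set.Ioi (0:ℝ),
      IsLocalMaxOn (fun q : EuclideanSpace ℝ (Fin N) × ℝ => u q.1 q.2 - φ q)
        (Ω ×ˢ Set.Ioi 0) (x, t) →
      deriv (fun s => φ (x, s)) t ≤
        Fupper p (gradient (fun y => φ (y, t)) x) (hess (fun y => φ (y, t)) x)) ∧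
  (∀ φ : EuclideanSpace ℝ (Fin N) × ℝ → ℝ, ContDiff ℝ 2 φ →
    ∀ x ∈ Ω, ∀ t ∈ Set.Ioi (0:ℝ),
      IsLocalMinOn (fun q : EuclideanSpace ℝ (Fin N) × ℝ => u q.1 q.2 - φ q)
        (Ω ×ˢ Set.Ioi 0) (x, t) →
      Flower p (gradient (fun y => φ (y, t)) x) (hess (fun y => φ (y, t)) x) ≤
        deriv (fun s => φ (x, s)) t)

/-- Bounded (viscosity) solution of problem (P): `u_t = Δ_p^G u` in `Ω × (0,∞)`,
`u = 0` on `Ω × {0}`, `u = 1` on `Γ × (0,∞)`; continuous away from `Γ × {0}`. -/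
def IsSolP {N : ℕ} (p : ℝ) (Ω : Set (EuclideanSpace ℝ (Fin N)))
    (u : EuclideanSpace ℝ (Fin N) → ℝ → ℝ) : Prop :=
  (∃ M : ℝ, ∀ x ∈ closure Ω, ∀ t : ℝ, 0 ≤ t → |u x t| ≤ M) ∧
  (∀ x ∈ closure Ω, ∀ t : ℝ, 0 ≤ t → ¬(x ∈ frontier Ω ∧ t = 0) →
    ContinuousWithinAt (fun q : EuclideanSpace ℝ (Fin N) × ℝ => u q.1 q.2)
      (closure Ω ×ˢ Set.Ici 0) (x, t)) ∧
  IsViscositySol p Ω u ∧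
  (∀ x ∈ Ω, u x 0 = 0) ∧
  (∀ y ∈ frontier Ω, ∀ t : ℝ, 0 < t → u y t = 1)

/-- Viscosity solution of the elliptic equation `u − ε² Δ_p^G u = 0` in `Ω`. -/
def IsEllipticViscositySol {N : ℕ} (p ε : ℝ) (Ω : Set (EuclideanSpace ℝ (Fin N)))
    (u : EuclideanSpace ℝ (Fin N) → ℝ) : Prop :=
  ContinuousOn u Ω ∧
  (∀ φ : EuclideanSpace ℝ (Fin N) → ℝ, ContDiff ℝ 2 φ → ∀ x ∈ Ω,
      IsLocalMaxOn (fun y => u y - φ y) Ω x →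
      φ x - ε^2 * Fupper p (gradient φ x) (hess φ x) ≤ 0) ∧
  (∀ φ : EuclideanSpace ℝ (Fin N) → ℝ, ContDiff ℝ 2 φ → ∀ x ∈ Ω,
      IsLocalMinOn (fun y => u y - φ y) Ω x →
      0 ≤ φ x - ε^2 * Flower p (gradient φ x) (hess φ x))

/-- The complementary error function. -/
noncomputable def Erfc (σ : ℝ) : ℝ := (2 / Real.sqrt π) * ∫ τ in Set.Ioi σ, Real.exp (-τ^2)

/-- The explicit radially symmetric solution `u^ε` of the elliptic problem in the ball `B_R`. -/
noncomputable def uEps (N : ℕ) (p R ε : ℝ) (x : EuclideanSpace ℝ (Fin N)) : ℝ :=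
  (∫ θ in (0:ℝ)..π,
      Real.exp (Real.sqrt (p/(p-1)) * (‖x‖/ε) * Real.cos θ) * (Real.sin θ) ^ (((N:ℝ) - p)/(p-1))) /
  (∫ θ in (0:ℝ)..π,
      Real.exp (Real.sqrt (p/(p-1)) * (R/ε) * Real.cos θ) * (Real.sin θ) ^ (((N:ℝ) - p)/(p-1)))

open scoped RealInnerProductSpace

theorem sub_le_of_partition {ψ : ℝ → ℝ} {M C : ℝ} (f : ℝ → ℝ)
    (hf : ∀ x ∈ Icc (0 : ℝ) 1, f x ∈ Icc (0 : ℝ) 1) (hiso : ∀ x y, |f x - f y| = |x - y|)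
    (h : ∀ σ ∈ Icc (0 : ℝ) 1, ∀ τ ∈ Icc (0 : ℝ) 1, ψ τ - ψ σ ≤ M * |τ - σ| + C * (τ - σ) ^ 2) :
    ψ (f 1) - ψ (f 0) ≤ M := by
  have key : ∀ n : ℕ, ψ (f 1) - ψ (f 0) ≤ M + C * (1 / ((n : ℝ) + 1)) := by
    intro n
    have hn : (0 : ℝ) < (n : ℝ) + 1 := by positivity
    have hsum := Finset.sum_range_sub (fun i : ℕ => ψ (f ((i : ℝ) / ((n : ℝ) + 1)))) (n + 1)
    have hb : ∀ i ∈ Finset.range (n + 1), ψ (f (((i + 1 : ℕ) : ℝ) / ((n : ℝ) + 1)))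
        - ψ (f ((i : ℝ) / ((n : ℝ) + 1)))
        ≤ M * (1 / ((n : ℝ) + 1)) + C * (1 / ((n : ℝ) + 1)) ^ 2 := by
      intro i hi
      have hi' : (i : ℝ) + 1 ≤ (n : ℝ) + 1 := by
        have := Finset.mem_range.mp hi
        exact_mod_cast this
      have h1 : (i : ℝ) / ((n : ℝ) + 1) ∈ Icc (0 : ℝ) 1 :=
        ⟨by positivity, by rw [div_le_one hn]; linarith⟩
      have h2 : ((i + 1 : ℕ) : ℝ) / ((n : ℝ) + 1) ∈ Icc (0 : ℝ) 1 :=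
        ⟨by positivity, by rw [div_le_one hn]; push_cast; linarith⟩
      have h3 := h _ (hf _ h1) _ (hf _ h2)
      have h4 : |f (((i + 1 : ℕ) : ℝ) / ((n : ℝ) + 1)) - f ((i : ℝ) / ((n : ℝ) + 1))|
          = 1 / ((n : ℝ) + 1) := by
        rw [hiso, ← sub_div]
        push_cast
        rw [add_sub_cancel_left, abs_of_pos (by positivity)]
      rw [← sq_abs, h4] at h3
      exact h3
    have hle := Finset.sum_le_sum hb
    rw [hsum] at hle
    simp only [Finset.sum_const, Finset.card_range, nsmul_eq_mul] at hle
    push_cast at hle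
    rw [div_self hn.ne', zero_div] at hle
    refine hle.trans (le_of_eq ?_)
    field_simp
  have hlim : Tendsto (fun n : ℕ => M + C * (1 / ((n : ℝ) + 1))) atTop (𝓝 (M + C * 0)) :=
    (tendsto_one_div_add_atTop_nhds_zero_nat.const_mul C).const_add M
  simpa using ge_of_tendsto' hlim key

theorem abs_sub_le_of_partition {ψ : ℝ → ℝ} {M C : ℝ}
    (h : ∀ σ ∈ Icc (0 : ℝ) 1, ∀ τ ∈ Icc (0 : ℝ) 1, ψ τ - ψ σ ≤ M * |τ - σ| + C * (τ - σ) ^ 2) :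
    |ψ 1 - ψ 0| ≤ M := by
  have h1 := sub_le_of_partition (fun x => x) (fun x hx => hx) (fun _ _ => rfl) h
  have h2 := sub_le_of_partition (fun x => 1 - x)
    (fun x hx => ⟨by linarith [hx.2], by linarith [hx.1]⟩)
    (fun x y => by rw [show 1 - x - (1 - y) = -(x - y) by ring, abs_neg]) h
  simp only [sub_self, sub_zero] at h2
  rw [abs_le]
  constructor <;> linarith


theorem eq_of_contact {H : Type*} [NormedAddCommGroup H] [InnerProductSpace ℝ H]
    {w : H → ℝ} {C r : ℝ} {X q ξ : H} (hr : 0 < r) (hC : 0 ≤ C)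
    (hup : ∀ Y, w Y ≤ w X + ⟪ξ, Y - X⟫ + C * ‖Y - X‖ ^ 2)
    (hlow : ∀ Y, ‖Y - X‖ ≤ r → w X + ⟪q, Y - X⟫ ≤ w Y) : q = ξ := by
  by_contra hne
  have hpos : 0 < ‖q - ξ‖ := norm_pos_iff.mpr (sub_ne_zero.mpr hne)
  set τ : ℝ := min (r / ‖q - ξ‖) (1 / (2 * (C + 1))) with hτ
  have hτ0 : 0 < τ := lt_min (by positivity) (by positivity)
  have hτ1 : τ * ‖q - ξ‖ ≤ r := by
    have := min_le_left (r / ‖q - ξ‖) (1 / (2 * (C + 1)))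
    rwa [← hτ, le_div_iff₀ hpos] at this
  have hτ2 : τ * (2 * (C + 1)) ≤ 1 := by
    have := min_le_right (r / ‖q - ξ‖) (1 / (2 * (C + 1)))
    rwa [← hτ, le_div_iff₀ (by positivity)] at this
  have h1 := hup (X + τ • (q - ξ))
  have h2 := hlow (X + τ • (q - ξ)) (by
    rw [add_sub_cancel_left, norm_smul, Real.norm_of_nonneg hτ0.le]; exact hτ1)
  rw [add_sub_cancel_left] at h1 h2
  have h3 : ⟪q, τ • (q - ξ)⟫ - ⟪ξ, τ • (q - ξ)⟫ = τ * ‖q - ξ‖ ^ 2 := by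
    rw [← inner_sub_left, real_inner_smul_right, real_inner_self_eq_norm_sq]
  rw [norm_smul, Real.norm_of_nonneg hτ0.le, mul_pow] at h1
  have h4 : τ * ‖q - ξ‖ ^ 2 ≤ C * (τ ^ 2 * ‖q - ξ‖ ^ 2) := by linarith
  have h5 : 0 < τ * ‖q - ξ‖ ^ 2 := by positivity
  nlinarith [mul_nonneg hτ0.le h5.le, mul_le_mul_of_nonneg_left hτ2 h5.le]

theorem norm_sub_le_of_contact {H : Type*} [NormedAddCommGroup H] [InnerProductSpace ℝ H]
    {w : H → ℝ} {C R : ℝ} {c Y Z : H} {ξY ξZ : H}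
    (hY : ‖Y - c‖ < R) (hZ : ‖Z - c‖ < R)
    (hupY : ∀ X, w X ≤ w Y + ⟪ξY, X - Y⟫ + C * ‖X - Y‖ ^ 2)
    (hupZ : ∀ X, w X ≤ w Z + ⟪ξZ, X - Z⟫ + C * ‖X - Z‖ ^ 2)
    (hlow : ∀ X, ‖X - c‖ ≤ 2 * R → w Y + ⟪ξY, X - Y⟫ ≤ w X)
    (hne : Z ≠ Y) :
    ‖ξY - ξZ‖ ≤ 5 / 2 * C * ‖Z - Y‖ := by
  have hC : 0 ≤ C := by
    have h1 := hupY Z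
    have h2 := hlow Z (by linarith [norm_nonneg (Z - c)])
    have h3 : 0 < ‖Z - Y‖ := norm_pos_iff.mpr (sub_ne_zero.mpr hne)
    by_contra hneg
    push Not at hneg
    nlinarith [mul_pos h3 h3]
  rcases eq_or_ne ξY ξZ with heq | hξ
  · rw [heq, sub_self, norm_zero]; positivity
  have hpos : 0 < ‖ξY - ξZ‖ := norm_pos_iff.mpr (sub_ne_zero.mpr hξ)
  have hZY : 0 < ‖Z - Y‖ := norm_pos_iff.mpr (sub_ne_zero.mpr hne)
  set ρ := ‖Z - Y‖ / 2 with hρ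
  have hρpos : 0 < ρ := by positivity
  have hρR : ρ ≤ R := by
    have : ‖Z - Y‖ ≤ ‖Z - c‖ + ‖Y - c‖ := by
      have := norm_sub_le (Z - c) (Y - c); rwa [sub_sub_sub_cancel_right] at this
    linarith
  set h : H := (ρ / ‖ξY - ξZ‖) • (ξY - ξZ) with hh
  have hnh : ‖h‖ = ρ := by
    rw [hh, norm_smul, Real.norm_of_nonneg (by positivity)]; field_simp
  have h1 := hlow (Z + h) (by
    have : Z + h - c = (Z - c) + h := by abel
    rw [this]
    exact (norm_add_le _ _).trans (by rw [hnh]; linarith))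
  have h2 := hupZ (Z + h)
  have h3 := hupY Z
  rw [add_sub_cancel_left] at h2
  have h4 : ⟪ξY, Z + h - Y⟫ = ⟪ξY, h⟫ + ⟪ξY, Z - Y⟫ := by
    rw [← inner_add_right]; congr 1; abel
  have h5 : ⟪ξY, h⟫ - ⟪ξZ, h⟫ = ρ * ‖ξY - ξZ‖ := by
    rw [← inner_sub_left, hh, real_inner_smul_right, real_inner_self_eq_norm_sq]; field_simp
  rw [hnh] at h2
  have h6 : ‖Z - Y‖ = 2 * ρ := by rw [hρ]; ring
  rw [h6] at h3 ⊢
  have h7 : ρ * ‖ξY - ξZ‖ ≤ ρ * (5 * C * ρ) := by nlinarith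
  have := le_of_mul_le_mul_left h7 hρpos
  linarith

theorem second_order_of_differentiable_selection {H : Type*} [NormedAddCommGroup H]
    [InnerProductSpace ℝ H] {w : H → ℝ} {C : ℝ} {ξ : H → H}
    (hup : ∀ X Y, w Y ≤ w X + ⟪ξ X, Y - X⟫ + C * ‖Y - X‖ ^ 2) {X : H} {L : H →L[ℝ] H}
    (hL : ∀ ε > 0, ∀ᶠ h in 𝓝 (0 : H), ‖ξ (X + h) - ξ X - L h‖ ≤ ε * ‖h‖) :
    ∀ ε > 0, ∀ᶠ h in 𝓝 (0 : H),
      |w (X + h) - w X - ⟪ξ X, h⟫ - 1 / 2 * ⟪L h, h⟫| ≤ ε * ‖h‖ ^ 2 := by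
  intro ε hε
  obtain ⟨r, hr, hball⟩ := Metric.eventually_nhds_iff.mp (hL ε hε)
  refine Metric.eventually_nhds_iff.mpr ⟨r, hr, fun h hh => ?_⟩
  rw [dist_zero_right] at hh
  have hb : ∀ σ ∈ Icc (0 : ℝ) 1, ‖ξ (X + σ • h) - ξ X - L (σ • h)‖ ≤ ε * ‖h‖ := by
    intro σ hσ
    have hn : ‖σ • h‖ ≤ ‖h‖ := by
      rw [norm_smul, Real.norm_of_nonneg hσ.1]
      exact mul_le_of_le_one_left (norm_nonneg _) hσ.2
    refine (hball (y := σ • h) ?_).trans (by gcongr)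
    rw [dist_zero_right]; exact hn.trans_lt hh
  have := abs_sub_le_of_partition
    (ψ := fun τ => w (X + τ • h) - τ * ⟪ξ X, h⟫ - 1 / 2 * τ ^ 2 * ⟪L h, h⟫)
    (M := ε * ‖h‖ ^ 2) (C := C * ‖h‖ ^ 2 + 1 / 2 * |⟪L h, h⟫|) ?_
  · simp only [one_smul, zero_smul, add_zero] at this
    convert this using 2
    ring
  intro σ hσ τ hτ
  have h1 := hup (X + σ • h) (X + τ • h)
  have e1 : X + τ • h - (X + σ • h) = (τ - σ) • h := by rw [sub_smul]; abel
  rw [e1, norm_smul, mul_pow, real_inner_smul_right, Real.norm_eq_abs, sq_abs] at h1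
  set r : H := ξ (X + σ • h) - ξ X - L (σ • h) with hrr
  have e2 : ξ (X + σ • h) = ξ X + σ • L h + r := by rw [hrr, map_smul]; abel
  rw [e2, inner_add_left, inner_add_left, real_inner_smul_left] at h1
  have h2 : |⟪r, h⟫| ≤ ε * ‖h‖ ^ 2 := by
    refine (abs_real_inner_le_norm _ _).trans ?_
    have := mul_le_mul_of_nonneg_right (hb σ hσ) (norm_nonneg h)
    nlinarith
  have h3 : (τ - σ) * ⟪r, h⟫ ≤ ε * ‖h‖ ^ 2 * |τ - σ| := by
    refine (le_abs_self _).trans ?_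
    rw [abs_mul, mul_comm]
    gcongr
  have h4 : -((τ - σ) ^ 2 * ⟪L h, h⟫) ≤ (τ - σ) ^ 2 * |⟪L h, h⟫| := by
    rw [← mul_neg]
    gcongr
    exact neg_le_abs _
  nlinarith

theorem exists_second_order_contact {H : Type*} [NormedAddCommGroup H] [InnerProductSpace ℝ H]
    [FiniteDimensional ℝ H] {w : H → ℝ} {C R κ : ℝ} {c : H} (hw : Continuous w) (hC : 0 ≤ C)
    (hR : 0 < R) (hκ : 0 < κ)
    (hsc : ∀ X, ∃ ξ : H, ∀ Y, w Y ≤ w X + ⟪ξ, Y - X⟫ + C * ‖Y - X‖ ^ 2)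
    (hmin : ∀ X, R ≤ ‖X - c‖ → ‖X - c‖ ≤ 2 * R → w c + κ ≤ w X) {q₀ : ℝ} (hq₀ : 0 < q₀) :
    ∃ (X q : H) (L : H →L[ℝ] H), ‖X - c‖ < R ∧ ‖q‖ ≤ q₀ ∧
      (∀ Y, ‖Y - c‖ ≤ 2 * R → w X + ⟪q, Y - X⟫ ≤ w Y) ∧
      ∀ ε > 0, ∀ᶠ h in 𝓝 (0 : H),
        |w (X + h) - w X - ⟪q, h⟫ - 1 / 2 * ⟪L h, h⟫| ≤ ε * ‖h‖ ^ 2 := by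
  choose ξ hξ using hsc
  set q₁ := min q₀ (κ / (3 * R)) with hq₁
  have hq₁pos : 0 < q₁ := lt_min hq₀ (by positivity)
  have hq₁κ : q₁ * (3 * R) ≤ κ := by
    have := min_le_right q₀ (κ / (3 * R))
    rwa [← hq₁, le_div_iff₀ (by positivity)] at this
  set K : Set H := {X | ‖X - c‖ < R ∧ ‖ξ X‖ ≤ q₁ ∧
    ∀ Y, ‖Y - c‖ ≤ 2 * R → w X + ⟪ξ X, Y - X⟫ ≤ w Y} with hK
  have hsurj : ball (0 : H) q₁ ⊆ ξ '' K := by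
    intro q hq
    rw [mem_ball_zero_iff] at hq
    obtain ⟨X, hXmem, hXmin⟩ := (isCompact_closedBall c (2 * R)).exists_isMinOn
      ⟨c, mem_closedBall_self (by positivity)⟩
      (f := fun Y => w Y - ⟪q, Y⟫) (by fun_prop)
    have hXm : ∀ Y, ‖Y - c‖ ≤ 2 * R → w X + ⟪q, Y - X⟫ ≤ w Y := by
      intro Y hY
      have := hXmin (a := Y) (by rwa [mem_closedBall_iff_norm])
      simp only [mem_ofPred_eq] at this
      rw [inner_sub_right]; linarith
    rw [mem_closedBall_iff_norm] at hXmem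
    have hXR : ‖X - c‖ < R := by
      by_contra hcon
      push Not at hcon
      have h1 := hmin X hcon hXmem
      have h2 := hXm c (by simp; positivity)
      have h3 : |⟪q, c - X⟫| ≤ ‖q‖ * ‖X - c‖ := by
        rw [norm_sub_rev]; exact abs_real_inner_le_norm _ _
      have h4 := (abs_le.mp h3).1
      nlinarith [norm_nonneg q, norm_nonneg (X - c), mul_le_mul hq.le hXmem (norm_nonneg _) hq₁pos.le,
        mul_pos hq₁pos hR]
    have hqe : q = ξ X := eq_of_contact hR hC (hξ X) (fun Y hY => hXm Y (by
      have : Y - c = (Y - X) + (X - c) := by abel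
      rw [this]; exact (norm_add_le _ _).trans (by linarith)))
    exact ⟨X, ⟨hXR, hqe ▸ hq.le, hqe ▸ hXm⟩, hqe.symm⟩
  have hLipK : ∀ Y ∈ K, ∀ Z, ‖Z - c‖ < R → ‖ξ Y - ξ Z‖ ≤ 5 / 2 * C * ‖Z - Y‖ := by
    intro Y hY Z hZ
    rcases eq_or_ne Z Y with rfl | hne
    · simp
    · exact norm_sub_le_of_contact hY.1 hZ (hξ Y) (hξ Z) hY.2.2 hne
  have hLip : LipschitzOnWith (Real.toNNReal (5 / 2 * C)) ξ K := by
    refine LipschitzOnWith.of_dist_le_mul fun Y hY Z hZ => ?_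
    rw [dist_eq_norm, dist_eq_norm, Real.coe_toNNReal _ (by positivity), norm_sub_rev Y Z]
    exact hLipK Y hY Z hZ.1
  obtain ⟨ξ', hξ'L, hξ'K⟩ := hLip.extend_finite_dimension
  set L' := lipschitzExtensionConstant H * Real.toNNReal (5 / 2 * C)
  let _ : MeasurableSpace H := borel H
  have : BorelSpace H := ⟨rfl⟩
  have hKpos : (μH[(Module.finrank ℝ H : ℝ)] : Measure H) K ≠ 0 := by
    intro h0
    have h1 := hLip.hausdorffMeasure_image_le (d := (Module.finrank ℝ H : ℝ)) (by positivity)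
    rw [h0, mul_zero] at h1
    have h2 := (measure_mono (μ := (μH[(Module.finrank ℝ H : ℝ)] : Measure H)) hsurj).trans h1
    have h3 := Metric.measure_ball_pos (μH[(Module.finrank ℝ H : ℝ)] : Measure H) (0 : H) hq₁pos
    exact absurd h2 (not_le.mpr h3)
  have hae1 := hξ'L.ae_differentiableAt (μ := (μH[(Module.finrank ℝ H : ℝ)] : Measure H))
  have hae2 := (lipschitz_infDist_pt K).ae_differentiableAt
    (μ := (μH[(Module.finrank ℝ H : ℝ)] : Measure H))
  obtain ⟨X, hXK, hX1, hX2⟩ : ∃ X ∈ K, DifferentiableAt ℝ ξ' X ∧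
      DifferentiableAt ℝ (fun x => infDist x K) X := by
    by_contra hcon
    push Not at hcon
    apply hKpos
    refine measure_mono_null (fun X hX => ?_) (ae_iff.mp (hae1.and hae2))
    simp only [mem_ofPred_eq, not_and]
    exact hcon X hX
  have hder0 : HasFDerivAt (fun x => infDist x K) (0 : H →L[ℝ] ℝ) X := by
    have hmin0 : IsLocalMin (fun x => infDist x K) X := by
      refine Eventually.of_forall fun Y => ?_
      simp only [infDist_zero_of_mem hXK]
      exact infDist_nonneg
    have := hX2.hasFDerivAt
    rwa [hmin0.hasFDerivAt_eq_zero this] at this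
  have hinf : ∀ ε > 0, ∀ᶠ h in 𝓝 (0 : H), infDist (X + h) K ≤ ε * ‖h‖ := by
    intro ε hε
    have := (hasFDerivAt_iff_isLittleO_nhds_zero.mp hder0).bound hε
    filter_upwards [this] with h hh
    simp only [infDist_zero_of_mem hXK, sub_zero, zero_apply] at hh
    exact (le_abs_self _).trans hh
  have hclose : ∀ Z, ‖Z - c‖ < R → ‖ξ Z - ξ' Z‖ ≤ (5 / 2 * C + L') * infDist Z K := by
    intro Z hZ
    have hall : ∀ Y ∈ K, ‖ξ Z - ξ' Z‖ ≤ (5 / 2 * C + L') * dist Z Y := by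
      intro Y hY
      have h1 := hLipK Y hY Z hZ
      have h2 := hξ'L.dist_le_mul Z Y
      have h3 : ξ Z - ξ' Z = -(ξ Y - ξ Z) - (ξ' Z - ξ' Y) := by rw [hξ'K hY]; abel
      rw [h3]
      refine (norm_sub_le _ _).trans ?_
      rw [norm_neg, add_mul, dist_eq_norm Z Y]
      rw [dist_eq_norm, dist_eq_norm] at h2
      exact add_le_add h1 h2
    rcases eq_or_lt_of_le (show (0 : ℝ) ≤ 5 / 2 * C + L' by positivity) with h0 | hpos
    · have := hall X hXK
      rw [← h0, zero_mul] at this ⊢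
      exact this
    · rw [← div_le_iff₀' hpos]
      rw [le_infDist ⟨X, hXK⟩]
      intro Y hY
      rw [div_le_iff₀' hpos]
      exact hall Y hY
  refine ⟨X, ξ X, fderiv ℝ ξ' X, hXK.1, hXK.2.1.trans (min_le_left _ _), hXK.2.2, ?_⟩
  apply second_order_of_differentiable_selection hξ
  intro ε hε
  have hpos : 0 < 5 / 2 * C + L' + 1 := by positivity
  have h1 := hinf (ε / 2 / (5 / 2 * C + L' + 1)) (by positivity)
  have h2 := (hasFDerivAt_iff_isLittleO_nhds_zero.mp hX1.hasFDerivAt).bound (half_pos hε)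
  have h3 : ∀ᶠ h in 𝓝 (0 : H), ‖X + h - c‖ < R := by
    have : Continuous fun h : H => ‖X + h - c‖ := by fun_prop
    exact this.tendsto 0 |>.eventually (gt_mem_nhds (by simpa using hXK.1))
  filter_upwards [h1, h2, h3] with h a1 a2 a3
  have a4 := hclose _ a3
  have e1 : ξ (X + h) - ξ X - fderiv ℝ ξ' X h =
      (ξ (X + h) - ξ' (X + h)) + (ξ' (X + h) - ξ' X - fderiv ℝ ξ' X h) := by
    rw [hξ'K hXK]; abel
  rw [e1]
  refine (norm_add_le _ _).trans ?_
  have a5 : (5 / 2 * C + L') * infDist (X + h) K ≤ ε / 2 * ‖h‖ := by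
    calc (5 / 2 * C + L') * infDist (X + h) K
        ≤ (5 / 2 * C + L' + 1) * (ε / 2 / (5 / 2 * C + L' + 1) * ‖h‖) := by
          refine mul_le_mul (by linarith) a1 infDist_nonneg hpos.le
      _ = ε / 2 * ‖h‖ := by field_simp
  linarith

/-- `f` has the second-order lower jet `(ξ, A)` at `y`. -/
def HasLowerJet {V : Type*} [NormedAddCommGroup V] [InnerProductSpace ℝ V]
    (f : V → ℝ) (y ξ : V) (A : V →L[ℝ] V) : Prop :=
  ∀ ε > 0, ∀ᶠ h in 𝓝 (0 : V), f y + ⟪ξ, h⟫ + 1 / 2 * ⟪A h, h⟫ - ε * ‖h‖ ^ 2 ≤ f (y + h)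

/-- The inf-convolution of `f` over the closed ball of radius `s`. -/
def infConv {V : Type*} [NormedAddCommGroup V] (f : V → ℝ) (s ε : ℝ) (Z : V) : ℝ :=
  sInf ((fun Y => f Y + ‖Z - Y‖ ^ 2 / (2 * ε)) '' closedBall 0 s)

section infConv
variable {V : Type*} [NormedAddCommGroup V] [InnerProductSpace ℝ V] [FiniteDimensional ℝ V]

theorem continuous_infConv {f : V → ℝ} (hf : Continuous f) (s ε : ℝ) :
    Continuous (infConv f s ε) := by
  refine (isCompact_closedBall (0 : V) s).continuous_sInf
    (f := fun Z Y => f Y + ‖Z - Y‖ ^ 2 / (2 * ε)) ?_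
  simp only [Function.HasUncurry.uncurry, id]
  fun_prop

theorem infConv_le {f : V → ℝ} (hf : Continuous f) {s ε : ℝ} (Z : V) {Y : V} (hY : ‖Y‖ ≤ s) :
    infConv f s ε Z ≤ f Y + ‖Z - Y‖ ^ 2 / (2 * ε) := by
  refine csInf_le ?_ ⟨Y, by simpa using hY, rfl⟩
  exact ((isCompact_closedBall (0 : V) s).image (by fun_prop)).bddBelow

theorem exists_infConv_eq {f : V → ℝ} (hf : Continuous f) {s : ℝ} (hs : 0 ≤ s) (ε : ℝ) (Z : V) :
    ∃ Y, ‖Y‖ ≤ s ∧ infConv f s ε Z = f Y + ‖Z - Y‖ ^ 2 / (2 * ε) := by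
  obtain ⟨Y, hY, h⟩ := (isCompact_closedBall (0 : V) s).exists_sInf_image_eq
    ⟨0, by simpa using hs⟩ (f := fun Y => f Y + ‖Z - Y‖ ^ 2 / (2 * ε)) (by fun_prop)
  exact ⟨Y, by simpa using hY, h⟩

theorem infConv_le_paraboloid {f : V → ℝ} (hf : Continuous f) {s ε : ℝ} (hε : 0 < ε) {Z Y : V}
    (hY : ‖Y‖ ≤ s) (h : infConv f s ε Z = f Y + ‖Z - Y‖ ^ 2 / (2 * ε)) (Z' : V) :
    infConv f s ε Z' ≤ infConv f s ε Z + ⟪(1 / ε) • (Z - Y), Z' - Z⟫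
      + 1 / (2 * ε) * ‖Z' - Z‖ ^ 2 := by
  refine (infConv_le hf Z' hY).trans ?_
  have e : Z' - Y = (Z - Y) + (Z' - Z) := by abel
  rw [h, e, norm_add_sq_real, real_inner_smul_left]
  apply le_of_eq
  field_simp
  ring

theorem norm_sub_sq_le_of_infConv_eq {f : V → ℝ} (hf : Continuous f) {s ε M : ℝ} (hε : 0 < ε)
    (hM : ∀ Y, ‖Y‖ ≤ s → |f Y| ≤ M) {Z Y : V} (hZ : ‖Z‖ ≤ s)
    (hY : ‖Y‖ ≤ s) (h : infConv f s ε Z = f Y + ‖Z - Y‖ ^ 2 / (2 * ε)) :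
    ‖Z - Y‖ ^ 2 ≤ 4 * M * ε := by
  have h1 := infConv_le hf (ε := ε) Z hZ
  rw [h, sub_self, norm_zero] at h1
  have h2 := (abs_le.mp (hM Y hY)).1
  have h3 := (abs_le.mp (hM Z hZ)).2
  have h4 : ‖Z - Y‖ ^ 2 / (2 * ε) ≤ 2 * M := by
    have : (0 : ℝ) ^ 2 / (2 * ε) = 0 := by simp
    linarith
  rw [div_le_iff₀ (by positivity)] at h4
  linarith

theorem HasLowerJet.of_infConv {f : V → ℝ} (hf : Continuous f) {s ε : ℝ} {Z Y ξ : V}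
    {A : V →L[ℝ] V} (hY : ‖Y‖ < s) (h : infConv f s ε Z = f Y + ‖Z - Y‖ ^ 2 / (2 * ε))
    (hjet : HasLowerJet (infConv f s ε) Z ξ A) : HasLowerJet f Y ξ A := by
  intro δ hδ
  have hev : ∀ᶠ k in 𝓝 (0 : V), ‖Y + k‖ < s := by
    have : Continuous fun k : V => ‖Y + k‖ := by fun_prop
    exact this.tendsto 0 |>.eventually (gt_mem_nhds (by simpa using hY))
  filter_upwards [hjet δ hδ, hev] with k h1 h2
  have h3 := infConv_le hf (ε := ε) (Z + k) h2.le
  rw [h] at h1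
  rw [show Z + k - (Y + k) = Z - Y by abel] at h3
  linarith
end infConv

section sums
variable {V : Type*} [NormedAddCommGroup V] [InnerProductSpace ℝ V]

/-- The quadratic polynomial `⟪P, X⟫ + ½⟪Q X, X⟫ + c‖X‖²`. -/
def quadPoly {H : Type*} [NormedAddCommGroup H] [InnerProductSpace ℝ H] (P : H) (Q : H →L[ℝ] H)
    (c : ℝ) (X : H) : ℝ := ⟪P, X⟫ + 1 / 2 * ⟪Q X, X⟫ + c * ‖X‖ ^ 2

theorem quadPoly_add {H : Type*} [NormedAddCommGroup H] [InnerProductSpace ℝ H] [CompleteSpace H]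
    (P : H) (Q : H →L[ℝ] H)
    (c : ℝ) (X h : H) : quadPoly P Q c (X + h) = quadPoly P Q c X
      + ⟪P + (1 / 2 : ℝ) • (Q X + ContinuousLinearMap.adjoint Q X) + (2 * c) • X, h⟫
      + 1 / 2 * ⟪Q h, h⟫ + c * ‖h‖ ^ 2 := by
  simp only [quadPoly, map_add, inner_add_left, inner_add_right, real_inner_smul_left,
    ContinuousLinearMap.adjoint_inner_left, norm_add_sq_real]
  rw [real_inner_comm X (Q h)]
  ring

theorem norm_quadPoly_grad_sub_le {H : Type*} [NormedAddCommGroup H] [InnerProductSpace ℝ H]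
    [CompleteSpace H] (Q : H →L[ℝ] H) {c : ℝ} (hc : 0 ≤ c) (X : H) :
    ‖(1 / 2 : ℝ) • (Q X + ContinuousLinearMap.adjoint Q X) + (2 * c) • X‖
      ≤ (‖Q‖ + 2 * c) * ‖X‖ := by
  have h1 := Q.le_opNorm X
  have h2 := (ContinuousLinearMap.adjoint Q).le_opNorm X
  rw [LinearIsometryEquiv.norm_map] at h2
  refine (norm_add_le _ _).trans ?_
  rw [norm_smul, norm_smul, Real.norm_of_nonneg (by norm_num : (0 : ℝ) ≤ 1 / 2),
    Real.norm_of_nonneg (by positivity : (0 : ℝ) ≤ 2 * c)]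
  have h3 := norm_add_le (Q X) (ContinuousLinearMap.adjoint Q X)
  nlinarith

theorem abs_quadPoly_sub_le {H : Type*} [NormedAddCommGroup H] [InnerProductSpace ℝ H]
    [CompleteSpace H] (P : H) (Q : H →L[ℝ] H) {c ρ : ℝ} (hc : 0 ≤ c) {X Y : H} (hX : ‖X‖ ≤ ρ)
    (hY : ‖Y‖ ≤ ρ) :
    |quadPoly P Q c X - quadPoly P Q c Y| ≤ (‖P‖ + 2 * (‖Q‖ + 2 * c) * ρ) * ‖X - Y‖ := by
  have h0 : X = Y + (X - Y) := by abel
  have h1 : quadPoly P Q c X - quadPoly P Q c Y =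
      ⟪P, X - Y⟫ + ⟪(1 / 2 : ℝ) • (Q Y + ContinuousLinearMap.adjoint Q Y) + (2 * c) • Y, X - Y⟫
      + 1 / 2 * ⟪Q (X - Y), X - Y⟫ + c * ‖X - Y‖ ^ 2 := by
    conv_lhs => rw [h0]
    rw [quadPoly_add, ← inner_add_left]
    rw [← add_assoc P]; ring
  have h2 : ‖X - Y‖ ≤ 2 * ρ := (norm_sub_le _ _).trans (by linarith)
  have a1 := abs_real_inner_le_norm P (X - Y)
  have a2 := abs_real_inner_le_norm ((1 / 2 : ℝ) • (Q Y + ContinuousLinearMap.adjoint Q Y)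
    + (2 * c) • Y) (X - Y)
  have a3 := abs_real_inner_le_norm (Q (X - Y)) (X - Y)
  have b2 := norm_quadPoly_grad_sub_le Q hc Y
  have b3 := Q.le_opNorm (X - Y)
  have n0 := norm_nonneg (X - Y)
  have n1 := norm_nonneg Q
  have c2 : |⟪(1 / 2 : ℝ) • (Q Y + ContinuousLinearMap.adjoint Q Y) + (2 * c) • Y, X - Y⟫|
      ≤ (‖Q‖ + 2 * c) * ρ * ‖X - Y‖ :=
    a2.trans (mul_le_mul_of_nonneg_right (b2.trans (by gcongr)) n0)
  have c3 : |⟪Q (X - Y), X - Y⟫| ≤ ‖Q‖ * (2 * ρ) * ‖X - Y‖ :=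
    a3.trans (mul_le_mul_of_nonneg_right (b3.trans (by gcongr)) n0)
  have c4 : |c * ‖X - Y‖ ^ 2| ≤ c * (2 * ρ) * ‖X - Y‖ := by
    rw [abs_of_nonneg (by positivity), pow_two, ← mul_assoc]; gcongr
  rw [h1]
  refine (abs_add_le _ _).trans ?_
  refine (add_le_add_left ((abs_add_le _ _).trans (add_le_add_left (abs_add_le _ _) _)) _).trans ?_
  rw [abs_mul, abs_of_pos (by norm_num : (0 : ℝ) < 1 / 2)]
  nlinarith
end sums

/-- The inclusion of the first factor in the `L²` product. -/
def inlL2 (V : Type*) [NormedAddCommGroup V] [InnerProductSpace ℝ V] : V →L[ℝ] WithLp 2 (V × V) :=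
  (WithLp.prodContinuousLinearEquiv 2 ℝ V V).symm.toContinuousLinearMap.comp
    (ContinuousLinearMap.inl ℝ V V)

/-- The inclusion of the second factor in the `L²` product. -/
def inrL2 (V : Type*) [NormedAddCommGroup V] [InnerProductSpace ℝ V] : V →L[ℝ] WithLp 2 (V × V) :=
  (WithLp.prodContinuousLinearEquiv 2 ℝ V V).symm.toContinuousLinearMap.comp
    (ContinuousLinearMap.inr ℝ V V)

section
variable {V : Type*} [NormedAddCommGroup V] [InnerProductSpace ℝ V]

@[simp] theorem inlL2_fst (v : V) : (inlL2 V v).fst = v := rfl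
@[simp] theorem inlL2_snd (v : V) : (inlL2 V v).snd = 0 := rfl
@[simp] theorem inrL2_fst (v : V) : (inrL2 V v).fst = 0 := rfl
@[simp] theorem inrL2_snd (v : V) : (inrL2 V v).snd = v := rfl

theorem norm_inlL2 (v : V) : ‖inlL2 V v‖ = ‖v‖ := by
  have := WithLp.prod_norm_sq_eq_of_L2 (inlL2 V v)
  simp only [inlL2_fst, inlL2_snd, norm_zero] at this
  exact (sq_eq_sq₀ (norm_nonneg _) (norm_nonneg _)).mp (by linarith)

theorem norm_inrL2 (v : V) : ‖inrL2 V v‖ = ‖v‖ := by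
  have := WithLp.prod_norm_sq_eq_of_L2 (inrL2 V v)
  simp only [inrL2_fst, inrL2_snd, norm_zero] at this
  exact (sq_eq_sq₀ (norm_nonneg _) (norm_nonneg _)).mp (by linarith)

theorem inlL2_add_inrL2 (h : WithLp 2 (V × V)) : inlL2 V h.fst + inrL2 V h.snd = h := by
  apply (WithLp.prodContinuousLinearEquiv 2 ℝ V V).injective
  ext
  · change h.fst + 0 = h.fst
    simp
  · change 0 + h.snd = h.snd
    simp

theorem norm_fstL2_le {V : Type*} [NormedAddCommGroup V] (h : WithLp 2 (V × V)) : ‖h.fst‖ ≤ ‖h‖ := by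
  have := WithLp.prod_norm_sq_eq_of_L2 h
  exact (sq_le_sq₀ (norm_nonneg _) (norm_nonneg _)).mp (by nlinarith [sq_nonneg ‖h.snd‖])

theorem norm_sndL2_le {V : Type*} [NormedAddCommGroup V] (h : WithLp 2 (V × V)) : ‖h.snd‖ ≤ ‖h‖ := by
  have := WithLp.prod_norm_sq_eq_of_L2 h
  exact (sq_le_sq₀ (norm_nonneg _) (norm_nonneg _)).mp (by nlinarith [sq_nonneg ‖h.fst‖])

theorem inner_inlL2_right (x : WithLp 2 (V × V)) (v : V) : ⟪x, inlL2 V v⟫ = ⟪x.fst, v⟫ := by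
  rw [WithLp.prod_inner_apply]
  change ⟪x.fst, v⟫ + ⟪x.snd, (0 : V)⟫ = _
  rw [inner_zero_right, add_zero]

theorem inner_inrL2_right (x : WithLp 2 (V × V)) (v : V) : ⟪x, inrL2 V v⟫ = ⟪x.snd, v⟫ := by
  rw [WithLp.prod_inner_apply]
  change ⟪x.fst, (0 : V)⟫ + ⟪x.snd, v⟫ = _
  rw [inner_zero_right, zero_add]

theorem HasLowerJet.congr {f f' : V → ℝ} {y ξ : V} {A : V →L[ℝ] V} (h : HasLowerJet f y ξ A)
    (he : f =ᶠ[𝓝 y] f') : HasLowerJet f' y ξ A := by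
  intro ε hε
  have ht : Tendsto (fun k : V => y + k) (𝓝 0) (𝓝 y) := by
    have : Continuous fun k : V => y + k := by fun_prop
    simpa using this.tendsto 0
  filter_upwards [h ε hε, ht.eventually he] with k h1 h2
  rw [← h2, ← he.self_of_nhds]; exact h1

theorem exists_continuous_eqOn_closedBall {V : Type*} [NormedAddCommGroup V] {f : V → ℝ} {a : V} {r : ℝ}
    (hf : ContinuousOn f (closedBall a r)) :
    ∃ f' : V → ℝ, Continuous f' ∧ EqOn f' f (closedBall a r) := by
  obtain ⟨g, hg⟩ := ContinuousMap.exists_restrict_eq (Metric.isClosed_closedBall (x := a) (ε := r))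
    ⟨_, hf.domRestrict⟩
  refine ⟨g, g.continuous, fun x hx => ?_⟩
  exact congrArg (fun k => k ⟨x, hx⟩) hg

variable [FiniteDimensional ℝ V]

theorem adjoint_inlL2 (x : WithLp 2 (V × V)) :
    ContinuousLinearMap.adjoint (inlL2 V) x = x.fst := by
  refine ext_inner_right ℝ fun v => ?_
  rw [ContinuousLinearMap.adjoint_inner_left, inner_inlL2_right]

theorem adjoint_inrL2 (x : WithLp 2 (V × V)) :
    ContinuousLinearMap.adjoint (inrL2 V) x = x.snd := by
  refine ext_inner_right ℝ fun v => ?_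
  rw [ContinuousLinearMap.adjoint_inner_left, inner_inrL2_right]

theorem restrict_expansion {H : Type*} [NormedAddCommGroup H] [InnerProductSpace ℝ H]
    [CompleteSpace H] {W : H → ℝ} {F : V → ℝ} {P q X : H} {Q L : H →L[ℝ] H} {c k : ℝ}
    {y : V} (ι : V →L[ℝ] H) (hι : ∀ v, ‖ι v‖ = ‖v‖)
    (hF : ∀ h, F (y + h) = W (X + ι h) - quadPoly P Q c (X + ι h) + k)
    (hW : ∀ ε > 0, ∀ᶠ h in 𝓝 (0 : H),
        |W (X + h) - W X - ⟪q, h⟫ - 1 / 2 * ⟪L h, h⟫| ≤ ε * ‖h‖ ^ 2) :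
    ∀ ε > 0, ∀ᶠ h in 𝓝 (0 : V),
      |F (y + h) - F y - ⟪ContinuousLinearMap.adjoint ι
          (q - (P + (1 / 2 : ℝ) • (Q X + ContinuousLinearMap.adjoint Q X) + (2 * c) • X)), h⟫
        - 1 / 2 * ⟪((ContinuousLinearMap.adjoint ι).comp
          ((L - Q - (2 * c) • ContinuousLinearMap.id ℝ H).comp ι)) h, h⟫| ≤ ε * ‖h‖ ^ 2 := by
  intro ε hε
  have ht : Tendsto ι (𝓝 0) (𝓝 0) := by
    have := ι.continuous.tendsto 0
    rwa [map_zero] at this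
  filter_upwards [ht.eventually (hW ε hε)] with h hh
  rw [hι] at hh
  convert hh using 2
  have h0 := hF 0
  rw [map_zero, add_zero, add_zero] at h0
  rw [hF h, h0, quadPoly_add]
  simp only [ContinuousLinearMap.comp_apply, ContinuousLinearMap.adjoint_inner_left, sub_apply,
    smul_apply, ContinuousLinearMap.id_apply, inner_sub_left, real_inner_smul_left,
    real_inner_self_eq_norm_sq]
  ring

set_option maxHeartbeats 1000000 in
theorem exists_jets_of_min_zero {f g : V → ℝ} (hf : Continuous f) (hg : Continuous g)
    {P : WithLp 2 (V × V)} {Q : WithLp 2 (V × V) →L[ℝ] WithLp 2 (V × V)}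
    (hmin : ∀ ε > 0, ∀ᶠ h in 𝓝 (0 : WithLp 2 (V × V)),
      f 0 + g 0 ≤ f h.fst + g h.snd + ⟪P, h⟫ + 1 / 2 * ⟪Q h, h⟫ + ε * ‖h‖ ^ 2)
    {η : ℝ} (hη : 0 < η) :
    ∃ (y₁ y₂ ξ ζ : V) (A B : V →L[ℝ] V), ‖y₁‖ ≤ η ∧ ‖y₂‖ ≤ η ∧ ‖ξ + P.fst‖ ≤ η ∧
      ‖ζ + P.snd‖ ≤ η ∧ HasLowerJet f y₁ ξ A ∧ HasLowerJet g y₂ ζ B ∧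
      ∀ h : WithLp 2 (V × V),
        0 ≤ ⟪A h.fst, h.fst⟫ + ⟪B h.snd, h.snd⟫ + ⟪Q h, h⟫ + η * ‖h‖ ^ 2 := by
  set c : ℝ := η / 4 with hc
  have hc0 : 0 < c := by positivity
  obtain ⟨ρ, hρ, hball⟩ := Metric.eventually_nhds_iff.mp (hmin (c / 2) (by positivity))
  -- the localisation radius
  set s : ℝ := min (ρ / 3) (min η (η / (2 * (‖Q‖ + 2 * c)))) with hs
  have hs0 : 0 < s := by
    refine lt_min (by positivity) (lt_min hη ?_)
    positivity
  have hsρ : 3 * s ≤ ρ := by have := min_le_left (ρ / 3) (min η (η / (2 * (‖Q‖ + 2 * c)))); linarith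
  have hsη : s ≤ η := (min_le_right _ _).trans (min_le_left _ _)
  have hsQ : (‖Q‖ + 2 * c) * s ≤ η / 2 := by
    have : s ≤ η / (2 * (‖Q‖ + 2 * c)) := (min_le_right _ _).trans (min_le_right _ _)
    rw [le_div_iff₀ (by positivity)] at this
    linarith
  set R : ℝ := s / 2 with hR
  have hR0 : 0 < R := by positivity
  obtain ⟨M₁, hM₁⟩ := (isCompact_closedBall (0 : V) s).exists_bound_of_continuousOn hf.continuousOn
  obtain ⟨M₂, hM₂⟩ := (isCompact_closedBall (0 : V) s).exists_bound_of_continuousOn hg.continuousOn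
  set M : ℝ := max (max M₁ M₂) 1 with hM
  have hM0 : 0 < M := lt_of_lt_of_le one_pos (le_max_right _ _)
  have hMf : ∀ Y, ‖Y‖ ≤ s → |f Y| ≤ M := fun Y hY =>
    (hM₁ Y (by simpa using hY)).trans ((le_max_left _ _).trans (le_max_left _ _))
  have hMg : ∀ Y, ‖Y‖ ≤ s → |g Y| ≤ M := fun Y hY =>
    (hM₂ Y (by simpa using hY)).trans ((le_max_right _ _).trans (le_max_left _ _))
  set Λ : ℝ := ‖P‖ + 2 * (‖Q‖ + 2 * c) * (2 * s) with hΛ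
  have hΛ0 : 0 ≤ Λ := by positivity
  set θ : ℝ := min (R / 4) (c * R ^ 2 / (8 * (Λ + 1))) with hθ
  have hθ0 : 0 < θ := lt_min (by positivity) (by positivity)
  have hθR : θ ≤ R / 4 := min_le_left _ _
  have hθΛ : Λ * θ ≤ c * R ^ 2 / 8 := by
    have : θ ≤ c * R ^ 2 / (8 * (Λ + 1)) := min_le_right _ _
    rw [le_div_iff₀ (by positivity)] at this
    nlinarith
  set ε : ℝ := θ ^ 2 / (8 * M) with hε
  have hε0 : 0 < ε := by positivity
  have hMε : 4 * M * ε = θ ^ 2 / 2 := by rw [hε]; field_simp; norm_num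
  set w : WithLp 2 (V × V) → ℝ := fun X =>
    infConv f s ε X.fst + infConv g s ε X.snd + quadPoly P Q c X with hw
  have hwc : Continuous w := by
    have h1 : Continuous fun X : WithLp 2 (V × V) => X.fst := by
      exact (WithLp.prod_continuous_ofLp 2 V V).fst
    have h2 : Continuous fun X : WithLp 2 (V × V) => X.snd := by
      exact (WithLp.prod_continuous_ofLp 2 V V).snd
    have h3 := (continuous_infConv hf s ε).comp h1
    have h4 := (continuous_infConv hg s ε).comp h2
    have h5 : Continuous fun X : WithLp 2 (V × V) => quadPoly P Q c X := by
      unfold quadPoly; fun_prop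
    exact (h3.add h4).add h5
  have hsc : ∀ X, ∃ ξ : WithLp 2 (V × V), ∀ Y, w Y ≤ w X + ⟪ξ, Y - X⟫
      + (1 / (2 * ε) + 1 / 2 * ‖Q‖ + c) * ‖Y - X‖ ^ 2 := by
    intro X
    obtain ⟨Y₁, hY₁, e₁⟩ := exists_infConv_eq hf hs0.le ε X.fst
    obtain ⟨Y₂, hY₂, e₂⟩ := exists_infConv_eq hg hs0.le ε X.snd
    refine ⟨inlL2 V ((1 / ε) • (X.fst - Y₁)) + inrL2 V ((1 / ε) • (X.snd - Y₂)) +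
      (P + (1 / 2 : ℝ) • (Q X + ContinuousLinearMap.adjoint Q X) + (2 * c) • X), fun Y => ?_⟩
    have b₁ := infConv_le_paraboloid hf hε0 hY₁ e₁ Y.fst
    have b₂ := infConv_le_paraboloid hg hε0 hY₂ e₂ Y.snd
    have b₃ := quadPoly_add P Q c X (Y - X)
    rw [add_sub_cancel] at b₃
    have b₄ : ⟪Q (Y - X), Y - X⟫ ≤ ‖Q‖ * ‖Y - X‖ ^ 2 := by
      refine (real_inner_le_norm _ _).trans ?_
      have := mul_le_mul_of_nonneg_right (Q.le_opNorm (Y - X)) (norm_nonneg (Y - X))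
      nlinarith
    have b₅ := WithLp.prod_norm_sq_eq_of_L2 (Y - X)
    have b₆ : (Y - X).fst = Y.fst - X.fst := rfl
    have b₇ : (Y - X).snd = Y.snd - X.snd := rfl
    simp only [hw]
    rw [inner_add_left, inner_add_left, real_inner_comm, inner_inlL2_right,
      real_inner_comm _ (inrL2 V _), inner_inrL2_right, b₆, b₇, real_inner_comm,
      real_inner_comm (_ • _) (Y.snd - X.snd), b₃]
    rw [b₆, b₇] at b₅
    have b₈ : 1 / (2 * ε) * ‖Y - X‖ ^ 2 = 1 / (2 * ε) * ‖Y.fst - X.fst‖ ^ 2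
      + 1 / (2 * ε) * ‖Y.snd - X.snd‖ ^ 2 := by rw [b₅]; ring
    linarith
  -- closeness of the points realising the inf-convolutions
  have hnear : ∀ X : WithLp 2 (V × V), ‖X‖ ≤ s → ∀ Y₁ Y₂ : V, ‖Y₁‖ ≤ s → ‖Y₂‖ ≤ s →
      infConv f s ε X.fst = f Y₁ + ‖X.fst - Y₁‖ ^ 2 / (2 * ε) →
      infConv g s ε X.snd = g Y₂ + ‖X.snd - Y₂‖ ^ 2 / (2 * ε) →
      ‖X - (inlL2 V Y₁ + inrL2 V Y₂)‖ ≤ θ := by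
    intro X hX Y₁ Y₂ hY₁ hY₂ e₁ e₂
    have h1 := norm_sub_sq_le_of_infConv_eq hf hε0 hMf ((norm_fstL2_le X).trans hX) hY₁ e₁
    have h2 := norm_sub_sq_le_of_infConv_eq hg hε0 hMg ((norm_sndL2_le X).trans hX) hY₂ e₂
    have h3 := WithLp.prod_norm_sq_eq_of_L2 (X - (inlL2 V Y₁ + inrL2 V Y₂))
    have h4 : (X - (inlL2 V Y₁ + inrL2 V Y₂)).fst = X.fst - Y₁ := by
      change X.fst - (Y₁ + 0) = _; rw [add_zero]
    have h5 : (X - (inlL2 V Y₁ + inrL2 V Y₂)).snd = X.snd - Y₂ := by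
      change X.snd - (0 + Y₂) = _; rw [zero_add]
    rw [h4, h5] at h3
    exact (sq_le_sq₀ (norm_nonneg _) hθ0.le).mp (by linarith)
  have hwmin : ∀ X, R ≤ ‖X - 0‖ → ‖X - 0‖ ≤ 2 * R → w 0 + c * R ^ 2 / 8 ≤ w X := by
    intro X hX1 hX2
    rw [sub_zero] at hX1 hX2
    have hXs : ‖X‖ ≤ s := by rw [hR] at hX2; linarith
    obtain ⟨Y₁, hY₁, e₁⟩ := exists_infConv_eq hf hs0.le ε X.fst
    obtain ⟨Y₂, hY₂, e₂⟩ := exists_infConv_eq hg hs0.le ε X.snd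
    have hn := hnear X hXs Y₁ Y₂ hY₁ hY₂ e₁ e₂
    set Y := inlL2 V Y₁ + inrL2 V Y₂ with hY
    have f1 : Y.fst = Y₁ := by change Y₁ + 0 = _; rw [add_zero]
    have f2 : Y.snd = Y₂ := by change 0 + Y₂ = _; rw [zero_add]
    have hYs : ‖Y‖ ≤ 2 * s := by
      refine (norm_add_le _ _).trans ?_
      rw [norm_inlL2, norm_inrL2]; linarith
    have hYR : R - θ ≤ ‖Y‖ := by
      have := norm_sub_norm_le X Y
      linarith
    have b1 := hball (y := Y) (by rw [dist_zero_right]; linarith)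
    rw [f1, f2] at b1
    have b2 := abs_le.mp (abs_quadPoly_sub_le P Q hc0.le (hXs.trans (by linarith)) hYs)
    have b3 : Λ * ‖X - Y‖ ≤ c * R ^ 2 / 8 := (mul_le_mul_of_nonneg_left hn hΛ0).trans hθΛ
    have b4 : w 0 ≤ f 0 + g 0 := by
      have c1 := infConv_le hf (ε := ε) (0 : V) (Y := 0) (by simpa using hs0.le)
      have c2 := infConv_le hg (ε := ε) (0 : V) (Y := 0) (by simpa using hs0.le)
      have c3 : quadPoly P Q c 0 = 0 := by simp [quadPoly]
      simp only [sub_self, norm_zero, ne_eq, OfNat.ofNat_ne_zero, not_false_eq_true, zero_pow,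
        zero_div, add_zero] at c1 c2
      change infConv f s ε 0 + infConv g s ε 0 + quadPoly P Q c 0 ≤ _
      rw [c3]; linarith
    have b5 : w X = f Y₁ + ‖X.fst - Y₁‖ ^ 2 / (2 * ε) + (g Y₂ + ‖X.snd - Y₂‖ ^ 2 / (2 * ε))
        + quadPoly P Q c X := by simp only [hw]; rw [e₁, e₂]
    have b6 : 0 ≤ ‖X.fst - Y₁‖ ^ 2 / (2 * ε) := by positivity
    have b7 : 0 ≤ ‖X.snd - Y₂‖ ^ 2 / (2 * ε) := by positivity
    have b8 : quadPoly P Q c Y = ⟪P, Y⟫ + 1 / 2 * ⟪Q Y, Y⟫ + c * ‖Y‖ ^ 2 := rfl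
    have b9 : (3 / 4 * R) ^ 2 ≤ ‖Y‖ ^ 2 := by
      apply pow_le_pow_left₀ (by positivity); linarith
    have b10 := mul_le_mul_of_nonneg_left b9 hc0.le
    have b11 : 0 ≤ c * R ^ 2 := by positivity
    nlinarith [b2.1]
  obtain ⟨X, q, L, hXR, hq, hcontact, hexp⟩ := exists_second_order_contact hwc
    (by positivity) hR0 (by positivity) hsc hwmin (q₀ := η / 2) (by positivity)
  rw [sub_zero] at hXR
  have hXs : ‖X‖ ≤ s := by rw [hR] at hXR; linarith
  obtain ⟨Y₁, hY₁, e₁⟩ := exists_infConv_eq hf hs0.le ε X.fst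
  obtain ⟨Y₂, hY₂, e₂⟩ := exists_infConv_eq hg hs0.le ε X.snd
  have hn := hnear X hXs Y₁ Y₂ hY₁ hY₂ e₁ e₂
  have hYlt : ‖inlL2 V Y₁ + inrL2 V Y₂‖ < s := by
    have := norm_sub_norm_le (inlL2 V Y₁ + inrL2 V Y₂) X
    rw [norm_sub_rev] at this
    linarith
  have hY₁lt : ‖Y₁‖ < s := by
    refine lt_of_le_of_lt ?_ hYlt
    have := norm_fstL2_le (inlL2 V Y₁ + inrL2 V Y₂)
    change ‖Y₁ + 0‖ ≤ _ at this
    rwa [add_zero] at this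
  have hY₂lt : ‖Y₂‖ < s := by
    refine lt_of_le_of_lt ?_ hYlt
    have := norm_sndL2_le (inlL2 V Y₁ + inrL2 V Y₂)
    change ‖0 + Y₂‖ ≤ _ at this
    rwa [zero_add] at this
  have hF := restrict_expansion (F := infConv f s ε) (y := X.fst) (inlL2 V) norm_inlL2
    (k := -infConv g s ε X.snd) (c := c) (P := P) (Q := Q) (fun h => by
      change _ = (infConv f s ε (X.fst + h) + infConv g s ε (X.snd + 0) + quadPoly P Q c _) - _ + _
      rw [add_zero]; ring) hexp
  have hG := restrict_expansion (F := infConv g s ε) (y := X.snd) (inrL2 V) norm_inrL2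
    (k := -infConv f s ε X.fst) (c := c) (P := P) (Q := Q) (fun h => by
      change _ = (infConv f s ε (X.fst + 0) + infConv g s ε (X.snd + h) + quadPoly P Q c _) - _ + _
      rw [add_zero]; ring) hexp
  set D := P + (1 / 2 : ℝ) • (Q X + ContinuousLinearMap.adjoint Q X) + (2 * c) • X with hD
  set A := (ContinuousLinearMap.adjoint (inlL2 V)).comp
    ((L - Q - (2 * c) • ContinuousLinearMap.id ℝ (WithLp 2 (V × V))).comp (inlL2 V)) with hA
  set B := (ContinuousLinearMap.adjoint (inrL2 V)).comp
    ((L - Q - (2 * c) • ContinuousLinearMap.id ℝ (WithLp 2 (V × V))).comp (inrL2 V)) with hB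
  have hDP : ‖q - D + P‖ ≤ η := by
    have h1 := norm_quadPoly_grad_sub_le Q hc0.le X
    have h2 : q - D + P = q - ((1 / 2 : ℝ) • (Q X + ContinuousLinearMap.adjoint Q X)
      + (2 * c) • X) := by rw [hD]; abel
    rw [h2]
    refine (norm_sub_le _ _).trans ?_
    have h3 : (‖Q‖ + 2 * c) * ‖X‖ ≤ (‖Q‖ + 2 * c) * s := by gcongr
    linarith
  refine ⟨Y₁, Y₂, ContinuousLinearMap.adjoint (inlL2 V) (q - D),
    ContinuousLinearMap.adjoint (inrL2 V) (q - D), A, B, hY₁.trans hsη, hY₂.trans hsη, ?_, ?_,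
    ?_, ?_, ?_⟩
  · rw [adjoint_inlL2]
    exact (norm_fstL2_le (q - D + P)).trans hDP
  · rw [adjoint_inrL2]
    exact (norm_sndL2_le (q - D + P)).trans hDP
  · refine HasLowerJet.of_infConv hf hY₁lt e₁ fun δ hδ => ?_
    filter_upwards [hF δ hδ] with h hh
    linarith [(abs_le.mp hh).1]
  · refine HasLowerJet.of_infConv hg hY₂lt e₂ fun δ hδ => ?_
    filter_upwards [hG δ hδ] with h hh
    linarith [(abs_le.mp hh).1]
  · intro h
    have t1 : Tendsto (fun t : ℝ => t • h.fst) (𝓝 0) (𝓝 0) := by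
      have : Continuous fun t : ℝ => t • h.fst := by fun_prop
      simpa using this.tendsto 0
    have t2 : Tendsto (fun t : ℝ => t • h.snd) (𝓝 0) (𝓝 0) := by
      have : Continuous fun t : ℝ => t • h.snd := by fun_prop
      simpa using this.tendsto 0
    have t3 : ∀ᶠ t : ℝ in 𝓝 0, ‖X + t • h‖ < 2 * R := by
      have : Continuous fun t : ℝ => ‖X + t • h‖ := by fun_prop
      exact this.tendsto 0 |>.eventually (gt_mem_nhds (by simp; linarith))
    have hev := ((t1.eventually (hF (η / 8) (by positivity))).and
      ((t2.eventually (hG (η / 8) (by positivity))).and t3)).filter_mono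
        (nhdsWithin_le_nhds (s := Ioi (0 : ℝ)))
    obtain ⟨t, ⟨g1, g2, g3⟩, ht⟩ := (hev.and self_mem_nhdsWithin).exists
    have ht0 : (0 : ℝ) < t := ht
    have g4 := hcontact (X + t • h) (by rw [sub_zero]; exact g3.le)
    rw [add_sub_cancel_left] at g4
    have g5 : w (X + t • h) = infConv f s ε (X.fst + t • h.fst) + infConv g s ε (X.snd + t • h.snd)
      + quadPoly P Q c (X + t • h) := rfl
    have g6 : w X = infConv f s ε X.fst + infConv g s ε X.snd + quadPoly P Q c X := rfl
    rw [g5, g6, quadPoly_add, ← hD] at g4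
    have g7 := (abs_le.mp g1).2
    have g8 := (abs_le.mp g2).2
    have g9 : ⟪ContinuousLinearMap.adjoint (inlL2 V) (q - D), t • h.fst⟫
        + ⟪ContinuousLinearMap.adjoint (inrL2 V) (q - D), t • h.snd⟫
        = ⟪q, t • h⟫ - ⟪D, t • h⟫ := by
      rw [ContinuousLinearMap.adjoint_inner_left, ContinuousLinearMap.adjoint_inner_left,
        ← inner_add_right, ← inner_sub_left]
      congr 1
      exact inlL2_add_inrL2 (t • h)
    simp only [map_smul, real_inner_smul_left, real_inner_smul_right, norm_smul, mul_pow,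
      Real.norm_eq_abs, sq_abs] at g4 g7 g8 g9
    have g10 := WithLp.prod_norm_sq_eq_of_L2 h
    have g11 : 0 ≤ t ^ 2 * (⟪A h.fst, h.fst⟫ + ⟪B h.snd, h.snd⟫ + ⟪Q h, h⟫ + η * ‖h‖ ^ 2) := by
      rw [hc] at g4
      have g12 : η * (t ^ 2 * ‖h‖ ^ 2) = η * (t ^ 2 * ‖h.fst‖ ^ 2) + η * (t ^ 2 * ‖h.snd‖ ^ 2) := by
        rw [g10]; ring
      have g13 : 0 ≤ η * (t ^ 2 * ‖h‖ ^ 2) := by positivity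
      linarith
    exact nonneg_of_mul_nonneg_right g11 (by positivity)

theorem exists_jets_of_min {f g : V → ℝ} {a b : V} {r : ℝ} (hr : 0 < r)
    (hf : ContinuousOn f (closedBall a r)) (hg : ContinuousOn g (closedBall b r))
    {P : WithLp 2 (V × V)} {Q : WithLp 2 (V × V) →L[ℝ] WithLp 2 (V × V)}
    (hmin : ∀ ε > 0, ∀ᶠ h in 𝓝 (0 : WithLp 2 (V × V)),
      f a + g b ≤ f (a + h.fst) + g (b + h.snd) + ⟪P, h⟫ + 1 / 2 * ⟪Q h, h⟫ + ε * ‖h‖ ^ 2)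
    {η : ℝ} (hη : 0 < η) :
    ∃ (y₁ y₂ ξ ζ : V) (A B : V →L[ℝ] V), ‖y₁ - a‖ ≤ η ∧ ‖y₂ - b‖ ≤ η ∧ ‖ξ + P.fst‖ ≤ η ∧
      ‖ζ + P.snd‖ ≤ η ∧ HasLowerJet f y₁ ξ A ∧ HasLowerJet g y₂ ζ B ∧
      ∀ h : WithLp 2 (V × V),
        0 ≤ ⟪A h.fst, h.fst⟫ + ⟪B h.snd, h.snd⟫ + ⟪Q h, h⟫ + η * ‖h‖ ^ 2 := by
  obtain ⟨f', hf'c, hf'⟩ := exists_continuous_eqOn_closedBall hf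
  obtain ⟨g', hg'c, hg'⟩ := exists_continuous_eqOn_closedBall hg
  have main := exists_jets_of_min_zero (f := fun h => f' (a + h)) (g := fun h => g' (b + h))
    (by fun_prop) (by fun_prop) (P := P) (Q := Q) ?_ (η := min η (r / 2))
    (lt_min hη (by positivity))
  · obtain ⟨y₁, y₂, ξ, ζ, A, B, h1, h2, h3, h4, h5, h6, h7⟩ := main
    have tr : ∀ (F F' : V → ℝ) (c y ξ : V) (A : V →L[ℝ] V), EqOn F' F (closedBall c r) →
        ‖y‖ ≤ min η (r / 2) → HasLowerJet (fun h => F' (c + h)) y ξ A →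
        HasLowerJet F (c + y) ξ A := by
      intro F F' c y ξ A hE hy hj
      have hj' : HasLowerJet F' (c + y) ξ A := by
        intro ε hε
        filter_upwards [hj ε hε] with k hk
        rw [add_assoc c y k]; exact hk
      refine hj'.congr ?_
      have hy' : ‖y‖ < r := by have := hy.trans (min_le_right _ _); linarith
      filter_upwards [isOpen_ball.mem_nhds (show c + y ∈ ball c r by
        rw [mem_ball_iff_norm, add_sub_cancel_left]; exact hy')] with x hx
      exact hE (ball_subset_closedBall hx)
    refine ⟨a + y₁, b + y₂, ξ, ζ, A, B, ?_, ?_, h3.trans (min_le_left _ _),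
      h4.trans (min_le_left _ _), tr f f' a y₁ ξ A hf' h1 h5, tr g g' b y₂ ζ B hg' h2 h6,
      fun h => (h7 h).trans ?_⟩
    · rw [add_sub_cancel_left]; exact h1.trans (min_le_left _ _)
    · rw [add_sub_cancel_left]; exact h2.trans (min_le_left _ _)
    · gcongr; exact min_le_left _ _
  · intro ε hε
    have hb : ∀ᶠ h in 𝓝 (0 : WithLp 2 (V × V)), ‖h‖ ≤ r := by
      filter_upwards [Metric.closedBall_mem_nhds (0 : WithLp 2 (V × V)) hr] with h hh
      simpa using hh
    filter_upwards [hmin ε hε, hb] with h h1 h2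
    simp only [add_zero]
    rw [hf' (by simpa using hr.le), hg' (by simpa using hr.le),
      hf' (show a + h.fst ∈ closedBall a r by
        rw [mem_closedBall_iff_norm, add_sub_cancel_left]; exact (norm_fstL2_le h).trans h2),
      hg' (show b + h.snd ∈ closedBall b r by
        rw [mem_closedBall_iff_norm, add_sub_cancel_left]; exact (norm_sndL2_le h).trans h2)]
    exact h1
end

theorem exists_taylor_two {V : Type*} [NormedAddCommGroup V] [InnerProductSpace ℝ V]
    [CompleteSpace V] {f : V → ℝ} {x : V} (hf : ContDiffAt ℝ 2 f x) :
    ∃ (ξ : V) (A : V →L[ℝ] V), (∀ v, ⟪ξ, v⟫ = fderiv ℝ f x v) ∧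
      (∀ v w, ⟪A v, w⟫ = fderiv ℝ (fderiv ℝ f) x v w) ∧
      ∀ ε > 0, ∀ᶠ h in 𝓝 (0 : V),
        |f (x + h) - f x - ⟪ξ, h⟫ - 1 / 2 * ⟪A h, h⟫| ≤ ε * ‖h‖ ^ 2 := by
  have hd1 : ∀ᶠ y in 𝓝 x, DifferentiableAt ℝ f y := by
    filter_upwards [hf.eventually (by simp)] with y hy
    exact hy.differentiableAt (by simp)
  have hd2 : DifferentiableAt ℝ (fderiv ℝ f) x :=
    (hf.fderiv_right (m := 1) (by norm_num)).differentiableAt (by simp)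
  refine ⟨(InnerProductSpace.toDual ℝ V).symm (fderiv ℝ f x),
    ((InnerProductSpace.toDual ℝ V).symm.toContinuousLinearEquiv.toContinuousLinearMap).comp
      (fderiv ℝ (fderiv ℝ f) x), ?_, ?_, ?_⟩
  · intro v; simp
  · intro v w
    simp
  · intro ε hε
    have h2 := (hasFDerivAt_iff_isLittleO_nhds_zero.mp hd2.hasFDerivAt).bound hε
    have ht : Tendsto (fun k : V => x + k) (𝓝 0) (𝓝 x) := by
      have : Continuous fun k : V => x + k := by fun_prop
      simpa using this.tendsto 0
    obtain ⟨r, hr, hball⟩ := Metric.eventually_nhds_iff.mp (h2.and (ht.eventually hd1))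
    refine Metric.eventually_nhds_iff.mpr ⟨r, hr, fun h hh => ?_⟩
    rw [dist_zero_right] at hh
    have hb : ∀ σ ∈ Icc (0 : ℝ) 1, dist (σ • h) 0 < r ∧ ‖σ • h‖ ≤ ‖h‖ := by
      intro σ hσ
      have hn : ‖σ • h‖ ≤ ‖h‖ := by
        rw [norm_smul, Real.norm_of_nonneg hσ.1]
        exact mul_le_of_le_one_left (norm_nonneg _) hσ.2
      exact ⟨by rw [dist_zero_right]; exact hn.trans_lt hh, hn⟩
    have hder : ∀ σ ∈ Icc (0 : ℝ) 1, HasDerivWithinAt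
        (fun σ : ℝ => f (x + σ • h) - σ * fderiv ℝ f x h
          - 1 / 2 * σ ^ 2 * fderiv ℝ (fderiv ℝ f) x h h)
        ((fderiv ℝ f (x + σ • h) - fderiv ℝ f x - fderiv ℝ (fderiv ℝ f) x (σ • h)) h)
        (Icc 0 1) σ := by
      intro σ hσ
      have d1 : HasDerivAt (fun σ : ℝ => x + σ • h) h σ := by
        simpa using ((hasDerivAt_id σ).smul_const h).const_add x
      have d2 := ((hball (hb σ hσ).1).2.hasFDerivAt.comp_hasDerivAt σ d1)
      have d3 := (hasDerivAt_id σ).mul_const (fderiv ℝ f x h)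
      have d4 := (((hasDerivAt_id σ).pow 2).const_mul (1 / 2 : ℝ)).mul_const
        (fderiv ℝ (fderiv ℝ f) x h h)
      refine (((d2.sub d3).sub d4).congr_deriv ?_).hasDerivWithinAt
      simp
    have hmv := norm_image_sub_le_of_norm_deriv_le_segment_01' (C := ε * ‖h‖ ^ 2) hder (by
      intro σ hσ
      have hσ' : σ ∈ Icc (0 : ℝ) 1 := Ico_subset_Icc_self hσ
      have b1 := (hball (hb σ hσ').1).1
      refine (ContinuousLinearMap.le_opNorm _ _).trans ?_
      calc _ ≤ (ε * ‖σ • h‖) * ‖h‖ := by gcongr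
        _ ≤ (ε * ‖h‖) * ‖h‖ := by gcongr; exact (hb σ hσ').2
        _ = _ := by ring)
    simp only [one_smul, zero_smul, add_zero] at hmv
    rw [Real.norm_eq_abs] at hmv
    convert hmv using 2
    simp
    ring

theorem fderiv_apply_eq_of_line {V : Type*} [NormedAddCommGroup V] [NormedSpace ℝ V]
    {f : V → ℝ} {x v : V} (hf : ContDiffAt ℝ 2 f x) {g : ℝ → ℝ} {b : ℝ}
    (hg : ∀ᶠ σ in 𝓝 (0 : ℝ), HasDerivAt (fun σ : ℝ => f (x + σ • v)) (g σ) σ)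
    (hb : HasDerivAt g b 0) :
    fderiv ℝ f x v = g 0 ∧ fderiv ℝ (fderiv ℝ f) x v v = b := by
  have hd1 : ∀ᶠ y in 𝓝 x, DifferentiableAt ℝ f y := by
    filter_upwards [hf.eventually (by simp)] with y hy
    exact hy.differentiableAt (by simp)
  have hd2 : DifferentiableAt ℝ (fderiv ℝ f) x :=
    (hf.fderiv_right (m := 1) (by norm_num)).differentiableAt (by simp)
  have dl : ∀ σ, HasDerivAt (fun σ : ℝ => x + σ • v) v σ := fun σ => by
    simpa using ((hasDerivAt_id σ).smul_const v).const_add x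
  have ht : Tendsto (fun σ : ℝ => x + σ • v) (𝓝 0) (𝓝 x) := by
    have : Continuous fun σ : ℝ => x + σ • v := by fun_prop
    simpa using this.tendsto 0
  have heq : ∀ᶠ σ in 𝓝 (0 : ℝ), g σ = fderiv ℝ f (x + σ • v) v := by
    filter_upwards [hg, ht.eventually hd1] with σ h1 h2
    exact h1.unique (h2.hasFDerivAt.comp_hasDerivAt σ (dl σ))
  refine ⟨by have := heq.self_of_nhds; rw [zero_smul, add_zero] at this; exact this.symm, ?_⟩
  have hd2' : HasFDerivAt (fderiv ℝ f) (fderiv ℝ (fderiv ℝ f) x) (x + (0 : ℝ) • v) := by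
    simpa using hd2.hasFDerivAt
  have h3 := hd2'.comp_hasDerivAt (0 : ℝ) (dl 0)
  have h4 : HasDerivAt (fun σ : ℝ => fderiv ℝ f (x + σ • v) v)
      (fderiv ℝ (fderiv ℝ f) x v v) 0 := by
    have := h3.clm_apply (hasDerivAt_const (0 : ℝ) v)
    simpa using this
  exact h4.unique (hb.congr_of_eventuallyEq (heq.mono fun σ h => h.symm))

section quadratic
variable {N : ℕ}

theorem hasGradientAt_quadratic (c : ℝ) (x g : EuclideanSpace ℝ (Fin N))
    (B : EuclideanSpace ℝ (Fin N) →L[ℝ] EuclideanSpace ℝ (Fin N)) (y : EuclideanSpace ℝ (Fin N)) :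
    HasGradientAt (fun y => c + quadPoly g B 0 (y - x))
      (g + (1 / 2 : ℝ) • (B (y - x) + ContinuousLinearMap.adjoint B (y - x))) y := by
  rw [hasGradientAt_iff_isLittleO_nhds_zero]
  refine Asymptotics.IsBigO.trans_isLittleO (g := fun h => ‖h‖ ^ 2) ?_
    (Asymptotics.isLittleO_norm_pow_id (by norm_num))
  refine Asymptotics.IsBigO.of_bound (1 / 2 * ‖B‖) (Eventually.of_forall fun h => ?_)
  rw [show y + h - x = (y - x) + h by abel, quadPoly_add]
  simp only [mul_zero, zero_smul, add_zero, zero_mul]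
  rw [Real.norm_eq_abs, Real.norm_eq_abs, abs_of_nonneg (by positivity : 0 ≤ ‖h‖ ^ 2)]
  have h1 := abs_real_inner_le_norm (B h) h
  have h2 := mul_le_mul_of_nonneg_right (B.le_opNorm h) (norm_nonneg h)
  rw [show ∀ a b d e : ℝ, c + (a + b + 1 / 2 * d) - (c + a) - b = 1 / 2 * d by intros; ring]
  · rw [abs_mul, abs_of_pos (by norm_num : (0 : ℝ) < 1 / 2)]
    nlinarith
  · exact 0

theorem gradient_quadratic (c : ℝ) (x g : EuclideanSpace ℝ (Fin N))
    (B : EuclideanSpace ℝ (Fin N) →L[ℝ] EuclideanSpace ℝ (Fin N)) :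
    gradient (fun y => c + quadPoly g B 0 (y - x)) x = g := by
  rw [(hasGradientAt_quadratic c x g B x).gradient]
  simp

theorem hess_quadratic (c : ℝ) (x g : EuclideanSpace ℝ (Fin N))
    (B : EuclideanSpace ℝ (Fin N) →L[ℝ] EuclideanSpace ℝ (Fin N)) (i j : Fin N) :
    hess (fun y => c + quadPoly g B 0 (y - x)) x i j =
      1 / 2 * (⟪B (EuclideanSpace.single i 1), EuclideanSpace.single j 1⟫
        + ⟪B (EuclideanSpace.single j 1), EuclideanSpace.single i 1⟫) := by
  have h1 : fderiv ℝ (fun y => c + quadPoly g B 0 (y - x)) = fun y =>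
      innerSL ℝ (g + (1 / 2 : ℝ) • (B (y - x) + ContinuousLinearMap.adjoint B (y - x))) := by
    funext y
    exact (hasGradientAt_iff_hasFDerivAt.mp (hasGradientAt_quadratic c x g B y)).fderiv
  have h2 : HasFDerivAt (fun y => innerSL ℝ (g + (1 / 2 : ℝ) •
      (B (y - x) + ContinuousLinearMap.adjoint B (y - x))))
      ((innerSL ℝ).comp ((1 / 2 : ℝ) • (B + ContinuousLinearMap.adjoint B))) x := by
    have h3 : HasFDerivAt (fun y => g + (1 / 2 : ℝ) •
      (B (y - x) + ContinuousLinearMap.adjoint B (y - x)))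
      ((1 / 2 : ℝ) • (B + ContinuousLinearMap.adjoint B)) x := by
      have h4 : HasFDerivAt (fun y => y - x) (ContinuousLinearMap.id ℝ _) x :=
        (hasFDerivAt_id x).sub_const x
      have h5 := B.hasFDerivAt.comp x h4
      have h6 := (ContinuousLinearMap.adjoint B).hasFDerivAt.comp x h4
      exact ((h5.add h6).const_smul (1 / 2 : ℝ)).const_add g
    exact (innerSL ℝ).hasFDerivAt.comp x h3
  rw [hess, iteratedFDeriv_two_apply, h1, h2.fderiv]
  simp only [ContinuousLinearMap.comp_apply, smul_apply, add_apply, map_smul, map_add,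
    innerSL_apply_apply, ContinuousLinearMap.adjoint_inner_left, Matrix.cons_val_zero,
    Matrix.cons_val_one, smul_eq_mul]
  rw [real_inner_comm (EuclideanSpace.single i 1) (B (EuclideanSpace.single j 1))]

theorem sum_inner_single (B : EuclideanSpace ℝ (Fin N) →L[ℝ] EuclideanSpace ℝ (Fin N))
    (v : EuclideanSpace ℝ (Fin N)) :
    ∑ i, ∑ j, ⟪B (EuclideanSpace.single i 1), EuclideanSpace.single j 1⟫ * v j * v i
      = ⟪B v, v⟫ := by
  have hv : v = ∑ i, v i • EuclideanSpace.single i (1 : ℝ) := by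
    have := (EuclideanSpace.basisFun (Fin N) ℝ).sum_repr v
    simpa using this.symm
  conv_rhs => rw [hv]
  simp only [map_sum, map_smul, sum_inner, inner_sum, real_inner_smul_left, real_inner_smul_right]
  rw [Finset.sum_comm]
  exact Finset.sum_congr rfl fun i _ => Finset.sum_congr rfl fun j _ => by ring

theorem qform_hess_quadratic (c : ℝ) (x g : EuclideanSpace ℝ (Fin N))
    (B : EuclideanSpace ℝ (Fin N) →L[ℝ] EuclideanSpace ℝ (Fin N)) (v : EuclideanSpace ℝ (Fin N)) :
    qform (hess (fun y => c + quadPoly g B 0 (y - x)) x) v = ⟪B v, v⟫ := by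
  have h1 := sum_inner_single B v
  have h2 : ∑ i, ∑ j, ⟪B (EuclideanSpace.single j 1), EuclideanSpace.single i 1⟫ * v j * v i
      = ⟪B v, v⟫ := by
    rw [Finset.sum_comm, ← h1]
    exact Finset.sum_congr rfl fun i _ => Finset.sum_congr rfl fun j _ => by ring
  simp only [qform, hess_quadratic]
  rw [show ⟪B v, v⟫ = 1 / 2 * (⟪B v, v⟫ + ⟪B v, v⟫) by ring]
  nth_rw 1 [← h1]
  rw [← h2, ← Finset.sum_add_distrib, Finset.mul_sum]
  refine Finset.sum_congr rfl fun i _ => ?_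
  rw [← Finset.sum_add_distrib, Finset.mul_sum]
  exact Finset.sum_congr rfl fun j _ => by ring

theorem trace_hess_quadratic (c : ℝ) (x g : EuclideanSpace ℝ (Fin N))
    (B : EuclideanSpace ℝ (Fin N) →L[ℝ] EuclideanSpace ℝ (Fin N)) :
    Matrix.trace (hess (fun y => c + quadPoly g B 0 (y - x)) x) =
      ∑ i, ⟪B (EuclideanSpace.single i 1), EuclideanSpace.single i 1⟫ := by
  simp only [Matrix.trace, Matrix.diag, hess_quadratic]
  exact Finset.sum_congr rfl fun i _ => by ring

theorem exists_unit_le_Flower [NeZero N] {p : ℝ} (hp : 0 < p) (c : ℝ)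
    (x g : EuclideanSpace ℝ (Fin N))
    (B : EuclideanSpace ℝ (Fin N) →L[ℝ] EuclideanSpace ℝ (Fin N)) {η : ℝ} (hη : 0 < η) :
    ∃ e : EuclideanSpace ℝ (Fin N), ‖e‖ = 1 ∧ (g ≠ 0 → e = (1 / ‖g‖) • g) ∧
      1 / p * (∑ i, ⟪B (EuclideanSpace.single i 1), EuclideanSpace.single i 1⟫
        + (p - 2) * ⟪B e, e⟫) - η ≤
      Flower p g (hess (fun y => c + quadPoly g B 0 (y - x)) x) := by
  by_cases hg : g = 0
  · set X := hess (fun y => c + quadPoly g B 0 (y - x)) x with hX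
    have hne : ({r | ∃ v : EuclideanSpace ℝ (Fin N), ‖v‖ = 1 ∧ r = qform X v} : Set ℝ).Nonempty :=
      ⟨_, EuclideanSpace.single 0 1, by simp, rfl⟩
    have hq : ∀ v, qform X v = ⟪B v, v⟫ := fun v => by rw [hX, qform_hess_quadratic]
    have htr : Matrix.trace X = ∑ i, ⟪B (EuclideanSpace.single i 1), EuclideanSpace.single i 1⟫ :=
      by rw [hX, trace_hess_quadratic]
    have hF : Flower p g X = 1 / p * (Matrix.trace X + max (p - 2) 0 * lamMin X
      + min (p - 2) 0 * lamMax X) := by rw [Flower, if_pos hg]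
    rw [hF, htr]
    rcases le_total 2 p with h2 | h2
    · have hδ : 0 < η * p / (p - 2 + 1) := by
        have : 0 < p - 2 + 1 := by linarith
        positivity
      obtain ⟨r, ⟨e, he, rfl⟩, hr⟩ := Real.lt_sInf_add_pos hne hδ
      refine ⟨e, he, fun h => absurd hg h, ?_⟩
      rw [max_eq_left (by linarith), min_eq_right (by linarith), ← hq]
      change qform X e < lamMin X + _ at hr
      have h3 : (p - 2) * qform X e ≤ (p - 2) * lamMin X + η * p := by
        have h4 := mul_le_mul_of_nonneg_left hr.le (by linarith : 0 ≤ p - 2)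
        have h5 : (p - 2) * (η * p / (p - 2 + 1)) ≤ η * p := by
          rw [← mul_div_assoc, div_le_iff₀ (by linarith)]
          nlinarith [mul_pos hη hp]
        nlinarith
      have h6 := mul_le_mul_of_nonneg_left h3 (by positivity : 0 ≤ 1 / p)
      have h7 : 1 / p * (η * p) = η := by field_simp
      nlinarith
    · have hδ : 0 < η * p / (2 - p + 1) := by
        have : 0 < 2 - p + 1 := by linarith
        positivity
      obtain ⟨r, ⟨e, he, rfl⟩, hr⟩ := Real.add_neg_lt_sSup hne (neg_lt_zero.mpr hδ)
      refine ⟨e, he, fun h => absurd hg h, ?_⟩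
      rw [max_eq_right (by linarith), min_eq_left (by linarith), ← hq]
      change lamMax X + _ < qform X e at hr
      have h3 : (p - 2) * qform X e ≤ (p - 2) * lamMax X + η * p := by
        have h4 := mul_le_mul_of_nonneg_left hr.le (by linarith : 0 ≤ 2 - p)
        have h5 : (2 - p) * (η * p / (2 - p + 1)) ≤ η * p := by
          rw [← mul_div_assoc, div_le_iff₀ (by linarith)]
          nlinarith [mul_pos hη hp]
        nlinarith
      have h6 := mul_le_mul_of_nonneg_left h3 (by positivity : 0 ≤ 1 / p)
      have h7 : 1 / p * (η * p) = η := by field_simp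
      nlinarith
  · have hpos : 0 < ‖g‖ := norm_pos_iff.mpr hg
    refine ⟨(1 / ‖g‖) • g, ?_, fun _ => rfl, ?_⟩
    · rw [norm_smul, Real.norm_of_nonneg (by positivity)]; field_simp
    · rw [Flower, if_neg hg, Fop, trace_hess_quadratic, qform_hess_quadratic, map_smul,
        real_inner_smul_left, real_inner_smul_right]
      have : (p - 2) * (1 / ‖g‖ * (1 / ‖g‖ * ⟪B g, g⟫)) = (p - 2) * ⟪B g, g⟫ / ‖g‖ ^ 2 := by
        field_simp
      rw [this]
      linarith
end quadratic

/-- Space-time with its Euclidean structure. -/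
abbrev SpaceTime (N : ℕ) := WithLp 2 (EuclideanSpace ℝ (Fin N) × ℝ)

/-- The inclusion of space in space-time. -/
def spaceIncl (N : ℕ) : EuclideanSpace ℝ (Fin N) →L[ℝ] SpaceTime N :=
  (WithLp.prodContinuousLinearEquiv 2 ℝ (EuclideanSpace ℝ (Fin N)) ℝ).symm.toContinuousLinearMap.comp
    (ContinuousLinearMap.inl ℝ _ _)

/-- The point of space-time with coordinates `x` and `t`. -/
def stPoint {N : ℕ} (x : EuclideanSpace ℝ (Fin N)) (t : ℝ) : SpaceTime N := WithLp.toLp 2 (x, t)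

section
variable {N : ℕ}

@[simp] theorem stPoint_fst (x : EuclideanSpace ℝ (Fin N)) (t : ℝ) : (stPoint x t).fst = x := rfl
@[simp] theorem stPoint_snd (x : EuclideanSpace ℝ (Fin N)) (t : ℝ) : (stPoint x t).snd = t := rfl

theorem stPoint_zero_right (x : EuclideanSpace ℝ (Fin N)) : stPoint x 0 = spaceIncl N x := rfl

theorem stPoint_eta (v : SpaceTime N) : stPoint v.fst v.snd = v := rfl

theorem inner_stPoint_right (v : SpaceTime N) (x : EuclideanSpace ℝ (Fin N)) (t : ℝ) :
    ⟪v, stPoint x t⟫ = ⟪v.fst, x⟫ + v.snd * t := by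
  rw [WithLp.prod_inner_apply]
  change ⟪v.fst, x⟫ + ⟪v.snd, t⟫ = _
  rw [real_inner_eq_re_inner, real_inner_comm]
  simp [mul_comm]

theorem norm_spaceIncl (x : EuclideanSpace ℝ (Fin N)) : ‖spaceIncl N x‖ = ‖x‖ := by
  have h := inner_stPoint_right (spaceIncl N x) x 0
  rw [stPoint_zero_right, real_inner_self_eq_norm_sq, mul_zero, add_zero] at h
  change _ = ⟪x, x⟫ at h
  rw [real_inner_self_eq_norm_sq] at h
  exact (sq_eq_sq₀ (norm_nonneg _) (norm_nonneg _)).mp h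

theorem exists_unit_le_of_hasLowerJet [NeZero N] {p : ℝ} (hp : 0 < p)
    {Ω : Set (EuclideanSpace ℝ (Fin N))} {u : EuclideanSpace ℝ (Fin N) → ℝ → ℝ}
    (hv : IsViscositySol p Ω u) {x : EuclideanSpace ℝ (Fin N)} (hx : x ∈ Ω) {t : ℝ} (ht : 0 < t)
    {ξ : SpaceTime N} {A : SpaceTime N →L[ℝ] SpaceTime N}
    (hj : HasLowerJet (fun v : SpaceTime N => u v.fst v.snd) (stPoint x t) ξ A)
    {η : ℝ} (hη : 0 < η) :
    ∃ e : EuclideanSpace ℝ (Fin N), ‖e‖ = 1 ∧ (ξ.fst ≠ 0 → e = (1 / ‖ξ.fst‖) • ξ.fst) ∧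
      1 / p * (∑ i, ⟪A (spaceIncl N (EuclideanSpace.single i 1)),
          spaceIncl N (EuclideanSpace.single i 1)⟫
        + (p - 2) * ⟪A (spaceIncl N e), spaceIncl N e⟫) - η ≤ ξ.snd := by
  set K : ℝ := 1 / p * (2 * (N + |p - 2|)) with hK
  have hK0 : 0 ≤ K := by positivity
  set ε : ℝ := η / (2 * (K + 1)) with hε
  have hε0 : 0 < ε := by positivity
  have hKε : K * ε ≤ η / 2 := by
    rw [hε, ← mul_div_assoc, div_le_iff₀ (by positivity)]
    nlinarith
  set B := (ContinuousLinearMap.adjoint (spaceIncl N)).comp (A.comp (spaceIncl N))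
    - (2 * ε) • ContinuousLinearMap.id ℝ (EuclideanSpace ℝ (Fin N)) with hB
  have hBv : ∀ v, ⟪B v, v⟫ = ⟪A (spaceIncl N v), spaceIncl N v⟫ - 2 * ε * ‖v‖ ^ 2 := by
    intro v
    simp only [hB, sub_apply, smul_apply, ContinuousLinearMap.comp_apply,
      ContinuousLinearMap.id_apply, inner_sub_left, ContinuousLinearMap.adjoint_inner_left,
      real_inner_smul_left, real_inner_self_eq_norm_sq]
  set φ : EuclideanSpace ℝ (Fin N) × ℝ → ℝ := fun q =>
    u x t + quadPoly ξ A (-ε) (stPoint (q.1 - x) (q.2 - t)) with hφ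
  have hst : ContDiff ℝ 2 fun q : EuclideanSpace ℝ (Fin N) × ℝ => stPoint (q.1 - x) (q.2 - t) := by
    have h1 : ContDiff ℝ 2 fun q : EuclideanSpace ℝ (Fin N) × ℝ => (q.1 - x, q.2 - t) := by
      fun_prop
    exact (WithLp.prodContinuousLinearEquiv 2 ℝ
      (EuclideanSpace ℝ (Fin N)) ℝ).symm.contDiff.comp h1
  have hφc : ContDiff ℝ 2 φ := by
    have h2 : ContDiff ℝ 2 fun v : SpaceTime N => quadPoly ξ A (-ε) v := by
      unfold quadPoly
      have h3 : ContDiff ℝ 2 fun v : SpaceTime N => ‖v‖ ^ 2 := contDiff_norm_sq ℝ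
      have h4 : ContDiff ℝ 2 fun v : SpaceTime N => ⟪A v, v⟫ := A.contDiff.inner ℝ contDiff_id
      have h5 : ContDiff ℝ 2 fun v : SpaceTime N => ⟪ξ, v⟫ := contDiff_const.inner ℝ contDiff_id
      exact (h5.add (contDiff_const.mul h4)).add (contDiff_const.mul h3)
    exact contDiff_const.add (h2.comp hst)
  have hmin : IsLocalMinOn (fun q : EuclideanSpace ℝ (Fin N) × ℝ => u q.1 q.2 - φ q)
      (Ω ×ˢ Ioi 0) (x, t) := by
    have htd : Tendsto (fun q : EuclideanSpace ℝ (Fin N) × ℝ => stPoint (q.1 - x) (q.2 - t))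
        (𝓝[Ω ×ˢ Ioi 0] (x, t)) (𝓝 0) := by
      have := hst.continuous.tendsto (x, t)
      simp only [sub_self] at this
      exact this.mono_left nhdsWithin_le_nhds
    refine (htd.eventually (hj ε hε0)).mono fun q hq => ?_
    have e1 : φ (x, t) = u x t := by
      simp only [hφ, sub_self]
      rw [stPoint_zero_right, map_zero]
      simp [quadPoly]
    have e2 : (stPoint x t + stPoint (q.1 - x) (q.2 - t)).fst = q.1 := by
      change x + (q.1 - x) = q.1; abel
    have e3 : (stPoint x t + stPoint (q.1 - x) (q.2 - t)).snd = q.2 := by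
      change t + (q.2 - t) = q.2; ring
    simp only [e2, e3, stPoint_fst, stPoint_snd] at hq
    change u x t - φ (x, t) ≤ u q.1 q.2 - φ q
    rw [e1]
    simp only [hφ, quadPoly]
    linarith
  have hvs := hv.2.2 φ hφc x hx t ht hmin
  have hs : (fun y => φ (y, t)) = fun y => u x t + quadPoly ξ.fst B 0 (y - x) := by
    funext y
    simp only [hφ, sub_self]
    rw [stPoint_zero_right]
    simp only [quadPoly]
    rw [hBv, norm_spaceIncl, ← stPoint_zero_right, inner_stPoint_right]
    ring
  have hd : deriv (fun s => φ (x, s)) t = ξ.snd := by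
    have e1 : (fun s => φ (x, s)) = fun s => u x t + ((s - t) * ξ.snd + (s - t) ^ 2 *
        (1 / 2 * ⟪A (stPoint 0 1), stPoint 0 1⟫ - ε * ‖(stPoint 0 1 : SpaceTime N)‖ ^ 2)) := by
      funext s
      have e2 : (stPoint (x - x) (s - t) : SpaceTime N) = (s - t) • stPoint 0 1 := by
        apply (WithLp.prodContinuousLinearEquiv 2 ℝ (EuclideanSpace ℝ (Fin N)) ℝ).injective
        ext
        · change (x - x) _ = ((s - t) • (0 : EuclideanSpace ℝ (Fin N))) _
          simp
        · change s - t = (s - t) • (1 : ℝ)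
          simp
      simp only [hφ, quadPoly]
      rw [e2, map_smul, real_inner_smul_right, real_inner_smul_left, real_inner_smul_right,
        norm_smul, mul_pow, Real.norm_eq_abs, sq_abs, inner_stPoint_right, inner_zero_right]
      ring
    rw [e1]
    have d1 : HasDerivAt (fun s : ℝ => s - t) 1 t := (hasDerivAt_id t).sub_const t
    have d2 := ((d1.mul_const ξ.snd).add ((d1.pow 2).mul_const
      (1 / 2 * ⟪A (stPoint 0 1), stPoint 0 1⟫
        - ε * ‖(stPoint 0 1 : SpaceTime N)‖ ^ 2))).const_add (u x t)
    refine (d2.deriv).trans ?_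
    simp
  rw [hs, gradient_quadratic, hd] at hvs
  obtain ⟨e, he, hdir, hle⟩ := exists_unit_le_Flower hp (u x t) x ξ.fst B (half_pos hη)
  refine ⟨e, he, hdir, ?_⟩
  have h1 := hle.trans hvs
  simp only [hBv, he, PiLp.norm_single, norm_one, one_pow, mul_one,
    Finset.sum_sub_distrib, Finset.sum_const, Finset.card_univ, Fintype.card_fin,
    nsmul_eq_mul] at h1
  have h2 : 1 / p * ((N : ℝ) * (2 * ε) + (p - 2) * (2 * ε)) ≤ K * ε := by
    have : K * ε = 1 / p * ((N : ℝ) * (2 * ε) + |p - 2| * (2 * ε)) := by rw [hK]; ring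
    rw [this]
    gcongr
    exact le_abs_self _
  linarith
end

section
variable {E ι : Type*} [NormedAddCommGroup E] [InnerProductSpace ℝ E]
  [Fintype ι]

theorem sum_inner_stretch (b : OrthonormalBasis ι ℝ E) (A : E →L[ℝ] E) (e : E) (c : ℝ) :
    ∑ i, ⟪A (b i + (c * ⟪b i, e⟫) • e), b i + (c * ⟪b i, e⟫) • e⟫
      = ∑ i, ⟪A (b i), b i⟫ + (2 * c + c ^ 2 * ‖e‖ ^ 2) * ⟪A e, e⟫ := by
  have h1 : ∑ i, ⟪b i, e⟫ * ⟪A (b i), e⟫ = ⟪A e, e⟫ := by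
    conv_rhs => rw [← b.sum_repr' e, map_sum, sum_inner]
    refine Finset.sum_congr rfl fun i _ => ?_
    rw [map_smul, real_inner_smul_left, b.sum_repr']
  have h2 : ∑ i, ⟪b i, e⟫ * ⟪A e, b i⟫ = ⟪A e, e⟫ := by
    conv_rhs => rw [← b.sum_repr' e, inner_sum]
    refine Finset.sum_congr rfl fun i _ => ?_
    rw [real_inner_smul_right, b.sum_repr']
  have h3 : ∑ i, ⟪b i, e⟫ ^ 2 = ‖e‖ ^ 2 := b.sum_sq_inner_right e
  have h : ∀ i, ⟪A (b i + (c * ⟪b i, e⟫) • e), b i + (c * ⟪b i, e⟫) • e⟫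
      = ⟪A (b i), b i⟫ + c * (⟪b i, e⟫ * ⟪A (b i), e⟫) + c * (⟪b i, e⟫ * ⟪A e, b i⟫)
        + c ^ 2 * ⟪A e, e⟫ * ⟪b i, e⟫ ^ 2 := fun i => by
    simp only [map_add, map_smul, inner_add_left, inner_add_right, real_inner_smul_left,
      real_inner_smul_right]
    ring
  simp only [h, Finset.sum_add_distrib, ← Finset.mul_sum, h1, h2, h3]
  ring

theorem sum_inner_orthonormalBasis_eq (b b' : OrthonormalBasis ι ℝ E) (A : E →L[ℝ] E) :
    ∑ i, ⟪A (b i), b i⟫ = ∑ i, ⟪A (b' i), b' i⟫ := by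
  have h := LinearMap.trace_eq_sum_inner (A : E →ₗ[ℝ] E) b
  have h' := LinearMap.trace_eq_sum_inner (A : E →ₗ[ℝ] E) b'
  simp only [ContinuousLinearMap.coe_coe] at h h'
  rw [h] at h'
  simpa only [real_inner_comm] using h'

theorem sum_norm_sq_stretch (b : OrthonormalBasis ι ℝ E) (e : E) (c : ℝ) :
    ∑ i, ‖b i + (c * ⟪b i, e⟫) • e‖ ^ 2
      = Fintype.card ι + (2 * c + c ^ 2 * ‖e‖ ^ 2) * ‖e‖ ^ 2 := by
  have h := sum_inner_stretch b (ContinuousLinearMap.id ℝ E) e c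
  simp only [ContinuousLinearMap.id_apply, real_inner_self_eq_norm_sq] at h
  rw [h]
  simp

/-- Parallel coupling of two quadratic forms. -/
theorem parallel_coupling (b : OrthonormalBasis ι ℝ E) {A B : E →L[ℝ] E} {k : E → ℝ} {C D : ℝ}
    (hAB : ∀ x y, 0 ≤ ⟪A x, x⟫ + ⟪B y, y⟫ + k (x - y) + C * (‖x‖ ^ 2 + ‖y‖ ^ 2))
    (hk : ∀ x, k x ≤ D * ‖x‖ ^ 2) (hD : 0 ≤ D) {e f : E} (he : ‖e‖ = 1) (hf : ‖f‖ = 1) (c : ℝ) :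
    0 ≤ ∑ i, ⟪A (b i), b i⟫ + (2 * c + c ^ 2) * ⟪A e, e⟫
      + (∑ i, ⟪B (b i), b i⟫ + (2 * c + c ^ 2) * ⟪B f, f⟫)
      + 2 * c ^ 2 * D * ‖e + f‖ ^ 2 + 2 * C * (Fintype.card ι + (2 * c + c ^ 2)) := by
  have h0 : 0 ≤ ∑ i, (⟪A (b i + (c * ⟪b i, e⟫) • e), b i + (c * ⟪b i, e⟫) • e⟫
      + ⟪B (b i + (c * ⟪b i, f⟫) • f), b i + (c * ⟪b i, f⟫) • f⟫
      + D * (c ^ 2 * ‖⟪b i, e⟫ • e - ⟪b i, f⟫ • f‖ ^ 2)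
      + C * (‖b i + (c * ⟪b i, e⟫) • e‖ ^ 2 + ‖b i + (c * ⟪b i, f⟫) • f‖ ^ 2)) := by
    refine Finset.sum_nonneg fun i _ => ?_
    have h1 := hAB (b i + (c * ⟪b i, e⟫) • e) (b i + (c * ⟪b i, f⟫) • f)
    have h2 := hk (b i + (c * ⟪b i, e⟫) • e - (b i + (c * ⟪b i, f⟫) • f))
    have h3 : b i + (c * ⟪b i, e⟫) • e - (b i + (c * ⟪b i, f⟫) • f)
        = c • (⟪b i, e⟫ • e - ⟪b i, f⟫ • f) := by
      rw [smul_sub, smul_smul, smul_smul]; abel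
    rw [h3] at h1 h2
    rw [norm_smul, mul_pow, Real.norm_eq_abs, sq_abs] at h2
    linarith
  have h4 : ∑ i, ‖⟪b i, e⟫ • e - ⟪b i, f⟫ • f‖ ^ 2 = 2 - 2 * ⟪e, f⟫ ^ 2 := by
    have h5 : ∀ i, ‖⟪b i, e⟫ • e - ⟪b i, f⟫ • f‖ ^ 2
        = ⟪b i, e⟫ ^ 2 + ⟪b i, f⟫ ^ 2 - 2 * ⟪e, f⟫ * (⟪e, b i⟫ * ⟪b i, f⟫) := fun i => by
      rw [norm_sub_sq_real, norm_smul, norm_smul, he, hf, real_inner_smul_left,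
        real_inner_smul_right, real_inner_comm e (b i)]
      simp only [mul_one, Real.norm_eq_abs, sq_abs]
      ring
    simp only [h5, Finset.sum_sub_distrib, Finset.sum_add_distrib, ← Finset.mul_sum,
      b.sum_sq_inner_right, b.sum_inner_mul_inner, he, hf]
    ring
  have h6 : 2 - 2 * ⟪e, f⟫ ^ 2 ≤ 2 * ‖e + f‖ ^ 2 := by
    rw [norm_add_sq_real, he, hf]
    have h7 := abs_real_inner_le_norm e f
    rw [he, hf, mul_one, abs_le] at h7
    nlinarith
  simp only [Finset.sum_add_distrib, ← Finset.mul_sum, sum_inner_stretch, sum_norm_sq_stretch, he,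
    hf, h4] at h0
  have h8 : D * (c ^ 2 * (2 - 2 * ⟪e, f⟫ ^ 2)) ≤ D * (c ^ 2 * (2 * ‖e + f‖ ^ 2)) := by gcongr
  linarith

/-- Coupling of two quadratic forms by the reflection exchanging `e` and `f`. -/
theorem reflection_coupling (b : OrthonormalBasis ι ℝ E) {A B : E →L[ℝ] E} {k : E → ℝ} {C : ℝ}
    (hAB : ∀ x y, 0 ≤ ⟪A x, x⟫ + ⟪B y, y⟫ + k (x - y) + C * (‖x‖ ^ 2 + ‖y‖ ^ 2))
    (hk : ∀ (r : ℝ) x, k (r • x) = r ^ 2 * k x) {e f : E} (he : ‖e‖ = 1) (hf : ‖f‖ = 1)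
    (hef : e ≠ f) (c : ℝ) :
    0 ≤ ∑ i, ⟪A (b i), b i⟫ + (2 * c + c ^ 2) * ⟪A e, e⟫
      + (∑ i, ⟪B (b i), b i⟫ + (2 * c + c ^ 2) * ⟪B f, f⟫)
      + 4 * (1 + (2 * c + c ^ 2) * ⟪e, (1 / ‖e - f‖) • (e - f)⟫ ^ 2) *
        k ((1 / ‖e - f‖) • (e - f)) + 2 * C * (Fintype.card ι + (2 * c + c ^ 2)) := by
  set n : E := (1 / ‖e - f‖) • (e - f) with hn
  have hef0 : ‖e - f‖ ≠ 0 := by rwa [norm_ne_zero_iff, sub_ne_zero]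
  have hn1 : ‖n‖ = 1 := by
    rw [hn, norm_smul, norm_div, norm_one, norm_norm, one_div, inv_mul_cancel₀ hef0]
  set R : E ≃ₗᵢ[ℝ] E := (ℝ ∙ (e - f))ᗮ.reflection with hR
  have hRe : R e = f := Submodule.reflection_sub (by rw [he, hf])
  have hRx : ∀ x, x - R x = (2 * ⟪n, x⟫) • n := fun x => by
    rw [hR, Submodule.reflection_orthogonal_apply, Submodule.reflection_singleton_apply, hn,
      real_inner_smul_left, smul_smul, ← Nat.cast_smul_eq_nsmul ℝ, smul_smul]
    simp only [RCLike.ofReal_real_eq_id, id, neg_sub]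
    rw [sub_sub_cancel]
    congr 1
    push_cast
    field_simp
  have hb' : ∀ i, R (b i + (c * ⟪b i, e⟫) • e)
      = (b.map R) i + (c * ⟪(b.map R) i, f⟫) • f := fun i => by
    rw [map_add, map_smul, hRe, OrthonormalBasis.map_apply, ← hRe, R.inner_map_map]
  have h0 : 0 ≤ ∑ i, (⟪A (b i + (c * ⟪b i, e⟫) • e), b i + (c * ⟪b i, e⟫) • e⟫
      + ⟪B ((b.map R) i + (c * ⟪(b.map R) i, f⟫) • f),
          (b.map R) i + (c * ⟪(b.map R) i, f⟫) • f⟫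
      + 4 * k n * ⟪b i + (c * ⟪b i, e⟫) • e, n⟫ ^ 2
      + C * (‖b i + (c * ⟪b i, e⟫) • e‖ ^ 2
        + ‖(b.map R) i + (c * ⟪(b.map R) i, f⟫) • f‖ ^ 2)) := by
    refine Finset.sum_nonneg fun i _ => ?_
    have h1 := hAB (b i + (c * ⟪b i, e⟫) • e) (R (b i + (c * ⟪b i, e⟫) • e))
    rw [hRx, hk, hb', real_inner_comm _ n] at h1
    linarith
  have h4 : ∑ i, ⟪b i + (c * ⟪b i, e⟫) • e, n⟫ ^ 2 = 1 + (2 * c + c ^ 2) * ⟪e, n⟫ ^ 2 := by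
    have h5 : ∀ i, ⟪b i + (c * ⟪b i, e⟫) • e, n⟫ ^ 2
        = ⟪b i, n⟫ ^ 2 + 2 * c * ⟪e, n⟫ * (⟪e, b i⟫ * ⟪b i, n⟫)
          + c ^ 2 * ⟪e, n⟫ ^ 2 * ⟪b i, e⟫ ^ 2 := fun i => by
      rw [inner_add_left, real_inner_smul_left, real_inner_comm e (b i)]
      ring
    simp only [h5, Finset.sum_add_distrib, ← Finset.mul_sum,
      b.sum_sq_inner_right, b.sum_inner_mul_inner, he, hn1]
    ring
  simp only [Finset.sum_add_distrib, ← Finset.mul_sum, sum_inner_stretch, sum_norm_sq_stretch, he,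
    hf, h4, ← sum_inner_orthonormalBasis_eq b (b.map R) B] at h0
  linarith

theorem norm_smul_sub_le_of_direction {e ξ v : E} {r : ℝ} (he : ‖e‖ = 1)
    (hξ : ξ ≠ 0 → e = (1 / ‖ξ‖) • ξ) (h : ‖ξ - v‖ ≤ r) : ‖‖v‖ • e - v‖ ≤ 2 * r := by
  have h1 : ξ = ‖ξ‖ • e := by
    by_cases h0 : ξ = 0
    · simp [h0]
    · rw [hξ h0, smul_smul, mul_one_div_cancel (norm_ne_zero_iff.mpr h0), one_smul]
  have h2 : ‖v‖ • e - v = (‖v‖ - ‖ξ‖) • e + (ξ - v) := by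
    rw [sub_smul, ← h1]; abel
  rw [h2]
  refine (norm_add_le _ _).trans ?_
  rw [norm_smul, he, mul_one, Real.norm_eq_abs]
  have h3 := abs_norm_sub_norm_le v ξ
  rw [norm_sub_rev] at h3
  linarith
end

section
variable {E ι : Type*} [NormedAddCommGroup E] [InnerProductSpace ℝ E] [Fintype ι]

/-- The Hessian form of the coupling kernel. -/
def kernelHess (L q t : ℝ) (d n : E) : ℝ :=
  L / 2 * ‖d‖ ^ 2 / (q ^ 7 * t ^ 2) * ‖n‖ ^ 2
    + (L / (q ^ 7 * t ^ 2) - 7 / 4 * L * ‖d‖ ^ 4 / (q ^ 15 * t ^ 4)) * ⟪d, n⟫ ^ 2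

theorem min_one_le_one_add_mul {p x : ℝ} (hx0 : 0 ≤ x) (hx1 : x ≤ 1) :
    min 1 (p - 1) ≤ 1 + (p - 2) * x := by
  rcases le_total 2 p with h | h
  · have : min 1 (p - 1) ≤ 1 := min_le_left _ _
    nlinarith
  · have : min 1 (p - 1) ≤ p - 1 := min_le_right _ _
    nlinarith

theorem kernelHess_smul (L q t : ℝ) (d : E) (r : ℝ) (n : E) :
    kernelHess L q t d (r • n) = r ^ 2 * kernelHess L q t d n := by
  simp only [kernelHess, norm_smul, real_inner_smul_right, Real.norm_eq_abs, mul_pow, sq_abs]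
  ring

theorem kernelHess_le {L q t : ℝ} (hL : 0 < L) (hq : 0 < q) (ht : 0 < t) (d n : E) :
    kernelHess L q t d n ≤ 3 / 2 * L * ‖d‖ ^ 2 / (q ^ 7 * t ^ 2) * ‖n‖ ^ 2 := by
  have h1 : ⟪d, n⟫ ^ 2 ≤ ‖d‖ ^ 2 * ‖n‖ ^ 2 := by
    rw [← mul_pow, ← sq_abs]
    exact pow_le_pow_left₀ (abs_nonneg _) (abs_real_inner_le_norm d n) 2
  have h2 : 0 ≤ 7 / 4 * L * ‖d‖ ^ 4 / (q ^ 15 * t ^ 4) * ⟪d, n⟫ ^ 2 := by positivity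
  have h3 : L / (q ^ 7 * t ^ 2) * ⟪d, n⟫ ^ 2 ≤ L / (q ^ 7 * t ^ 2) * (‖d‖ ^ 2 * ‖n‖ ^ 2) := by
    gcongr
  have h4 : 3 / 2 * L * ‖d‖ ^ 2 / (q ^ 7 * t ^ 2) * ‖n‖ ^ 2
      = L / 2 * ‖d‖ ^ 2 / (q ^ 7 * t ^ 2) * ‖n‖ ^ 2
        + L / (q ^ 7 * t ^ 2) * (‖d‖ ^ 2 * ‖n‖ ^ 2) := by ring
  rw [h4, kernelHess, sub_mul]
  linarith

theorem kernelHess_le_neg {L q t : ℝ} (hL : 0 < L) (hq : 0 < q) (ht : 0 < t) {d n : E}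
    (hn : ‖n‖ = 1) (hd : 27 / 28 * q ^ 8 ≤ ‖d‖ ^ 4 / t ^ 2)
    (hdn : 27 / 28 * ‖d‖ ^ 2 ≤ ⟪d, n⟫ ^ 2) :
    kernelHess L q t d n ≤ - (L / 8 * ‖d‖ ^ 2 / (q ^ 7 * t ^ 2)) := by
  set x := ⟪d, n⟫ ^ 2 with hx
  have h1 : x ≤ ‖d‖ ^ 2 := by
    have := pow_le_pow_left₀ (abs_nonneg _) (abs_real_inner_le_norm d n) 2
    rwa [hn, mul_one, sq_abs] at this
  have hθ : 27 / 28 ≤ ‖d‖ ^ 4 / (q ^ 8 * t ^ 2) := by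
    rw [le_div_iff₀ (by positivity)]
    rw [le_div_iff₀ (by positivity)] at hd
    linarith
  set θ := ‖d‖ ^ 4 / (q ^ 8 * t ^ 2) with hθd
  have h2 : kernelHess L q t d n = L / 8 / (q ^ 7 * t ^ 2) * (4 * ‖d‖ ^ 2 + 8 * x - 14 * θ * x) := by
    rw [kernelHess, hn, hθd, ← hx]
    field_simp
    ring
  have h3 : -(L / 8 * ‖d‖ ^ 2 / (q ^ 7 * t ^ 2)) = L / 8 / (q ^ 7 * t ^ 2) * (-‖d‖ ^ 2) := by ring
  rw [h2, h3]
  refine mul_le_mul_of_nonneg_left ?_ (by positivity)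
  have h4 : 27 / 28 * x ≤ θ * x := by
    have : 0 ≤ x := sq_nonneg _
    gcongr
  nlinarith [sq_nonneg ‖d‖]

set_option maxHeartbeats 800000 in
theorem coupling_contradiction {p : ℝ} (hp : 1 < p) (b : OrthonormalBasis ι ℝ E) {d : E}
    {a t q L κ H lam δ : ℝ} (ha : 0 < a) (ht : t = a ^ 10) (hq : 0 < q) (hL : 0 < L) (hκ : 0 < κ)
    (hδ : 0 < δ) (hH : 0 < H)
    (hqe : q ^ 8 = ‖d‖ ^ 4 / t ^ 2 + κ ^ 8 * a ^ 8)
    (hq4 : q ^ 4 ≤ 2 * min 1 (p - 1) / p)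
    (hang : 3584 * δ * (q * a ^ 5) ≤ L)
    (hHκ : 10 * L * κ ≤ H)
    (hδH : (2 * (√(p - 1) - 1) ^ 2 / p) ^ 3 * (13824 * L * δ ^ 2) ≤ κ ^ 7 * (H / 20) ^ 3)
    (hlam : (4 + 4 * (Fintype.card ι + (p - 2)) / p) * δ < lam)
    {A B : E →L[ℝ] E} {e f ξ ζ : E} {τ₁ τ₂ : ℝ} (he : ‖e‖ = 1) (hf : ‖f‖ = 1)
    (hξ : ξ ≠ 0 → e = (1 / ‖ξ‖) • ξ) (hζ : ζ ≠ 0 → f = (1 / ‖ζ‖) • ζ)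
    (hξd : ‖ξ - -((L / 2 * ‖d‖ ^ 2 / (q ^ 7 * t ^ 2)) • d)‖ ≤ 2 * δ)
    (hζd : ‖ζ - (L / 2 * ‖d‖ ^ 2 / (q ^ 7 * t ^ 2)) • d‖ ≤ 2 * δ)
    (hAB : ∀ x y, 0 ≤ ⟪A x, x⟫ + ⟪B y, y⟫ + kernelHess L q t d (x - y)
      + 2 * δ * (‖x‖ ^ 2 + ‖y‖ ^ 2))
    (hA : 1 / p * (∑ i, ⟪A (b i), b i⟫ + (p - 2) * ⟪A e, e⟫) - δ ≤ τ₁)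
    (hB : 1 / p * (∑ i, ⟪B (b i), b i⟫ + (p - 2) * ⟪B f, f⟫) - δ ≤ τ₂)
    (hτ : τ₁ + τ₂ ≤ L / 4 * ‖d‖ ^ 4 / (q ^ 7 * t ^ 3) - H * a / (10 * t) - lam + 2 * δ) :
    False := by
  have ht0 : 0 < t := by rw [ht]; positivity
  have hp0 : 0 < p := by linarith
  set c := √(p - 1) - 1 with hc
  have hcp : 2 * c + c ^ 2 = p - 2 := by
    have := Real.sq_sqrt (show 0 ≤ p - 1 by linarith)
    rw [hc]; linarith
  set K := L / 2 * ‖d‖ ^ 2 / (q ^ 7 * t ^ 2) with hK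
  have hK0 : 0 ≤ K := by positivity
  set g := K • d with hg
  have hng : ‖g‖ = K * ‖d‖ := by rw [hg, norm_smul, Real.norm_of_nonneg hK0]
  have hce := norm_smul_sub_le_of_direction he hξ hξd
  have hcf := norm_smul_sub_le_of_direction hf hζ hζd
  rw [norm_neg] at hce
  set S := ∑ i, ⟪A (b i), b i⟫ + (p - 2) * ⟪A e, e⟫
      + (∑ i, ⟪B (b i), b i⟫ + (p - 2) * ⟪B f, f⟫) with hS
  have hSle : 1 / p * S ≤ L / 4 * ‖d‖ ^ 4 / (q ^ 7 * t ^ 3) - H * a / (10 * t) - lam + 4 * δ := by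
    have : 1 / p * S = 1 / p * (∑ i, ⟪A (b i), b i⟫ + (p - 2) * ⟪A e, e⟫)
      + 1 / p * (∑ i, ⟪B (b i), b i⟫ + (p - 2) * ⟪B f, f⟫) := by rw [hS]; ring
    linarith
  have hlam' : (4 + 4 * (Fintype.card ι + (p - 2)) / p) * δ
      = 4 * δ + 1 / p * (2 * (2 * δ) * (Fintype.card ι + (p - 2))) := by ring
  have hd4 : ‖d‖ ^ 4 / t ^ 2 ≤ q ^ 8 := by
    have : 0 < κ ^ 8 * a ^ 8 := by positivity
    linarith
  rcases le_or_gt (27 * (κ ^ 8 * a ^ 8)) (‖d‖ ^ 4 / t ^ 2) with hcase | hcase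
  · -- reflection coupling
    have h27 : 27 / 28 * q ^ 8 ≤ ‖d‖ ^ 4 / t ^ 2 := by linarith
    have hd0 : 0 < ‖d‖ := by
      rw [norm_pos_iff]
      rintro rfl
      have : 0 < q ^ 8 := by positivity
      simp at h27
      linarith
    have hr : q ^ 2 * a ^ 5 / 2 ≤ ‖d‖ := by
      refine le_of_pow_le_pow_left₀ (n := 4) (by norm_num) hd0.le ?_
      rw [le_div_iff₀ (by positivity), ht] at h27
      have : 0 < q ^ 8 * (a ^ 10) ^ 2 := by positivity
      calc (q ^ 2 * a ^ 5 / 2) ^ 4 = 1 / 16 * (q ^ 8 * (a ^ 10) ^ 2) := by ring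
        _ ≤ ‖d‖ ^ 4 := by linarith
    have hgl : 224 * δ ≤ ‖g‖ := by
      have h1 : L / (16 * (q * a ^ 5)) ≤ ‖g‖ := by
        have h2 : (q ^ 2 * a ^ 5 / 2) ^ 3 ≤ ‖d‖ ^ 3 := by gcongr
        rw [hng, hK, ht, div_mul_eq_mul_div, div_le_div_iff₀ (by positivity) (by positivity)]
        calc L * (q ^ 7 * (a ^ 10) ^ 2) = L / 2 * (q ^ 2 * a ^ 5 / 2) ^ 3 * (16 * (q * a ^ 5)) := by
              ring
          _ ≤ L / 2 * ‖d‖ ^ 3 * (16 * (q * a ^ 5)) := by gcongr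
          _ = _ := by ring
      refine le_trans ?_ h1
      rw [le_div_iff₀ (by positivity)]
      linarith
    have hg0 : 0 < ‖g‖ := by linarith
    have hKp : 0 < K := by positivity
    have hfe : 2 * ‖g‖ ^ 2 - 8 * δ * ‖g‖ ≤ ‖g‖ * ⟪f - e, g⟫ := by
      have h1 := (abs_le.mp ((abs_real_inner_le_norm (‖g‖ • e - -g) g).trans
        (mul_le_mul_of_nonneg_right hce hg0.le))).2
      have h2 := (abs_le.mp ((abs_real_inner_le_norm (‖g‖ • f - g) g).trans
        (mul_le_mul_of_nonneg_right hcf hg0.le))).1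
      simp only [inner_sub_left, inner_neg_left, real_inner_smul_left,
        real_inner_self_eq_norm_sq] at h1 h2 ⊢
      linarith
    have hfe' : 2 * ‖g‖ - 8 * δ ≤ ⟪f - e, g⟫ := by
      refine le_of_mul_le_mul_left ?_ hg0
      linarith
    have hfed : 55 / 28 * ‖d‖ ≤ ⟪f - e, d⟫ := by
      rw [hg, real_inner_smul_right] at hfe'
      refine le_of_mul_le_mul_left ?_ hKp
      rw [hng] at hgl hfe'
      linarith
    have hef : e ≠ f := by
      rintro rfl
      simp at hfed
      linarith
    have hnef : 0 < ‖e - f‖ := by rwa [norm_pos_iff, sub_ne_zero]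
    have hnef2 : ‖e - f‖ ≤ 2 := by
      have := norm_sub_le e f
      rw [he, hf] at this; linarith
    have hco := reflection_coupling b hAB (kernelHess_smul L q t d) he hf hef c
    rw [hcp] at hco
    set n : E := (1 / ‖e - f‖) • (e - f) with hn
    have hn1 : ‖n‖ = 1 := by
      rw [hn, norm_smul, norm_div, norm_one, norm_norm, one_div, inv_mul_cancel₀ hnef.ne']
    have hdn : 27 / 28 * ‖d‖ ^ 2 ≤ ⟪d, n⟫ ^ 2 := by
      have h1 : 55 / 56 * ‖d‖ ≤ -⟪d, n⟫ := by
        rw [hn, real_inner_smul_right, ← mul_neg, ← inner_neg_right, neg_sub, real_inner_comm,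
          one_div, inv_mul_eq_div, le_div_iff₀ hnef]
        have h0 : 55 / 56 * ‖d‖ * ‖e - f‖ ≤ 55 / 56 * ‖d‖ * 2 := by gcongr
        linarith
      have h2 := mul_self_le_mul_self (by positivity) h1
      have h3 := sq_nonneg ‖d‖
      have h4 : -⟪d, n⟫ * -⟪d, n⟫ = ⟪d, n⟫ ^ 2 := by ring
      have h5 : 55 / 56 * ‖d‖ * (55 / 56 * ‖d‖) = 3025 / 3136 * ‖d‖ ^ 2 := by ring
      linarith
    have hneg := kernelHess_le_neg hL hq ht0 hn1 h27 hdn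
    set μ := min 1 (p - 1) with hμ
    have hμ0 : 0 < μ := lt_min one_pos (by linarith)
    have hμn : μ ≤ 1 + (p - 2) * ⟪e, n⟫ ^ 2 := by
      have h1 := abs_real_inner_le_norm e n
      rw [he, hn1, mul_one] at h1
      exact min_one_le_one_add_mul (sq_nonneg _) ((sq_le_one_iff_abs_le_one _).mpr h1)
    set G := L / 8 * ‖d‖ ^ 2 / (q ^ 7 * t ^ 2) with hG
    have hG0 : 0 < G := by positivity
    have hprod : 4 * (1 + (p - 2) * ⟪e, n⟫ ^ 2) * kernelHess L q t d n ≤ -(4 * μ * G) := by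
      have h1 : 0 ≤ 4 * (1 + (p - 2) * ⟪e, n⟫ ^ 2) := by linarith
      have h2 : 4 * μ * G ≤ 4 * (1 + (p - 2) * ⟪e, n⟫ ^ 2) * G := by gcongr
      have h3 := mul_le_mul_of_nonneg_left hneg h1
      rw [mul_neg] at h3
      linarith
    have hSge : 1 / p * (4 * μ * G) ≤ 1 / p * S + 1 / p * (2 * (2 * δ) * (Fintype.card ι + (p - 2))) := by
      rw [← mul_add]
      refine mul_le_mul_of_nonneg_left ?_ (by positivity)
      linarith
    have hloss : L / 4 * ‖d‖ ^ 4 / (q ^ 7 * t ^ 3) ≤ 1 / p * (4 * μ * G) := by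
      have h1 : ‖d‖ ^ 2 / t ≤ 2 * μ / p := by
        refine le_trans ?_ hq4
        refine le_of_pow_le_pow_left₀ (n := 2) (by norm_num) (by positivity) ?_
        calc (‖d‖ ^ 2 / t) ^ 2 = ‖d‖ ^ 4 / t ^ 2 := by ring
          _ ≤ q ^ 8 := hd4
          _ = _ := by ring
      calc L / 4 * ‖d‖ ^ 4 / (q ^ 7 * t ^ 3) = 2 * G * (‖d‖ ^ 2 / t) := by
            rw [hG]; field_simp; ring
        _ ≤ 2 * G * (2 * μ / p) := by gcongr
        _ = _ := by ring
    have : 0 < H * a / (10 * t) := by positivity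
    linarith
  · -- parallel coupling
    set D := 3 / 2 * L * ‖d‖ ^ 2 / (q ^ 7 * t ^ 2) with hD
    have hD0 : 0 ≤ D := by positivity
    have hco := parallel_coupling b hAB (kernelHess_le hL hq ht0 d) hD0 he hf c
    rw [hcp] at hco
    have hθ2 : ‖e + f‖ ≤ 2 := by
      have := norm_add_le e f
      rw [he, hf] at this; linarith
    have hθg : ‖g‖ * ‖e + f‖ ≤ 8 * δ := by
      have h1 : ‖g‖ • (e + f) = (‖g‖ • e - -g) + (‖g‖ • f - g) := by
        rw [smul_add]; abel
      rw [← norm_norm g, ← norm_smul, h1]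
      refine (norm_add_le _ _).trans ?_
      linarith
    set θ := ‖e + f‖ with hθ
    have hθ0 : 0 ≤ θ := norm_nonneg _
    have hκq : κ * a ≤ q := by
      refine le_of_pow_le_pow_left₀ (n := 8) (by norm_num) hq.le ?_
      have : 0 ≤ ‖d‖ ^ 4 / t ^ 2 := by positivity
      rw [mul_pow]; linarith
    have hqκ : q ≤ 2 * (κ * a) := by
      refine le_of_pow_le_pow_left₀ (n := 8) (by norm_num) (by positivity) ?_
      have : 0 < κ ^ 8 * a ^ 8 := by positivity
      rw [mul_pow, mul_pow]; linarith
    have hX : (D * θ ^ 2) ^ 3 ≤ 13824 * L * δ ^ 2 / (κ ^ 7) * (a / t) ^ 3 := by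
      have h1 : (D * θ ^ 2) ^ 3 = 27 / 2 * L / (q ^ 7 * t ^ 2) * (‖g‖ * θ) ^ 2 * θ ^ 4 := by
        rw [hD, hng, hK]; field_simp; ring
      have h2 : (‖g‖ * θ) ^ 2 ≤ (8 * δ) ^ 2 := by gcongr
      have h3 : θ ^ 4 ≤ 2 ^ 4 := by gcongr
      have h4 : (κ * a) ^ 7 ≤ q ^ 7 := by gcongr
      calc (D * θ ^ 2) ^ 3 ≤ 27 / 2 * L / ((κ * a) ^ 7 * t ^ 2) * (8 * δ) ^ 2 * 2 ^ 4 := by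
            rw [h1]; gcongr
        _ = _ := by rw [ht]; field_simp; norm_num
    have hcost : 2 * c ^ 2 / p * (D * θ ^ 2) ≤ H * a / (20 * t) := by
      refine le_of_pow_le_pow_left₀ (n := 3) (by norm_num) (by positivity) ?_
      calc (2 * c ^ 2 / p * (D * θ ^ 2)) ^ 3 = (2 * c ^ 2 / p) ^ 3 * (D * θ ^ 2) ^ 3 := by ring
        _ ≤ (2 * c ^ 2 / p) ^ 3 * (13824 * L * δ ^ 2 / (κ ^ 7) * (a / t) ^ 3) := by gcongr
        _ = (2 * c ^ 2 / p) ^ 3 * (13824 * L * δ ^ 2) * ((a / t) ^ 3 / κ ^ 7) := by ring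
        _ ≤ κ ^ 7 * (H / 20) ^ 3 * ((a / t) ^ 3 / κ ^ 7) := by gcongr
        _ = (H * a / (20 * t)) ^ 3 := by field_simp
    have hloss : L / 4 * ‖d‖ ^ 4 / (q ^ 7 * t ^ 3) ≤ H * a / (20 * t) := by
      calc L / 4 * ‖d‖ ^ 4 / (q ^ 7 * t ^ 3) = L / 4 / (q ^ 7 * t) * (‖d‖ ^ 4 / t ^ 2) := by
            field_simp
        _ ≤ L / 4 / (q ^ 7 * t) * q ^ 8 := by gcongr
        _ = L / 4 * q / t := by field_simp
        _ ≤ L / 4 * (2 * (κ * a)) / t := by gcongr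
        _ = 10 * L * κ * a / (20 * t) := by field_simp; norm_num
        _ ≤ _ := by gcongr
    have hsum : 0 ≤ 1 / p * S + 2 * c ^ 2 / p * (D * θ ^ 2)
        + 1 / p * (2 * (2 * δ) * (Fintype.card ι + (p - 2))) := by
      have : 1 / p * S + 2 * c ^ 2 / p * (D * θ ^ 2)
        + 1 / p * (2 * (2 * δ) * (Fintype.card ι + (p - 2)))
        = 1 / p * (S + 2 * c ^ 2 * D * θ ^ 2 + 2 * (2 * δ) * (Fintype.card ι + (p - 2))) := by
        ring
      rw [this]
      positivity
    have hsplit : H * a / (10 * t) = H * a / (20 * t) + H * a / (20 * t) := by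
      field_simp; norm_num
    linarith
end

theorem hasDerivAt_comp_line {V : Type*} [NormedAddCommGroup V] [NormedSpace ℝ V] {f : V → ℝ}
    {w : V} (hf : DifferentiableAt ℝ f w) (v : V) :
    HasDerivAt (fun σ : ℝ => f (w + σ • v)) (fderiv ℝ f w v) 0 := by
  have h1 : HasFDerivAt f (fderiv ℝ f w) (w + (0 : ℝ) • v) := by
    rw [zero_smul, add_zero]
    exact hf.hasFDerivAt
  have h2 : HasDerivAt (fun σ : ℝ => w + σ • v) v 0 := by
    simpa using ((hasDerivAt_id (0 : ℝ)).smul_const v).const_add w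
  exact h1.comp_hasDerivAt (0 : ℝ) h2

theorem hasDerivAt_quadratic (A B C σ : ℝ) :
    HasDerivAt (fun σ : ℝ => A + 2 * B * σ + C * σ ^ 2) (2 * B + 2 * C * σ) σ := by
  have := (((hasDerivAt_id σ).const_mul (2 * B)).const_add A).add
    ((hasDerivAt_pow 2 σ).const_mul C)
  refine this.congr_deriv ?_
  push_cast
  ring

theorem hasDerivAt_rpow_kernel (A B C c t r : ℝ) (hc : 0 < c) (σ : ℝ) :
    HasDerivAt (fun σ : ℝ => ((A + 2 * B * σ + C * σ ^ 2) ^ 2 / t ^ 2 + c) ^ r)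
      (2 * (A + 2 * B * σ + C * σ ^ 2) * (2 * B + 2 * C * σ) / t ^ 2 * r *
        ((A + 2 * B * σ + C * σ ^ 2) ^ 2 / t ^ 2 + c) ^ (r - 1)) σ := by
  have h1 : 0 < (A + 2 * B * σ + C * σ ^ 2) ^ 2 / t ^ 2 + c := by positivity
  have h2 := (((hasDerivAt_quadratic A B C σ).pow 2).div_const (t ^ 2)).add_const c
  have := h2.rpow_const (p := r) (Or.inl h1.ne')
  refine this.congr_deriv ?_
  simp only [Pi.pow_apply]
  push_cast
  ring_nf

theorem hasDerivAt_sqrt_quadratic (A B C : ℝ) (σ : ℝ) (h : 0 < A + 2 * B * σ + C * σ ^ 2) :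
    HasDerivAt (fun σ : ℝ => √(A + 2 * B * σ + C * σ ^ 2))
      ((B + C * σ) / √(A + 2 * B * σ + C * σ ^ 2)) σ := by
  convert (hasDerivAt_quadratic A B C σ).sqrt h.ne' using 1
  have : √(A + 2 * B * σ + C * σ ^ 2) ≠ 0 := (Real.sqrt_pos.mpr h).ne'
  field_simp

theorem hasDerivAt_rpow_kernel_deriv (A B C c t q : ℝ) (hc : 0 < c) (hq : 0 < q)
    (hqe : q ^ 8 = A ^ 2 / t ^ 2 + c) (ht : t ≠ 0) :
    HasDerivAt (fun σ : ℝ => 2 * (A + 2 * B * σ + C * σ ^ 2) * (2 * B + 2 * C * σ) / t ^ 2 *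
        (1 / 8) * ((A + 2 * B * σ + C * σ ^ 2) ^ 2 / t ^ 2 + c) ^ ((1 : ℝ) / 8 - 1))
      (A / 2 / (q ^ 7 * t ^ 2) * C + (1 / (q ^ 7 * t ^ 2) - 7 / 4 * A ^ 2 / (q ^ 15 * t ^ 4)) * B ^ 2)
      0 := by
  have h1 := hasDerivAt_rpow_kernel A B C c t ((1 : ℝ) / 8 - 1) hc 0
  have h2 := hasDerivAt_quadratic A B C 0
  have h3 : HasDerivAt (fun σ : ℝ => 2 * B + 2 * C * σ) (2 * C) 0 := by
    simpa using ((hasDerivAt_id (0 : ℝ)).const_mul (2 * C)).const_add (2 * B)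
  have h4 := ((((h2.const_mul 2).mul h3).div_const (t ^ 2)).mul_const (1 / 8 : ℝ)).mul h1
  have r7 : (A ^ 2 / t ^ 2 + c) ^ ((1 : ℝ) / 8 - 1) = (q ^ 7)⁻¹ := by
    rw [← hqe, ← Real.rpow_natCast, ← Real.rpow_mul hq.le, ← Real.rpow_natCast,
      ← Real.rpow_neg hq.le]
    norm_num
  have r15 : (A ^ 2 / t ^ 2 + c) ^ ((1 : ℝ) / 8 - 1 - 1) = (q ^ 15)⁻¹ := by
    rw [← hqe, ← Real.rpow_natCast, ← Real.rpow_mul hq.le, ← Real.rpow_natCast,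
      ← Real.rpow_neg hq.le]
    norm_num
  refine h4.congr_deriv ?_
  simp only [mul_zero, add_zero, ne_eq, OfNat.ofNat_ne_zero, not_false_eq_true, zero_pow,
    Pi.mul_apply, r7, r15]
  field_simp
  ring

theorem hasDerivAt_sqrt_quadratic_deriv (A B C : ℝ) (h : 0 < A) :
    HasDerivAt (fun σ : ℝ => (B + C * σ) / √(A + 2 * B * σ + C * σ ^ 2))
      (C / √A - B ^ 2 / √A ^ 3) 0 := by
  have h1 := hasDerivAt_sqrt_quadratic A B C 0 (by simpa using h)
  have h3 : HasDerivAt (fun σ : ℝ => B + C * σ) C 0 := by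
    simpa using ((hasDerivAt_id (0 : ℝ)).const_mul C).const_add B
  have hs : √A ≠ 0 := (Real.sqrt_pos.mpr h).ne'
  have := h3.div h1 (by simpa using hs)
  refine this.congr_deriv ?_
  simp only [mul_zero, add_zero, ne_eq, OfNat.ofNat_ne_zero, not_false_eq_true, zero_pow]
  field_simp

section
variable {N : ℕ}

/-- The doubling penalty. -/
def couplingFn (L κ δ s ε H lam : ℝ) (w : WithLp 2 (SpaceTime N × SpaceTime N)) : ℝ :=
  L * ((‖w.fst.fst - w.snd.fst‖ ^ 2) ^ 2 / w.fst.snd ^ 2 + κ ^ 8 * w.fst.snd ^ (4 / 5 : ℝ))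
      ^ (1 / 8 : ℝ)
    + δ * √(1 + ‖w.fst.fst‖ ^ 2) + (w.snd.snd - w.fst.snd - s) ^ 2 / ε
    + H * w.fst.snd ^ (1 / 10 : ℝ) + lam * w.fst.snd

theorem contDiffAt_couplingFn {L κ δ s ε H lam : ℝ} (hκ : 0 < κ)
    {w : WithLp 2 (SpaceTime N × SpaceTime N)} (hw : 0 < w.fst.snd) :
    ContDiffAt ℝ 2 (couplingFn L κ δ s ε H lam) w := by
  have c1 : ContDiff ℝ 2 fun w : WithLp 2 (SpaceTime N × SpaceTime N) => w.fst.fst :=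
    ((WithLp.fstL 2 ℝ (EuclideanSpace ℝ (Fin N)) ℝ).comp
      (WithLp.fstL 2 ℝ (SpaceTime N) (SpaceTime N))).contDiff
  have c2 : ContDiff ℝ 2 fun w : WithLp 2 (SpaceTime N × SpaceTime N) => w.fst.snd :=
    ((WithLp.sndL 2 ℝ (EuclideanSpace ℝ (Fin N)) ℝ).comp
      (WithLp.fstL 2 ℝ (SpaceTime N) (SpaceTime N))).contDiff
  have c3 : ContDiff ℝ 2 fun w : WithLp 2 (SpaceTime N × SpaceTime N) => w.snd.fst :=
    ((WithLp.fstL 2 ℝ (EuclideanSpace ℝ (Fin N)) ℝ).comp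
      (WithLp.sndL 2 ℝ (SpaceTime N) (SpaceTime N))).contDiff
  have c4 : ContDiff ℝ 2 fun w : WithLp 2 (SpaceTime N × SpaceTime N) => w.snd.snd :=
    ((WithLp.sndL 2 ℝ (EuclideanSpace ℝ (Fin N)) ℝ).comp
      (WithLp.sndL 2 ℝ (SpaceTime N) (SpaceTime N))).contDiff
  have hq : 0 < (‖w.fst.fst - w.snd.fst‖ ^ 2) ^ 2 / w.fst.snd ^ 2
      + κ ^ 8 * w.fst.snd ^ (4 / 5 : ℝ) := by positivity
  have p1 : ContDiffAt ℝ 2 (fun w : WithLp 2 (SpaceTime N × SpaceTime N) =>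
      ((‖w.fst.fst - w.snd.fst‖ ^ 2) ^ 2 / w.fst.snd ^ 2
      + κ ^ 8 * w.fst.snd ^ (4 / 5 : ℝ)) ^ (1 / 8 : ℝ)) w :=
    ((((((c1.sub c3).norm_sq ℝ).pow 2).contDiffAt).div ((c2.pow 2).contDiffAt)
      (by positivity)).add (contDiffAt_const.mul
        (c2.contDiffAt.rpow_const_of_ne hw.ne'))).rpow_const_of_ne hq.ne'
  have p2 : ContDiffAt ℝ 2 (fun w : WithLp 2 (SpaceTime N × SpaceTime N) =>
      √(1 + ‖w.fst.fst‖ ^ 2)) w :=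
    ((contDiff_const.add (c1.norm_sq ℝ)).contDiffAt).sqrt (by positivity)
  exact ((((contDiffAt_const.mul p1).add (contDiffAt_const.mul p2)).add
    ((((c4.sub c2).sub contDiff_const).pow 2).div_const ε).contDiffAt).add
    (contDiffAt_const.mul (c2.contDiffAt.rpow_const_of_ne hw.ne'))).add
    (contDiffAt_const.mul c2.contDiffAt)

theorem fderiv_couplingFn_space {L κ δ s ε H lam : ℝ} (hκ : 0 < κ)
    {w : WithLp 2 (SpaceTime N × SpaceTime N)} (hw : 0 < w.fst.snd) {q : ℝ} (hq : 0 < q)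
    (hqe : q ^ 8 = (‖w.fst.fst - w.snd.fst‖ ^ 2) ^ 2 / w.fst.snd ^ 2
      + κ ^ 8 * w.fst.snd ^ (4 / 5 : ℝ)) (x y : EuclideanSpace ℝ (Fin N))
    {v : WithLp 2 (SpaceTime N × SpaceTime N)}
    (hv : v = inlL2 _ (spaceIncl N x) + inrL2 _ (spaceIncl N y)) :
    fderiv ℝ (couplingFn L κ δ s ε H lam) w v
      = L / 2 * ‖w.fst.fst - w.snd.fst‖ ^ 2 / (q ^ 7 * w.fst.snd ^ 2) *
          ⟪w.fst.fst - w.snd.fst, x - y⟫ + δ / √(1 + ‖w.fst.fst‖ ^ 2) * ⟪w.fst.fst, x⟫ ∧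
    fderiv ℝ (fderiv ℝ (couplingFn L κ δ s ε H lam)) w v v
      = kernelHess L q w.fst.snd (w.fst.fst - w.snd.fst) (x - y)
        + δ * (‖x‖ ^ 2 / √(1 + ‖w.fst.fst‖ ^ 2) - ⟪w.fst.fst, x⟫ ^ 2 / √(1 + ‖w.fst.fst‖ ^ 2) ^ 3)
        := by
  set d := w.fst.fst - w.snd.fst with hd
  set t := w.fst.snd with ht
  set c := κ ^ 8 * t ^ (4 / 5 : ℝ) with hc
  have hc0 : 0 < c := by positivity
  set r := (w.snd.snd - t - s) ^ 2 / ε + H * t ^ (1 / 10 : ℝ) + lam * t with hr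
  have hline : ∀ σ : ℝ, couplingFn L κ δ s ε H lam (w + σ • v)
      = L * ((‖d‖ ^ 2 + 2 * ⟪d, x - y⟫ * σ + ‖x - y‖ ^ 2 * σ ^ 2) ^ 2 / t ^ 2 + c) ^ (1 / 8 : ℝ)
        + δ * √(1 + ‖w.fst.fst‖ ^ 2 + 2 * ⟪w.fst.fst, x⟫ * σ + ‖x‖ ^ 2 * σ ^ 2) + r := fun σ => by
    have e1 : (w + σ • v).fst.fst = w.fst.fst + σ • x := by
      rw [hv]; change w.fst.fst + σ • (x + 0) = _; rw [add_zero]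
    have e2 : (w + σ • v).fst.snd = t := by
      rw [hv]; change w.fst.snd + σ • ((0 : ℝ) + 0) = _; rw [add_zero, smul_zero, add_zero]
    have e3 : (w + σ • v).snd.fst = w.snd.fst + σ • y := by
      rw [hv]; change w.snd.fst + σ • (0 + y) = _; rw [zero_add]
    have e4 : (w + σ • v).snd.snd = w.snd.snd := by
      rw [hv]; change w.snd.snd + σ • ((0 : ℝ) + 0) = _; rw [add_zero, smul_zero, add_zero]
    have e5 : w.fst.fst + σ • x - (w.snd.fst + σ • y) = d + σ • (x - y) := by
      rw [hd, smul_sub]; abel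
    have e6 : ∀ a b : EuclideanSpace ℝ (Fin N), ‖a + σ • b‖ ^ 2
        = ‖a‖ ^ 2 + 2 * ⟪a, b⟫ * σ + ‖b‖ ^ 2 * σ ^ 2 := fun a b => by
      rw [norm_add_sq_real, norm_smul, real_inner_smul_right, Real.norm_eq_abs, mul_pow, sq_abs]
      ring
    rw [couplingFn, e1, e2, e3, e4, e5, e6, e6, hr, hc]
    simp only [← add_assoc]
  have hpos : ∀ σ : ℝ, 0 < 1 + ‖w.fst.fst‖ ^ 2 + 2 * ⟪w.fst.fst, x⟫ * σ + ‖x‖ ^ 2 * σ ^ 2 :=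
    fun σ => by
    have : 0 ≤ ‖w.fst.fst + σ • x‖ ^ 2 := by positivity
    rw [norm_add_sq_real, norm_smul, real_inner_smul_right, Real.norm_eq_abs, mul_pow, sq_abs] at this
    linarith
  set G : ℝ → ℝ := fun σ => L * (2 * (‖d‖ ^ 2 + 2 * ⟪d, x - y⟫ * σ + ‖x - y‖ ^ 2 * σ ^ 2) *
      (2 * ⟪d, x - y⟫ + 2 * ‖x - y‖ ^ 2 * σ) / t ^ 2 * (1 / 8) *
      ((‖d‖ ^ 2 + 2 * ⟪d, x - y⟫ * σ + ‖x - y‖ ^ 2 * σ ^ 2) ^ 2 / t ^ 2 + c) ^ ((1 : ℝ) / 8 - 1))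
    + δ * ((⟪w.fst.fst, x⟫ + ‖x‖ ^ 2 * σ) /
      √(1 + ‖w.fst.fst‖ ^ 2 + 2 * ⟪w.fst.fst, x⟫ * σ + ‖x‖ ^ 2 * σ ^ 2)) with hG
  have h := fderiv_apply_eq_of_line (v := v) (g := G) (contDiffAt_couplingFn (L := L) (δ := δ) (s := s)
    (ε := ε) (H := H) (lam := lam) hκ hw) (Eventually.of_forall fun σ => by
      simp only [hline]
      exact (((hasDerivAt_rpow_kernel (‖d‖ ^ 2) ⟪d, x - y⟫ (‖x - y‖ ^ 2) c t (1 / 8) hc0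
        σ).const_mul L).add ((hasDerivAt_sqrt_quadratic (1 + ‖w.fst.fst‖ ^ 2) ⟪w.fst.fst, x⟫
        (‖x‖ ^ 2) σ (hpos σ)).const_mul δ)).add_const r)
    (((hasDerivAt_rpow_kernel_deriv (‖d‖ ^ 2) ⟪d, x - y⟫ (‖x - y‖ ^ 2) c t q hc0 hq hqe
      hw.ne').const_mul L).add ((hasDerivAt_sqrt_quadratic_deriv (1 + ‖w.fst.fst‖ ^ 2)
      ⟪w.fst.fst, x⟫ (‖x‖ ^ 2) (by positivity)).const_mul δ))
  have r7 : ((‖d‖ ^ 2) ^ 2 / t ^ 2 + c) ^ ((1 : ℝ) / 8 - 1) = (q ^ 7)⁻¹ := by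
    rw [← hqe, ← Real.rpow_natCast, ← Real.rpow_mul hq.le, ← Real.rpow_natCast,
      ← Real.rpow_neg hq.le]
    norm_num
  refine ⟨h.1.trans ?_, h.2.trans ?_⟩
  · simp only [hG, mul_zero, add_zero, ne_eq, OfNat.ofNat_ne_zero, not_false_eq_true, zero_pow, r7]
    field_simp
    ring
  · rw [kernelHess]
    ring

theorem le_fderiv_couplingFn_time {L κ δ s ε H lam : ℝ} (hκ : 0 < κ) (hL : 0 < L)
    {w : WithLp 2 (SpaceTime N × SpaceTime N)} (hw : 0 < w.fst.snd) {q : ℝ} (hq : 0 < q)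
    (hqe : q ^ 8 = (‖w.fst.fst - w.snd.fst‖ ^ 2) ^ 2 / w.fst.snd ^ 2
      + κ ^ 8 * w.fst.snd ^ (4 / 5 : ℝ))
    {v : WithLp 2 (SpaceTime N × SpaceTime N)}
    (hv : v = inlL2 _ (stPoint 0 1) + inrL2 _ (stPoint 0 1)) :
    -(L / 4 * ‖w.fst.fst - w.snd.fst‖ ^ 4 / (q ^ 7 * w.fst.snd ^ 3))
        + H * w.fst.snd ^ (1 / 10 : ℝ) / (10 * w.fst.snd) + lam
      ≤ fderiv ℝ (couplingFn L κ δ s ε H lam) w v := by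
  set d := w.fst.fst - w.snd.fst with hd
  set t := w.fst.snd with ht
  have hline : ∀ σ : ℝ, couplingFn L κ δ s ε H lam (w + σ • v)
      = L * ((‖d‖ ^ 2) ^ 2 / (t + σ) ^ 2 + κ ^ 8 * (t + σ) ^ (4 / 5 : ℝ)) ^ (1 / 8 : ℝ)
        + (δ * √(1 + ‖w.fst.fst‖ ^ 2) + (w.snd.snd - t - s) ^ 2 / ε)
        + H * (t + σ) ^ (1 / 10 : ℝ) + lam * (t + σ) := fun σ => by
    have e1 : (w + σ • v).fst.fst = w.fst.fst := by
      rw [hv]; change w.fst.fst + σ • (0 + 0) = _; rw [add_zero, smul_zero, add_zero]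
    have e2 : (w + σ • v).fst.snd = t + σ := by
      rw [hv]; change w.fst.snd + σ • ((1 : ℝ) + 0) = _; rw [add_zero, smul_eq_mul, mul_one]
    have e3 : (w + σ • v).snd.fst = w.snd.fst := by
      rw [hv]; change w.snd.fst + σ • (0 + 0) = _; rw [add_zero, smul_zero, add_zero]
    have e4 : (w + σ • v).snd.snd = w.snd.snd + σ := by
      rw [hv]; change w.snd.snd + σ • ((0 : ℝ) + 1) = _; rw [zero_add, smul_eq_mul, mul_one]
    rw [couplingFn, e1, e2, e3, e4, ← hd]
    ring_nf
  have d1 : HasDerivAt (fun σ : ℝ => t + σ) 1 0 := by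
    simpa using (hasDerivAt_id (0 : ℝ)).const_add t
  have d2 : ∀ r : ℝ, HasDerivAt (fun σ : ℝ => (t + σ) ^ r) (r * t ^ (r - 1)) 0 := fun r => by
    have := d1.rpow_const (p := r) (Or.inl (by simpa using hw.ne'))
    simpa using this
  have d3 : HasDerivAt (fun σ : ℝ => (‖d‖ ^ 2) ^ 2 / (t + σ) ^ 2) (-(2 * ‖d‖ ^ 4 / t ^ 3)) 0 := by
    have := (hasDerivAt_const (0 : ℝ) ((‖d‖ ^ 2) ^ 2)).div (d1.pow 2)
      (by simpa using hw.ne')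
    refine this.congr_deriv ?_
    simp only [add_zero, Pi.pow_apply]
    push_cast
    field_simp
    ring
  have hqp : 0 < (‖d‖ ^ 2) ^ 2 / t ^ 2 + κ ^ 8 * t ^ (4 / 5 : ℝ) := by positivity
  have d4 := (d3.add ((d2 (4 / 5)).const_mul (κ ^ 8))).rpow_const (p := 1 / 8)
    (Or.inl (by simpa using hqp.ne'))
  have d5 := (((d4.const_mul L).add_const
    (δ * √(1 + ‖w.fst.fst‖ ^ 2) + (w.snd.snd - t - s) ^ 2 / ε)).add
    ((d2 (1 / 10)).const_mul H)).add (d1.const_mul lam)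
  have d6 : HasDerivAt (fun σ : ℝ => couplingFn L κ δ s ε H lam (w + σ • v))
      (fderiv ℝ (couplingFn L κ δ s ε H lam) w v) 0 :=
    hasDerivAt_comp_line ((contDiffAt_couplingFn hκ hw).differentiableAt (by simp)) v
  rw [funext hline] at d6
  have hu := d6.unique d5
  have r7 : ((‖d‖ ^ 2) ^ 2 / t ^ 2 + κ ^ 8 * t ^ (4 / 5 : ℝ)) ^ ((1 : ℝ) / 8 - 1)
      = (q ^ 7)⁻¹ := by
    rw [← hqe, ← Real.rpow_natCast, ← Real.rpow_mul hq.le, ← Real.rpow_natCast,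
      ← Real.rpow_neg hq.le]
    norm_num
  rw [hu]
  simp only [add_zero, Pi.add_apply, r7]
  have ra : t ^ ((1 : ℝ) / 10 - 1) = t ^ (1 / 10 : ℝ) / t := by
    rw [Real.rpow_sub_one hw.ne']
  rw [ra]
  have hpos : 0 ≤ L * (κ ^ 8 * (4 / 5 * t ^ ((4 : ℝ) / 5 - 1)) * (1 / 8) * (q ^ 7)⁻¹) := by
    positivity
  have e : L * ((-(2 * ‖d‖ ^ 4 / t ^ 3) + κ ^ 8 * (4 / 5 * t ^ ((4 : ℝ) / 5 - 1))) * (1 / 8)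
        * (q ^ 7)⁻¹) + H * (1 / 10 * (t ^ (1 / 10 : ℝ) / t)) + lam * 1
      = -(L / 4 * ‖d‖ ^ 4 / (q ^ 7 * t ^ 3)) + H * t ^ (1 / 10 : ℝ) / (10 * t) + lam
        + L * (κ ^ 8 * (4 / 5 * t ^ ((4 : ℝ) / 5 - 1)) * (1 / 8) * (q ^ 7)⁻¹) := by
    field_simp
    ring
  linarith
end

section
variable {N : ℕ}

theorem norm_fst_le_spaceTime (v : SpaceTime N) : ‖v.fst‖ ≤ ‖v‖ := by
  have := WithLp.prod_norm_sq_eq_of_L2 v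
  exact (sq_le_sq₀ (norm_nonneg _) (norm_nonneg _)).mp (by nlinarith [sq_nonneg ‖v.snd‖])

theorem abs_snd_le_spaceTime (v : SpaceTime N) : |v.snd| ≤ ‖v‖ := by
  have := WithLp.prod_norm_sq_eq_of_L2 v
  rw [← Real.norm_eq_abs]
  exact (sq_le_sq₀ (norm_nonneg _) (norm_nonneg _)).mp (by nlinarith [sq_nonneg ‖v.fst‖])

theorem continuousOn_spaceTime {Ω : Set (EuclideanSpace ℝ (Fin N))} (hΩ : IsOpen Ω)
    {u : EuclideanSpace ℝ (Fin N) → ℝ → ℝ}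
    (hu : ContinuousOn (fun q : EuclideanSpace ℝ (Fin N) × ℝ => u q.1 q.2) (Ω ×ˢ Ioi 0))
    {v : SpaceTime N} (hx : v.fst ∈ Ω) (ht : 0 < v.snd) :
    ∃ r > 0, ContinuousOn (fun v : SpaceTime N => u v.fst v.snd) (closedBall v r) ∧
      ∀ y ∈ closedBall v r, y.fst ∈ Ω ∧ 0 < y.snd := by
  have hc : Continuous fun v : SpaceTime N => ((v.fst, v.snd) : EuclideanSpace ℝ (Fin N) × ℝ) :=
    (WithLp.prodContinuousLinearEquiv 2 ℝ (EuclideanSpace ℝ (Fin N)) ℝ).continuous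
  have ho : IsOpen ((fun v : SpaceTime N => ((v.fst, v.snd) : EuclideanSpace ℝ (Fin N) × ℝ)) ⁻¹'
      (Ω ×ˢ Ioi 0)) := (hΩ.prod isOpen_Ioi).preimage hc
  obtain ⟨r, hr, hb⟩ := Metric.nhds_basis_closedBall.mem_iff.mp
    (ho.mem_nhds (show v ∈ _ from ⟨hx, ht⟩))
  exact ⟨r, hr, hu.comp hc.continuousOn hb, fun y hy => hb hy⟩

theorem no_interior_min [NeZero N] {p : ℝ} (hp : 1 < p) {Ω : Set (EuclideanSpace ℝ (Fin N))}
    (hΩ : IsOpen Ω) {u : EuclideanSpace ℝ (Fin N) → ℝ → ℝ} (hu : IsViscositySol p Ω u)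
    {L κ δ s ε H lam : ℝ} (hL : 0 < L) (hκ : 0 < κ) (hδ : 0 < δ) (hH : 0 < H)
    {w : WithLp 2 (SpaceTime N × SpaceTime N)}
    (hw1 : w.fst.fst ∈ Ω) (ht1 : 0 < w.fst.snd) (hw2 : w.snd.fst ∈ Ω) (ht2 : 0 < w.snd.snd)
    {q : ℝ} (hq : 0 < q) (hqe : q ^ 8 = (‖w.fst.fst - w.snd.fst‖ ^ 2) ^ 2 / w.fst.snd ^ 2
      + κ ^ 8 * w.fst.snd ^ (4 / 5 : ℝ))
    (hq4 : q ^ 4 ≤ 2 * min 1 (p - 1) / p)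
    (hang : 3584 * δ * (q * (w.fst.snd ^ (1 / 10 : ℝ)) ^ 5) ≤ L)
    (hHκ : 10 * L * κ ≤ H)
    (hδH : (2 * (√(p - 1) - 1) ^ 2 / p) ^ 3 * (13824 * L * δ ^ 2) ≤ κ ^ 7 * (H / 20) ^ 3)
    (hlam : (4 + 4 * (N + (p - 2)) / p) * δ < lam)
    (hmin : ∀ᶠ w' in 𝓝 w, u w.fst.fst w.fst.snd + u w.snd.fst w.snd.snd
        + couplingFn L κ δ s ε H lam w
      ≤ u w'.fst.fst w'.fst.snd + u w'.snd.fst w'.snd.snd + couplingFn L κ δ s ε H lam w') :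
    False := by
  set d := w.fst.fst - w.snd.fst with hd
  set t := w.fst.snd with ht
  obtain ⟨P, Q, hP, hQ, hT⟩ := exists_taylor_two (contDiffAt_couplingFn (L := L) (δ := δ) (s := s)
    (ε := ε) (H := H) (lam := lam) hκ ht1)
  obtain ⟨r1, hr1, hc1, hb1⟩ := continuousOn_spaceTime hΩ hu.1 hw1 ht1
  obtain ⟨r2, hr2, hc2, hb2⟩ := continuousOn_spaceTime hΩ hu.1 hw2 ht2
  have hη : 0 < min δ (min r1 r2) := by positivity
  obtain ⟨y₁, y₂, ξ, ζ, A, B, hy1, hy2, hξ, hζ, hjA, hjB, hAB⟩ :=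
    exists_jets_of_min (lt_min hr1 hr2)
      (hc1.mono (closedBall_subset_closedBall (min_le_left _ _)))
      (hc2.mono (closedBall_subset_closedBall (min_le_right _ _)))
      (P := P) (Q := Q) (fun e he => by
        have h0 : Tendsto (fun h : WithLp 2 (SpaceTime N × SpaceTime N) => w + h) (𝓝 0) (𝓝 w) := by
          simpa using (continuous_const_add w).tendsto 0
        filter_upwards [hT e he, h0.eventually hmin] with h h1 h2
        have h3 := (abs_le.mp h1).2
        have e1 : (w + h).fst = w.fst + h.fst := rfl
        have e2 : (w + h).snd = w.snd + h.snd := rfl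
        simp only [e1, e2] at h2
        linarith) hη
  have hηδ : min δ (min r1 r2) ≤ δ := min_le_left _ _
  obtain ⟨hyΩ1, hyt1⟩ := hb1 y₁ (by
    rw [mem_closedBall_iff_norm]
    exact hy1.trans ((min_le_right _ _).trans (min_le_left _ _)))
  obtain ⟨hyΩ2, hyt2⟩ := hb2 y₂ (by
    rw [mem_closedBall_iff_norm]
    exact hy2.trans ((min_le_right _ _).trans (min_le_right _ _)))
  have hp0 : 0 < p := by linarith
  obtain ⟨e, he, hed, hAe⟩ := exists_unit_le_of_hasLowerJet hp0 hu hyΩ1 hyt1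
    (by rw [stPoint_eta]; exact hjA) hδ
  obtain ⟨f, hf, hfd, hBf⟩ := exists_unit_le_of_hasLowerJet hp0 hu hyΩ2 hyt2
    (by rw [stPoint_eta]; exact hjB) hδ
  set K := L / 2 * ‖d‖ ^ 2 / (q ^ 7 * t ^ 2) with hK
  set ρ := √(1 + ‖w.fst.fst‖ ^ 2) with hρ
  have hρ0 : 0 < ρ := Real.sqrt_pos.mpr (by positivity)
  have hρ1 : 1 ≤ ρ := by rw [hρ, Real.one_le_sqrt]; nlinarith [sq_nonneg ‖w.fst.fst‖]
  have hρn : ‖w.fst.fst‖ ≤ ρ := Real.le_sqrt_of_sq_le (by linarith)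
  have hsp := fun x y => fderiv_couplingFn_space (L := L) (δ := δ) (s := s)
    (ε := ε) (H := H) (lam := lam) hκ ht1 hq hqe x y rfl
  have hP1 : P.fst.fst = K • d + (δ / ρ) • w.fst.fst := by
    refine ext_inner_right ℝ fun x => ?_
    have h1 := (hsp x 0).1
    rw [← hP, map_zero, map_zero, add_zero, inner_inlL2_right, ← stPoint_zero_right,
      inner_stPoint_right, mul_zero, add_zero, sub_zero] at h1
    rw [h1, inner_add_left, real_inner_smul_left, real_inner_smul_left]
  have hP2 : P.snd.fst = -(K • d) := by
    refine ext_inner_right ℝ fun x => ?_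
    have h1 := (hsp 0 x).1
    rw [← hP, map_zero, map_zero, zero_add, inner_inrL2_right, ← stPoint_zero_right,
      inner_stPoint_right, mul_zero, add_zero, zero_sub, inner_zero_right, mul_zero, add_zero] at h1
    rw [h1, inner_neg_right, inner_neg_left, real_inner_smul_left, mul_neg]
  have hPt : -(L / 4 * ‖d‖ ^ 4 / (q ^ 7 * t ^ 3)) + H * t ^ (1 / 10 : ℝ) / (10 * t) + lam
      ≤ P.fst.snd + P.snd.snd := by
    have h1 := le_fderiv_couplingFn_time (δ := δ) (s := s) (ε := ε) (H := H) (lam := lam)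
      hκ hL ht1 hq hqe rfl
    rw [← hP, inner_add_right, inner_inlL2_right, inner_inrL2_right, inner_stPoint_right,
      inner_stPoint_right, inner_zero_right, inner_zero_right] at h1
    simpa only [mul_one, zero_add] using h1
  have hsQ : ∀ x y : EuclideanSpace ℝ (Fin N), 0 ≤
      ⟪A (spaceIncl N x), spaceIncl N x⟫ + ⟪B (spaceIncl N y), spaceIncl N y⟫
        + kernelHess L q t d (x - y) + 2 * δ * (‖x‖ ^ 2 + ‖y‖ ^ 2) := fun x y => by
    set v := inlL2 _ (spaceIncl N x) + inrL2 _ (spaceIncl N y) with hv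
    have e1 : v.fst = spaceIncl N x := by
      change spaceIncl N x + 0 = _; rw [add_zero]
    have e2 : v.snd = spaceIncl N y := by
      change 0 + spaceIncl N y = _; rw [zero_add]
    have h1 := hAB v
    have h2 := WithLp.prod_norm_sq_eq_of_L2 v
    rw [hQ, (hsp x y).2, h2, e1, e2, norm_spaceIncl, norm_spaceIncl] at h1
    have h3 : ‖x‖ ^ 2 / ρ - ⟪w.fst.fst, x⟫ ^ 2 / ρ ^ 3 ≤ ‖x‖ ^ 2 := by
      have h4 : 0 ≤ ⟪w.fst.fst, x⟫ ^ 2 / ρ ^ 3 := by positivity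
      have h5 : ‖x‖ ^ 2 / ρ ≤ ‖x‖ ^ 2 := div_le_self (by positivity) hρ1
      linarith
    have h6 := mul_le_mul_of_nonneg_left h3 hδ.le
    have h7 := mul_le_mul_of_nonneg_right hηδ (show 0 ≤ ‖x‖ ^ 2 + ‖y‖ ^ 2 by positivity)
    have h8 : 0 ≤ δ * ‖y‖ ^ 2 := by positivity
    linarith
  have hcomp : ∀ (A : SpaceTime N →L[ℝ] SpaceTime N) (x y : EuclideanSpace ℝ (Fin N)),
      ⟪(ContinuousLinearMap.adjoint (spaceIncl N)).comp (A.comp (spaceIncl N)) x, y⟫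
        = ⟪A (spaceIncl N x), spaceIncl N y⟫ := fun A x y => by
    rw [ContinuousLinearMap.comp_apply, ContinuousLinearMap.adjoint_inner_left]
    rfl
  have ha : 0 < t ^ (1 / 10 : ℝ) := by positivity
  have hta : t = (t ^ (1 / 10 : ℝ)) ^ 10 := by
    rw [← Real.rpow_natCast, ← Real.rpow_mul ht1.le]; norm_num
  have hta8 : t ^ (4 / 5 : ℝ) = (t ^ (1 / 10 : ℝ)) ^ 8 := by
    rw [← Real.rpow_natCast, ← Real.rpow_mul ht1.le]; norm_num
  refine coupling_contradiction hp (EuclideanSpace.basisFun (Fin N) ℝ) (d := d) ha hta hq hL hκ hδ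
    hH (by rw [hqe, hta8]; ring) hq4 hang hHκ hδH (by simpa using hlam)
    (A := (ContinuousLinearMap.adjoint (spaceIncl N)).comp (A.comp (spaceIncl N)))
    (B := (ContinuousLinearMap.adjoint (spaceIncl N)).comp (B.comp (spaceIncl N)))
    he hf hed hfd ?_ ?_ ?_ (τ₁ := ξ.snd) (τ₂ := ζ.snd) ?_ ?_ ?_
  · have h1 : ξ.fst - -(K • d) = (ξ + P.fst).fst - (δ / ρ) • w.fst.fst := by
      change _ = ξ.fst + P.fst.fst - _
      rw [hP1]; abel
    have h2 : ‖(δ / ρ) • w.fst.fst‖ ≤ δ := by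
      rw [norm_smul, Real.norm_of_nonneg (by positivity), div_mul_eq_mul_div, div_le_iff₀ hρ0]
      gcongr
    rw [h1]
    refine (norm_sub_le _ _).trans ?_
    have := norm_fst_le_spaceTime (ξ + P.fst)
    linarith
  · have h1 : ζ.fst - K • d = (ζ + P.snd).fst := by
      change _ = ζ.fst + P.snd.fst
      rw [hP2]; abel
    rw [h1]
    have := norm_fst_le_spaceTime (ζ + P.snd)
    linarith
  · intro x y
    rw [hcomp, hcomp]
    exact hsQ x y
  · simpa only [hcomp, EuclideanSpace.basisFun_apply] using hAe
  · simpa only [hcomp, EuclideanSpace.basisFun_apply] using hBf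
  · have h1 := (abs_le.mp ((abs_snd_le_spaceTime (ξ + P.fst)).trans (hξ.trans hηδ))).2
    have h2 := (abs_le.mp ((abs_snd_le_spaceTime (ζ + P.snd)).trans (hζ.trans hηδ))).2
    change ξ.snd + P.fst.snd ≤ δ at h1
    change ζ.snd + P.snd.snd ≤ δ at h2
    linarith
end

section
variable {N : ℕ}

theorem norm_le_add_of_L2 {V W : Type*} [NormedAddCommGroup V] [NormedAddCommGroup W]
    (v : WithLp 2 (V × W)) : ‖v‖ ≤ ‖v.fst‖ + ‖v.snd‖ := by
  have := WithLp.prod_norm_sq_eq_of_L2 v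
  refine (sq_le_sq₀ (norm_nonneg _) (by positivity)).mp ?_
  nlinarith [mul_nonneg (norm_nonneg v.fst) (norm_nonneg v.snd)]

/-- The functional minimised when the variables are doubled. -/
def couplingVal (u : EuclideanSpace ℝ (Fin N) → ℝ → ℝ) (L κ δ s ε H lam : ℝ)
    (w : WithLp 2 (SpaceTime N × SpaceTime N)) : ℝ :=
  u w.fst.fst w.fst.snd + u w.snd.fst w.snd.snd + couplingFn L κ δ s ε H lam w

/-- Pairs of points in the closed parabolic cylinder with positive times. -/
def doubledCylinder (Ω : Set (EuclideanSpace ℝ (Fin N))) :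
    Set (WithLp 2 (SpaceTime N × SpaceTime N)) :=
  {w | w.fst.fst ∈ closure Ω ∧ 0 < w.fst.snd ∧ w.snd.fst ∈ closure Ω ∧ 0 < w.snd.snd}

theorem continuous_spaceTime_prod : Continuous fun v : SpaceTime N =>
    ((v.fst, v.snd) : EuclideanSpace ℝ (Fin N) × ℝ) :=
  (WithLp.prodContinuousLinearEquiv 2 ℝ (EuclideanSpace ℝ (Fin N)) ℝ).continuous

theorem continuous_doubled_prod : Continuous fun w : WithLp 2 (SpaceTime N × SpaceTime N) =>
    (((w.fst.fst, w.fst.snd), (w.snd.fst, w.snd.snd)) :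
      (EuclideanSpace ℝ (Fin N) × ℝ) × (EuclideanSpace ℝ (Fin N) × ℝ)) :=
  (continuous_spaceTime_prod.prodMap continuous_spaceTime_prod).comp
    (WithLp.prodContinuousLinearEquiv 2 ℝ (SpaceTime N) (SpaceTime N)).continuous

theorem continuousWithinAt_couplingVal {p : ℝ} {Ω : Set (EuclideanSpace ℝ (Fin N))}
    {u : EuclideanSpace ℝ (Fin N) → ℝ → ℝ} (hu : IsSolP p Ω u) {L κ δ s ε H lam : ℝ} (hκ : 0 < κ)
    {w : WithLp 2 (SpaceTime N × SpaceTime N)} (hw : w ∈ doubledCylinder Ω) :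
    ContinuousWithinAt (couplingVal u L κ δ s ε H lam) (doubledCylinder Ω) w := by
  obtain ⟨h1, h2, h3, h4⟩ := hw
  have c1 := hu.2.1 _ h1 _ h2.le (fun h => h2.ne' h.2)
  have c2 := hu.2.1 _ h3 _ h4.le (fun h => h4.ne' h.2)
  have d1 := c1.comp (f := fun w : WithLp 2 (SpaceTime N × SpaceTime N) => (w.fst.fst, w.fst.snd))
    (s := doubledCylinder Ω) (continuous_fst.comp continuous_doubled_prod).continuousWithinAt
    (fun v hv => ⟨hv.1, hv.2.1.le⟩)
  have d2 := c2.comp (f := fun w : WithLp 2 (SpaceTime N × SpaceTime N) => (w.snd.fst, w.snd.snd))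
    (s := doubledCylinder Ω) (continuous_snd.comp continuous_doubled_prod).continuousWithinAt
    (fun v hv => ⟨hv.2.2.1, hv.2.2.2.le⟩)
  exact (d1.add d2).add (contDiffAt_couplingFn hκ h2).continuousAt.continuousWithinAt

theorem couplingFn_bounds {L κ δ s ε H lam m : ℝ} (hL : 0 < L) (hκ : 0 < κ) (hδ : 0 < δ)
    (hε : 0 < ε) (hH : 0 < H) (hlam : 0 < lam) (hs : 0 < s) (hmε : m * ε ≤ (s / 2) ^ 2)
    {w : WithLp 2 (SpaceTime N × SpaceTime N)} (ht : 0 < w.fst.snd)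
    (hw : couplingFn L κ δ s ε H lam w ≤ m) :
    0 ≤ couplingFn L κ δ s ε H lam w ∧
    ((‖w.fst.fst - w.snd.fst‖ ^ 2) ^ 2 / w.fst.snd ^ 2 + κ ^ 8 * w.fst.snd ^ (4 / 5 : ℝ))
      ^ (1 / 8 : ℝ) ≤ m / L ∧
    ‖w.fst.fst‖ ≤ m / δ ∧ |w.snd.snd - w.fst.snd - s| ≤ s / 2 ∧ w.fst.snd ≤ m / lam := by
  rw [couplingFn] at hw ⊢
  set A := ((‖w.fst.fst - w.snd.fst‖ ^ 2) ^ 2 / w.fst.snd ^ 2 + κ ^ 8 * w.fst.snd ^ (4 / 5 : ℝ))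
      ^ (1 / 8 : ℝ) with hA
  have a1 : 0 ≤ L * A := by positivity
  have hsq : ‖w.fst.fst‖ ≤ √(1 + ‖w.fst.fst‖ ^ 2) := Real.le_sqrt_of_sq_le (by linarith)
  have a2 : δ * ‖w.fst.fst‖ ≤ δ * √(1 + ‖w.fst.fst‖ ^ 2) := by gcongr
  have a2' : 0 ≤ δ * ‖w.fst.fst‖ := by positivity
  have a3 : 0 ≤ (w.snd.snd - w.fst.snd - s) ^ 2 / ε := by positivity
  have a4 : 0 ≤ H * w.fst.snd ^ (1 / 10 : ℝ) := by positivity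
  have a5 : 0 ≤ lam * w.fst.snd := by positivity
  refine ⟨by linarith, ?_, ?_, ?_, ?_⟩
  · rw [le_div_iff₀ hL]; linarith
  · rw [le_div_iff₀ hδ]; linarith
  · have : (w.snd.snd - w.fst.snd - s) ^ 2 / ε ≤ m := by linarith
    rw [div_le_iff₀ hε] at this
    exact abs_le_of_sq_le_sq (this.trans hmε) (by linarith)
  · rw [le_div_iff₀ hlam]; linarith

theorem dist_pow_four_le_of_rpow_le {D t c B : ℝ} (ht : 0 < t) (hc : 0 ≤ c)
    (h : ((D ^ 2) ^ 2 / t ^ 2 + c) ^ (1 / 8 : ℝ) ≤ B) : D ^ 4 ≤ B ^ 8 * t ^ 2 := by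
  have h0 : 0 ≤ (D ^ 2) ^ 2 / t ^ 2 + c := by positivity
  have h1 : (((D ^ 2) ^ 2 / t ^ 2 + c) ^ (1 / 8 : ℝ)) ^ 8 = (D ^ 2) ^ 2 / t ^ 2 + c := by
    rw [← Real.rpow_natCast, ← Real.rpow_mul h0]; norm_num
  have h2 := pow_le_pow_left₀ (by positivity) h 8
  rw [h1] at h2
  have h3 : (D ^ 2) ^ 2 / t ^ 2 ≤ B ^ 8 := by linarith
  rw [div_le_iff₀ (by positivity)] at h3
  nlinarith

theorem exists_min_couplingVal {p : ℝ} {Ω : Set (EuclideanSpace ℝ (Fin N))} (hΩ : IsOpen Ω)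
    {u : EuclideanSpace ℝ (Fin N) → ℝ → ℝ} (hu : IsSolP p Ω u) {L κ δ s ε H lam m θ : ℝ}
    (hL : 0 < L) (hκ : 0 < κ) (hδ : 0 < δ)
    (hε : 0 < ε) (hH : 0 < H) (hlam : 0 < lam) (hs : 0 < s) (hmε : m * ε ≤ (s / 2) ^ 2)
    (hm : ∀ x ∈ closure Ω, ∀ t, 0 < t → -m ≤ u x t) (hθ : θ < -m)
    {w₀ : WithLp 2 (SpaceTime N × SpaceTime N)} (hw₀ : w₀ ∈ doubledCylinder Ω)
    (hv₀ : couplingVal u L κ δ s ε H lam w₀ ≤ θ) :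
    ∃ w ∈ doubledCylinder Ω, couplingVal u L κ δ s ε H lam w ≤ θ ∧
      ∀ w' ∈ doubledCylinder Ω,
        couplingVal u L κ δ s ε H lam w ≤ couplingVal u L κ δ s ε H lam w' := by
  set K := {w | w ∈ doubledCylinder Ω ∧ couplingVal u L κ δ s ε H lam w ≤ θ} with hK
  have hb : ∀ w ∈ K, 0 ≤ couplingFn L κ δ s ε H lam w ∧
      ((‖w.fst.fst - w.snd.fst‖ ^ 2) ^ 2 / w.fst.snd ^ 2 + κ ^ 8 * w.fst.snd ^ (4 / 5 : ℝ))
        ^ (1 / 8 : ℝ) ≤ m / L ∧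
      ‖w.fst.fst‖ ≤ m / δ ∧ |w.snd.snd - w.fst.snd - s| ≤ s / 2 ∧ w.fst.snd ≤ m / lam := by
    rintro w ⟨⟨h1, h2, h3, h4⟩, h5⟩
    refine couplingFn_bounds hL hκ hδ hε hH hlam hs hmε h2 ?_
    have e1 := hm _ h1 _ h2
    have e2 := hm _ h3 _ h4
    rw [couplingVal] at h5
    linarith
  have hd : ∀ w ∈ K, ‖w.fst.fst - w.snd.fst‖ ^ 4 ≤ (m / L) ^ 8 * w.fst.snd ^ 2 := fun w hw =>
    have := hw.1.2.1
    dist_pow_four_le_of_rpow_le this (by positivity) (hb w hw).2.1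
  have hbdd : Bornology.IsBounded K := by
    refine isBounded_iff_forall_norm_le.mpr
      ⟨(m / δ + m / lam) + ((m / δ + (1 + (m / L) ^ 8 * (m / lam) ^ 2)) + (m / lam + 2 * s)),
        fun w hw => ?_⟩
    obtain ⟨-, -, b1, b2, b3⟩ := hb w hw
    have ht1 := hw.1.2.1
    have ht2 := hw.1.2.2.2
    have b4 := hd w hw
    have n1 := norm_le_add_of_L2 w
    have n2 := norm_le_add_of_L2 w.fst
    have n3 := norm_le_add_of_L2 w.snd
    rw [Real.norm_of_nonneg ht1.le] at n2
    rw [Real.norm_of_nonneg ht2.le] at n3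
    have b5 := (abs_le.mp b2).2
    have b6 : (m / L) ^ 8 * w.fst.snd ^ 2 ≤ (m / L) ^ 8 * (m / lam) ^ 2 := by gcongr
    have b7 : ‖w.snd.fst‖ ≤ ‖w.fst.fst‖ + ‖w.fst.fst - w.snd.fst‖ := by
      simpa using norm_sub_le w.fst.fst (w.fst.fst - w.snd.fst)
    have b8 : ‖w.fst.fst - w.snd.fst‖ ≤ 1 + ‖w.fst.fst - w.snd.fst‖ ^ 4 := by
      nlinarith [sq_nonneg (‖w.fst.fst - w.snd.fst‖ ^ 2 - 1 / 2),
        sq_nonneg (‖w.fst.fst - w.snd.fst‖ - 1 / 2)]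
    linarith
  have hclosed : IsClosed K := by
    refine IsSeqClosed.isClosed fun v w hv hvw => ?_
    have hc := (continuous_doubled_prod.tendsto w).comp hvw
    have c1 := (continuous_fst.tendsto _).comp hc
    have c2 := (continuous_snd.tendsto _).comp hc
    have c11 := (continuous_fst.tendsto _).comp c1
    have c12 := (continuous_snd.tendsto _).comp c1
    have c21 := (continuous_fst.tendsto _).comp c2
    have c22 := (continuous_snd.tendsto _).comp c2
    have m1 : w.fst.fst ∈ closure Ω := isClosed_closure.mem_of_tendsto c11
      (Eventually.of_forall fun n => (hv n).1.1)
    have m2 : w.snd.fst ∈ closure Ω := isClosed_closure.mem_of_tendsto c21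
      (Eventually.of_forall fun n => (hv n).1.2.2.1)
    have t1 : 0 ≤ w.fst.snd := ge_of_tendsto' c12 fun n => (hv n).1.2.1.le
    have t2 : s / 2 ≤ w.snd.snd := ge_of_tendsto' c22 fun n => by
      have h1 := (abs_le.mp (hb _ (hv n)).2.2.2.1).1
      have h2 := (hv n).1.2.1
      simp only [Function.comp_apply]
      linarith
    have t2' : 0 < w.snd.snd := by linarith
    rcases t1.lt_or_eq with t1 | t1
    · have hw : w ∈ doubledCylinder Ω := ⟨m1, t1, m2, t2'⟩
      refine ⟨hw, le_of_tendsto' ((continuousWithinAt_couplingVal hu hκ hw).tendsto.comp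
        (tendsto_nhdsWithin_iff.mpr ⟨hvw, Eventually.of_forall fun n => (hv n).1⟩))
        fun n => (hv n).2⟩
    · exfalso
      have hlim : ‖w.fst.fst - w.snd.fst‖ ^ 4 ≤ (m / L) ^ 8 * w.fst.snd ^ 2 :=
        le_of_tendsto_of_tendsto' ((c11.sub c21).norm.pow 4) ((c12.pow 2).const_mul _)
          fun n => hd _ (hv n)
      have heq : w.fst.fst = w.snd.fst := by
        rw [← t1, zero_pow two_ne_zero, mul_zero] at hlim
        have := pow_eq_zero_iff (four_ne_zero) |>.mp (le_antisymm hlim (by positivity))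
        rwa [norm_eq_zero, sub_eq_zero] at this
      by_cases hΩw : w.fst.fst ∈ Ω
      · have hcu := hu.2.1 _ m1 0 le_rfl (fun h => by
          rw [hΩ.frontier_eq] at h
          exact h.1.2 hΩw)
        have h1 : Tendsto (fun n => u (v n).fst.fst (v n).fst.snd) atTop (𝓝 (u w.fst.fst 0)) :=
          hcu.tendsto.comp (tendsto_nhdsWithin_iff.mpr ⟨by rw [t1]; exact c1,
            Eventually.of_forall fun n => ⟨(hv n).1.1, (hv n).1.2.1.le⟩⟩)
        rw [hu.2.2.2.1 _ hΩw] at h1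
        have := le_of_tendsto' h1 (b := θ + m) fun n => by
          have e1 := (hb _ (hv n)).1
          have e2 := (hv n).2
          have e3 := hm _ (hv n).1.2.2.1 _ (hv n).1.2.2.2
          rw [couplingVal] at e2
          linarith
        linarith
      · have hf : w.snd.fst ∈ frontier Ω := by
          rw [hΩ.frontier_eq, ← heq]
          exact ⟨m1, hΩw⟩
        have hcu := hu.2.1 _ m2 w.snd.snd t2'.le (fun h => t2'.ne' h.2)
        have h1 : Tendsto (fun n => u (v n).snd.fst (v n).snd.snd) atTop
            (𝓝 (u w.snd.fst w.snd.snd)) :=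
          hcu.tendsto.comp (tendsto_nhdsWithin_iff.mpr ⟨c2,
            Eventually.of_forall fun n => ⟨(hv n).1.2.2.1, (hv n).1.2.2.2.le⟩⟩)
        rw [hu.2.2.2.2 _ hf _ t2'] at h1
        have := le_of_tendsto' h1 (b := θ + m) fun n => by
          have e1 := (hb _ (hv n)).1
          have e2 := (hv n).2
          have e3 := hm _ (hv n).1.1 _ (hv n).1.2.1
          rw [couplingVal] at e2
          linarith
        linarith
  obtain ⟨w, hw, hmin⟩ := (Metric.isCompact_of_isClosed_isBounded hclosed hbdd).exists_isMinOn
    ⟨w₀, hw₀, hv₀⟩ (fun w hw => (continuousWithinAt_couplingVal hu hκ hw.1).mono fun _ h => h.1)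
  refine ⟨w, hw.1, hw.2, fun w' hw' => ?_⟩
  by_cases h : couplingVal u L κ δ s ε H lam w' ≤ θ
  · exact hmin ⟨hw', h⟩
  · exact hw.2.trans (not_le.mp h).le
end

section
variable {N : ℕ}

theorem couplingFn_pos_base {κ t : ℝ} (hκ : 0 ≤ κ) (ht : 0 ≤ t) :
    (κ ^ 8 * t ^ (4 / 5 : ℝ)) ^ (1 / 8 : ℝ) = κ * t ^ (1 / 10 : ℝ) := by
  rw [Real.mul_rpow (by positivity) (by positivity), ← Real.rpow_natCast, ← Real.rpow_mul hκ,
    ← Real.rpow_mul ht]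
  norm_num

theorem exists_pos_small {C₁ C₂ C₃ C₄ m lam L ρ : ℝ} (hm : 0 < m) (hC₂ : 0 < C₂) (hlam : 0 < lam)
    (hL : 0 < L) :
    ∃ δ > 0, δ * ρ ≤ m ∧ C₁ * δ ^ 2 ≤ C₂ ∧ C₃ * δ < lam ∧ C₄ * δ ≤ L := by
  have h : ∀ f : ℝ → ℝ, Continuous f → f 0 = 0 → ∀ c > 0, ∀ᶠ δ in 𝓝[>] 0, f δ < c :=
    fun f hf h0 c hc => (hf.tendsto 0).mono_left nhdsWithin_le_nhds |>.eventually_lt_const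
      (by rwa [h0])
  obtain ⟨δ, h1, h2, h3, h4, h5⟩ := ((h (fun δ => δ * ρ) (by fun_prop) (by simp) m hm).and
    ((h (fun δ => C₁ * δ ^ 2) (by fun_prop) (by simp) C₂ hC₂).and
    ((h (fun δ => C₃ * δ) (by fun_prop) (by simp) lam hlam).and
    ((h (fun δ => C₄ * δ) (by fun_prop) (by simp) L hL).and self_mem_nhdsWithin)))).exists
  exact ⟨δ, h5, h1.le, h2.le, h3, h4.le⟩

theorem IsSolP.exists_lt_of_neg {p : ℝ} {Ω : Set (EuclideanSpace ℝ (Fin N))} (hΩ : IsOpen Ω)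
    {u : EuclideanSpace ℝ (Fin N) → ℝ → ℝ} (hu : IsSolP p Ω u) {x : EuclideanSpace ℝ (Fin N)}
    (hx : x ∈ closure Ω) {t : ℝ} (ht : 0 < t) (hneg : u x t < 0) :
    ∃ m > 0, (∀ x ∈ closure Ω, ∀ t, 0 < t → -m ≤ u x t) ∧
      ∃ x₀ ∈ Ω, ∃ t₀ > 0, ∃ s > 0, u x₀ t₀ < -(9 / 10 * m) ∧ u x₀ (t₀ + s) < -(9 / 10 * m) := by
  obtain ⟨M, hM⟩ := hu.1
  set S := {r | ∃ x ∈ closure Ω, ∃ t, 0 < t ∧ r = u x t} with hS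
  have hbd : BddBelow S := ⟨-M, by
    rintro r ⟨x, hx, t, ht, rfl⟩
    exact (abs_le.mp (hM x hx t ht.le)).1⟩
  have hne : S.Nonempty := ⟨_, x, hx, t, ht, rfl⟩
  have hlow : ∀ x ∈ closure Ω, ∀ t, 0 < t → sInf S ≤ u x t := fun x hx t ht =>
    csInf_le hbd ⟨x, hx, t, ht, rfl⟩
  have hm : sInf S < 0 := (hlow x hx t ht).trans_lt hneg
  obtain ⟨_, ⟨x₀, hx₀, T, hT, rfl⟩, hlt⟩ := exists_lt_of_csInf_lt hne
    (show sInf S < 9 / 10 * sInf S by linarith)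
  have hxΩ : x₀ ∈ Ω := by
    by_contra h
    have := hu.2.2.2.2 x₀ (by rw [hΩ.frontier_eq]; exact ⟨hx₀, h⟩) T hT
    linarith
  have hc : ContinuousAt (fun t => u x₀ t) T :=
    (hu.2.2.1.1.continuousAt ((hΩ.prod isOpen_Ioi).mem_nhds
      (show (x₀, T) ∈ Ω ×ˢ Ioi 0 from ⟨hxΩ, hT⟩))).comp (f := fun t : ℝ => (x₀, t))
      (by fun_prop)
  have hev : ∀ᶠ t in 𝓝[<] T, u x₀ t < 9 / 10 * sInf S ∧ 0 < t ∧ t < T :=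
    ((hc.eventually_lt_const hlt).filter_mono nhdsWithin_le_nhds).and
      (((eventually_gt_nhds hT).filter_mono nhdsWithin_le_nhds).and self_mem_nhdsWithin)
  obtain ⟨t₀, h1, h2, h3⟩ := hev.exists
  refine ⟨-sInf S, by linarith, by simpa using hlow, x₀, hxΩ, t₀, h2, T - t₀, by linarith, ?_, ?_⟩
  · linarith
  · rw [add_sub_cancel]; linarith

theorem IsSolP.nonneg [NeZero N] {p : ℝ} (hp : 1 < p) {Ω : Set (EuclideanSpace ℝ (Fin N))}
    (hΩ : IsOpen Ω) {u : EuclideanSpace ℝ (Fin N) → ℝ → ℝ} (hu : IsSolP p Ω u)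
    {x : EuclideanSpace ℝ (Fin N)} (hx : x ∈ closure Ω) {t : ℝ} (ht : 0 < t) : 0 ≤ u x t := by
  by_contra! hneg
  obtain ⟨m, hm, hlow, x₀, hx₀, t₀, ht₀, s, hs, hu₁, hu₂⟩ := hu.exists_lt_of_neg hΩ hx ht hneg
  have hp1 : 0 < p - 1 := by linarith
  have hp0 : 0 < p := by linarith
  set c := min 1 (2 * min 1 (p - 1) / p) with hc
  have hc0 : 0 < c := by positivity
  have hc1 : c ≤ 1 := min_le_left _ _
  set L := m / c with hLd
  have hL : 0 < L := by positivity
  have hmL : m / L = c := by rw [hLd]; field_simp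
  set lam := m / (10 * t₀) with hlamd
  have hlam : 0 < lam := by positivity
  have hlt : lam * t₀ = m / 10 := by rw [hlamd]; field_simp
  set H := m / (10 * t₀ ^ (1 / 10 : ℝ)) with hHd
  have hr : 0 < t₀ ^ (1 / 10 : ℝ) := by positivity
  have hH : 0 < H := by positivity
  have hHt : H * t₀ ^ (1 / 10 : ℝ) = m / 10 := by rw [hHd]; field_simp
  set κ := H / (10 * L) with hκd
  have hκ : 0 < κ := by positivity
  have hLκ : 10 * L * κ = H := by rw [hκd]; field_simp
  set R := ((m / lam) ^ (1 / 10 : ℝ)) ^ 5 with hR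
  obtain ⟨δ, hδ, d1, d2, d3, d4⟩ := exists_pos_small (C₁ := (2 * (√(p - 1) - 1) ^ 2 / p) ^ 3
    * (13824 * L)) (C₂ := κ ^ 7 * (H / 20) ^ 3) (C₃ := 4 + 4 * (N + (p - 2)) / p)
    (C₄ := 3584 * (m / L * R)) (ρ := √(1 + ‖x₀‖ ^ 2)) (m := m / 10) (lam := lam) (L := L)
    (by positivity) (by positivity) hlam hL
  set ε := s ^ 2 / (4 * m) with hεd
  have hε : 0 < ε := by positivity
  have hmε : m * ε ≤ (s / 2) ^ 2 := le_of_eq (by rw [hεd]; field_simp; norm_num)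
  set w₀ : WithLp 2 (SpaceTime N × SpaceTime N) :=
    WithLp.toLp 2 (stPoint x₀ t₀, stPoint x₀ (t₀ + s)) with hw₀
  have hv₀ : couplingVal u L κ δ s ε H lam w₀ ≤ -(7 / 5 * m) := by
    have h1 : couplingVal u L κ δ s ε H lam w₀ = u x₀ t₀ + u x₀ (t₀ + s)
        + (L * ((‖x₀ - x₀‖ ^ 2) ^ 2 / t₀ ^ 2 + κ ^ 8 * t₀ ^ (4 / 5 : ℝ)) ^ (1 / 8 : ℝ)
          + δ * √(1 + ‖x₀‖ ^ 2) + (t₀ + s - t₀ - s) ^ 2 / ε + H * t₀ ^ (1 / 10 : ℝ)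
          + lam * t₀) := rfl
    rw [h1, sub_self, norm_zero, zero_pow two_ne_zero, zero_pow two_ne_zero, zero_div, zero_add,
      couplingFn_pos_base hκ.le ht₀.le, add_sub_cancel_left, sub_self, zero_pow two_ne_zero,
      zero_div, hHt, hlt]
    have h2 : L * (κ * t₀ ^ (1 / 10 : ℝ)) = m / 100 := by
      have : 10 * (L * (κ * t₀ ^ (1 / 10 : ℝ))) = m / 10 := by rw [← hHt, ← hLκ]; ring
      linarith
    rw [h2]
    linarith
  obtain ⟨w, hwS, hwv, hmin⟩ := exists_min_couplingVal hΩ hu hL hκ hδ hε hH hlam hs hmε hlow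
    (by linarith) (w₀ := w₀)
    ⟨subset_closure hx₀, ht₀, subset_closure hx₀, add_pos ht₀ hs⟩ hv₀
  obtain ⟨m1, t1, m2, t2⟩ := hwS
  have l1 := hlow _ m1 _ t1
  have l2 := hlow _ m2 _ t2
  have hwv' : u w.fst.fst w.fst.snd + u w.snd.fst w.snd.snd + couplingFn L κ δ s ε H lam w
    ≤ -(7 / 5 * m) := hwv
  obtain ⟨b0, b1, -, -, b4⟩ := couplingFn_bounds (m := m) hL hκ hδ hε hH hlam hs hmε t1
    (by linarith)
  have i1 : w.fst.fst ∈ Ω := by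
    by_contra h
    have := hu.2.2.2.2 _ (by rw [hΩ.frontier_eq]; exact ⟨m1, h⟩) _ t1
    linarith
  have i2 : w.snd.fst ∈ Ω := by
    by_contra h
    have := hu.2.2.2.2 _ (by rw [hΩ.frontier_eq]; exact ⟨m2, h⟩) _ t2
    linarith
  set B := (‖w.fst.fst - w.snd.fst‖ ^ 2) ^ 2 / w.fst.snd ^ 2 + κ ^ 8 * w.fst.snd ^ (4 / 5 : ℝ)
    with hB
  have hB0 : 0 < B := by positivity
  have hq : 0 < B ^ (1 / 8 : ℝ) := by positivity
  have hqe : (B ^ (1 / 8 : ℝ)) ^ 8 = B := by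
    rw [← Real.rpow_natCast, ← Real.rpow_mul hB0.le]; norm_num
  refine no_interior_min (s := s) (ε := ε) hp hΩ hu.2.2.1 hL hκ hδ hH i1 t1 i2 t2 hq hqe ?_ ?_ hLκ.le ?_ d3 ?_
  · rw [hmL] at b1
    calc (B ^ (1 / 8 : ℝ)) ^ 4 ≤ c ^ 4 := by gcongr
      _ ≤ c := pow_le_of_le_one hc0.le hc1 four_ne_zero
      _ ≤ _ := min_le_right _ _
  · calc 3584 * δ * (B ^ (1 / 8 : ℝ) * (w.fst.snd ^ (1 / 10 : ℝ)) ^ 5)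
        ≤ 3584 * δ * (m / L * R) := by rw [hR]; gcongr
      _ = 3584 * (m / L * R) * δ := by ring
      _ ≤ L := d4
  · rw [← mul_assoc]; exact d2
  · have ho : IsOpen {w : WithLp 2 (SpaceTime N × SpaceTime N) |
        (w.fst.fst ∈ Ω ∧ 0 < w.fst.snd) ∧ w.snd.fst ∈ Ω ∧ 0 < w.snd.snd} :=
      ((hΩ.prod isOpen_Ioi).prod (hΩ.prod isOpen_Ioi)).preimage continuous_doubled_prod
    filter_upwards [ho.mem_nhds ⟨⟨i1, t1⟩, i2, t2⟩] with w' hw'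
    exact hmin w' ⟨subset_closure hw'.1.1, hw'.1.2, subset_closure hw'.2.1, hw'.2.2⟩
end

section
variable {N : ℕ}

/-- A Gaussian of height `C`, spreading around `z`. -/
def barrier (C a k : ℝ) (z x : EuclideanSpace ℝ (Fin N)) (t : ℝ) : ℝ :=
  C * (t ^ (-a) * Real.exp (-(k * ‖x - z‖ ^ 2 / t)))

/-- The barrier tilted in time, as a function on space-time. -/
def tiltedBarrier (C a k lam : ℝ) (z : EuclideanSpace ℝ (Fin N)) (v : SpaceTime N) : ℝ :=
  barrier C a k z v.fst v.snd - lam * v.snd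

theorem contDiffAt_tiltedBarrier {C a k lam : ℝ} {z : EuclideanSpace ℝ (Fin N)} {v : SpaceTime N}
    (hv : 0 < v.snd) : ContDiffAt ℝ 2 (tiltedBarrier C a k lam z) v := by
  have c1 : ContDiff ℝ 2 fun v : SpaceTime N => v.fst :=
    (WithLp.fstL 2 ℝ (EuclideanSpace ℝ (Fin N)) ℝ).contDiff
  have c2 : ContDiff ℝ 2 fun v : SpaceTime N => v.snd :=
    (WithLp.sndL 2 ℝ (EuclideanSpace ℝ (Fin N)) ℝ).contDiff
  exact (contDiffAt_const.mul ((c2.contDiffAt.rpow_const_of_ne hv.ne').mul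
    ((((contDiff_const.mul ((c1.sub contDiff_const).norm_sq ℝ)).contDiffAt.div c2.contDiffAt
      hv.ne').neg).exp))).sub (contDiffAt_const.mul c2.contDiffAt)

theorem fderiv_tiltedBarrier_space {C a k lam : ℝ} {z x : EuclideanSpace ℝ (Fin N)} {t : ℝ}
    (ht : 0 < t) (h : EuclideanSpace ℝ (Fin N)) :
    fderiv ℝ (tiltedBarrier C a k lam z) (stPoint x t) (spaceIncl N h)
      = -(2 * k / t * barrier C a k z x t) * ⟪x - z, h⟫ ∧
    fderiv ℝ (fderiv ℝ (tiltedBarrier C a k lam z)) (stPoint x t) (spaceIncl N h) (spaceIncl N h)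
      = barrier C a k z x t * (4 * k ^ 2 / t ^ 2 * ⟪x - z, h⟫ ^ 2 - 2 * k / t * ‖h‖ ^ 2) := by
  set B := ⟪x - z, h⟫ with hB
  have hline : ∀ σ : ℝ, tiltedBarrier C a k lam z (stPoint x t + σ • spaceIncl N h)
      = C * (t ^ (-a) * Real.exp (-(k * (‖x - z‖ ^ 2 + 2 * B * σ + ‖h‖ ^ 2 * σ ^ 2) / t)))
        - lam * t := fun σ => by
    have e1 : (stPoint x t + σ • spaceIncl N h).fst = x + σ • h := rfl
    have e2 : (stPoint x t + σ • spaceIncl N h).snd = t := by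
      change t + σ • (0 : ℝ) = _; rw [smul_zero, add_zero]
    have e5 : x + σ • h - z = (x - z) + σ • h := by abel
    rw [tiltedBarrier, barrier, e1, e2, e5, norm_add_sq_real, norm_smul, real_inner_smul_right,
      Real.norm_eq_abs, mul_pow, sq_abs, hB]
    ring_nf
  have hq := fun σ => hasDerivAt_quadratic (‖x - z‖ ^ 2) B (‖h‖ ^ 2) σ
  have he := fun σ => ((((hq σ).const_mul k).div_const t).neg).exp
  have h2 : HasDerivAt (fun σ : ℝ => 2 * B + 2 * ‖h‖ ^ 2 * σ) (2 * ‖h‖ ^ 2) 0 := by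
    simpa using ((hasDerivAt_id (0 : ℝ)).const_mul (2 * ‖h‖ ^ 2)).const_add (2 * B)
  have key := fderiv_apply_eq_of_line (v := spaceIncl N h)
    (contDiffAt_tiltedBarrier (C := C) (a := a) (k := k) (lam := lam) (z := z)
      (v := stPoint x t) ht)
    (Eventually.of_forall fun σ => by
      simp only [hline]
      exact (((he σ).const_mul (t ^ (-a))).const_mul C).sub_const (lam * t))
    ((((he 0).mul (((h2.const_mul k).div_const t).neg)).const_mul (t ^ (-a))).const_mul C)
  refine ⟨key.1.trans ?_, key.2.trans ?_⟩
  · simp only [barrier, mul_zero, add_zero, ne_eq, OfNat.ofNat_ne_zero, not_false_eq_true, zero_pow,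
      Pi.mul_apply, Pi.neg_apply]
    ring
  · simp only [barrier, mul_zero, add_zero, ne_eq, OfNat.ofNat_ne_zero, not_false_eq_true, zero_pow,
      Pi.neg_apply]
    ring

theorem fderiv_tiltedBarrier_time {C a k lam : ℝ} {z x : EuclideanSpace ℝ (Fin N)} {t : ℝ}
    (ht : 0 < t) :
    fderiv ℝ (tiltedBarrier C a k lam z) (stPoint x t) (stPoint 0 1)
      = barrier C a k z x t * (-(a / t) + k * ‖x - z‖ ^ 2 / t ^ 2) - lam := by
  have hline : ∀ σ : ℝ, tiltedBarrier C a k lam z (stPoint x t + σ • stPoint 0 1)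
      = C * ((t + σ) ^ (-a) * Real.exp (-(k * ‖x - z‖ ^ 2 / (t + σ)))) - lam * (t + σ) :=
    fun σ => by
    have e1 : (stPoint x t + σ • stPoint (0 : EuclideanSpace ℝ (Fin N)) 1).fst = x := by
      change x + σ • (0 : EuclideanSpace ℝ (Fin N)) = x; rw [smul_zero, add_zero]
    have e2 : (stPoint x t + σ • stPoint (0 : EuclideanSpace ℝ (Fin N)) 1).snd = t + σ := by
      change t + σ • (1 : ℝ) = _; rw [smul_eq_mul, mul_one]
    rw [tiltedBarrier, barrier, e1, e2]
  have d1 : HasDerivAt (fun σ : ℝ => t + σ) 1 0 := by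
    simpa using (hasDerivAt_id (0 : ℝ)).const_add t
  have d2 := d1.rpow_const (p := -a) (Or.inl (by simpa using ht.ne'))
  have d3 := ((((hasDerivAt_const (0 : ℝ) (k * ‖x - z‖ ^ 2)).div d1
    (by simpa using ht.ne')).neg).exp)
  have d5 := ((d2.mul d3).const_mul C).sub (d1.const_mul lam)
  have d6 := hasDerivAt_comp_line ((contDiffAt_tiltedBarrier (C := C) (a := a) (k := k) (lam := lam)
    (z := z) (v := stPoint x t) ht).differentiableAt (by simp)) (stPoint 0 1)
  rw [funext hline] at d6
  rw [d6.unique d5]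
  simp only [barrier, add_zero, Pi.neg_apply, Pi.div_apply, Real.rpow_sub_one ht.ne']
  field_simp
  ring

theorem no_interior_touching [NeZero N] {p : ℝ} (hp : 1 < p) {Ω : Set (EuclideanSpace ℝ (Fin N))}
    {u : EuclideanSpace ℝ (Fin N) → ℝ → ℝ} (hu : IsViscositySol p Ω u)
    {C lam : ℝ} (hC : 0 < C) (hlam : 0 < lam) {z x : EuclideanSpace ℝ (Fin N)} (hx : x ∈ Ω)
    (hxz : x ≠ z) {t : ℝ} (ht : 0 < t)
    (hmin : ∀ᶠ v in 𝓝 (stPoint x t), u x t - tiltedBarrier C ((N + p - 2) / (2 * (p - 1)))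
        (p / (4 * (p - 1))) lam z (stPoint x t)
      ≤ u v.fst v.snd - tiltedBarrier C ((N + p - 2) / (2 * (p - 1)))
        (p / (4 * (p - 1))) lam z v) : False := by
  set a := (N + p - 2) / (2 * (p - 1)) with ha
  set k := p / (4 * (p - 1)) with hk
  have hp0 : 0 < p := by linarith
  have hp1 : 0 < p - 1 := by linarith
  have hk0 : 0 < k := by positivity
  obtain ⟨P, Q, hP, hQ, hT⟩ := exists_taylor_two (contDiffAt_tiltedBarrier (C := C) (a := a)
    (k := k) (lam := lam) (z := z) (v := stPoint x t) ht)
  have hj : HasLowerJet (fun v : SpaceTime N => u v.fst v.snd) (stPoint x t) P Q := fun e he => by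
    have h0 : Tendsto (fun h : SpaceTime N => stPoint x t + h) (𝓝 0) (𝓝 (stPoint x t)) := by
      simpa using (continuous_const_add (stPoint x t)).tendsto 0
    filter_upwards [hT e he, h0.eventually hmin] with h h1 h2
    have h3 := (abs_le.mp h1).1
    simp only [stPoint_fst, stPoint_snd]
    linarith
  obtain ⟨e, he, hed, hle⟩ := exists_unit_le_of_hasLowerJet hp0 hu hx ht hj (half_pos hlam)
  set U := barrier C a k z x t with hU
  have hU0 : 0 < U := by rw [hU, barrier]; positivity
  set r := ‖x - z‖ with hr
  have hr0 : 0 < r := norm_pos_iff.mpr (sub_ne_zero.mpr hxz)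
  have hsp := fun h => fderiv_tiltedBarrier_space (C := C) (a := a) (k := k) (lam := lam) (z := z)
    (x := x) ht h
  have hP1 : P.fst = (-(2 * k / t * U)) • (x - z) := by
    refine ext_inner_right ℝ fun y => ?_
    have h1 := (hsp y).1
    rw [← hP, ← stPoint_zero_right, inner_stPoint_right, mul_zero, add_zero] at h1
    rw [h1, real_inner_smul_left]
  have hPt : P.snd = U * (-(a / t) + k * r ^ 2 / t ^ 2) - lam := by
    have h1 := fderiv_tiltedBarrier_time (C := C) (a := a) (k := k) (lam := lam) (z := z)
      (x := x) ht
    rw [← hP, inner_stPoint_right, inner_zero_right, zero_add, mul_one] at h1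
    exact h1
  have hc : 0 < 2 * k / t * U := by positivity
  have hP0 : P.fst ≠ 0 := by
    rw [hP1]
    exact smul_ne_zero (by linarith) (sub_ne_zero.mpr hxz)
  have hPn : ‖P.fst‖ = 2 * k / t * U * r := by
    rw [hP1, norm_smul, norm_neg, Real.norm_of_nonneg hc.le]
  have hin : ⟪x - z, e⟫ ^ 2 = r ^ 2 := by
    have : ⟪x - z, e⟫ = -r := by
      rw [hed hP0, hPn, hP1, real_inner_smul_right, real_inner_smul_right,
        real_inner_self_eq_norm_sq, ← hr]
      field_simp
    rw [this, neg_sq]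
  have hQ' : ∀ h, ⟪Q (spaceIncl N h), spaceIncl N h⟫
      = U * (4 * k ^ 2 / t ^ 2 * ⟪x - z, h⟫ ^ 2 - 2 * k / t * ‖h‖ ^ 2) := fun h => by
    rw [hQ, (hsp h).2]
  have hsum : ∑ i, ⟪Q (spaceIncl N (EuclideanSpace.single i 1)),
      spaceIncl N (EuclideanSpace.single i 1)⟫
      = U * (4 * k ^ 2 / t ^ 2 * r ^ 2 - 2 * k / t * N) := by
    have h1 : ∑ i, ⟪x - z, EuclideanSpace.single i (1 : ℝ)⟫ ^ 2 = r ^ 2 := by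
      rw [hr, EuclideanSpace.norm_sq_eq]
      refine Finset.sum_congr rfl fun i _ => ?_
      rw [EuclideanSpace.inner_single_right]
      simp
    simp only [hQ']
    rw [← Finset.mul_sum, Finset.sum_sub_distrib, ← Finset.mul_sum, h1]
    simp [mul_comm]
  rw [hsum, hQ', hin, he, hPt] at hle
  have hF : 1 / p * (U * (4 * k ^ 2 / t ^ 2 * r ^ 2 - 2 * k / t * N)
      + (p - 2) * (U * (4 * k ^ 2 / t ^ 2 * r ^ 2 - 2 * k / t * 1 ^ 2)))
      = U * (-(a / t) + k * r ^ 2 / t ^ 2) := by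
    rw [ha, hk]
    field_simp
    ring
  linarith
end

section
variable {N : ℕ}

theorem rpow_mul_exp_le_one {a k d t : ℝ} (ha : 0 < a) (hk : 0 < k) (hd : 0 < d) (ht : 0 < t) :
    (k / a * Real.exp 1) ^ a * d ^ (2 * a) * (t ^ (-a) * Real.exp (-(k * d ^ 2 / t))) ≤ 1 := by
  have e1 : Real.exp (-(k * d ^ 2 / t)) = Real.exp (-(k * d ^ 2 / t) / a) ^ a := by
    rw [← Real.exp_mul, div_mul_cancel₀ _ ha.ne']
  have e2 : d ^ (2 * a) = (d ^ 2) ^ a := by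
    rw [← Real.rpow_natCast, ← Real.rpow_mul hd.le]; norm_num
  have e3 : t ^ (-a) = t⁻¹ ^ a := by rw [Real.rpow_neg ht.le, Real.inv_rpow ht.le]
  rw [e1, e2, e3, ← Real.mul_rpow (by positivity) (by positivity),
    ← Real.mul_rpow (by positivity) (by positivity), ← Real.mul_rpow (by positivity) (by positivity)]
  refine Real.rpow_le_one (by positivity) ?_ ha.le
  set y := k * d ^ 2 / t / a with hy
  have hye : k / a * Real.exp 1 * d ^ 2 * (t⁻¹ * Real.exp (-(k * d ^ 2 / t) / a))
      = y * Real.exp (1 - y) := by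
    rw [sub_eq_add_neg, Real.exp_add, hy]
    field_simp
  rw [hye]
  have h1 : y ≤ Real.exp (y - 1) := by linarith [Real.add_one_le_exp (y - 1)]
  calc y * Real.exp (1 - y) ≤ Real.exp (y - 1) * Real.exp (1 - y) := by gcongr
    _ = 1 := by rw [← Real.exp_add]; simp

theorem continuousOn_barrier (C a k : ℝ) (z : EuclideanSpace ℝ (Fin N)) :
    ContinuousOn (fun q : EuclideanSpace ℝ (Fin N) × ℝ => barrier C a k z q.1 q.2) {q | 0 < q.2} :=
  fun q hq => by
    have h : q.2 ≠ 0 := ne_of_gt hq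
    have h1 : ContinuousAt (fun q : EuclideanSpace ℝ (Fin N) × ℝ => q.2 ^ (-a)) q :=
      continuousAt_snd.rpow_const (Or.inl h)
    have h2 : ContinuousAt (fun q : EuclideanSpace ℝ (Fin N) × ℝ => k * ‖q.1 - z‖ ^ 2 / q.2) q :=
      ContinuousAt.div (by fun_prop) continuousAt_snd h
    exact (continuousAt_const.mul (h1.mul (Real.continuous_exp.continuousAt.comp
      h2.neg))).continuousWithinAt

theorem exists_time_bound {C a b β : ℝ} (hb : 0 < b) (hβ : 0 < β) :
    ∃ τ > 0, ∀ t > 0, β ≤ C * (t ^ (-a) * Real.exp (-(b / t))) → τ ≤ t := by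
  have h1 := (tendsto_rpow_mul_exp_neg_mul_atTop_nhds_zero a b hb).const_mul C
  rw [mul_zero] at h1
  obtain ⟨S, hS⟩ := eventually_atTop.mp (h1.eventually_lt_const hβ)
  refine ⟨1 / max S 1, by positivity, fun t ht h => ?_⟩
  by_contra! hlt
  have h2 : max S 1 ≤ t⁻¹ := by
    rw [lt_div_iff₀ (by positivity)] at hlt
    rw [← one_div, le_div_iff₀ ht]
    linarith
  have h3 := hS t⁻¹ ((le_max_left _ _).trans h2)
  rw [Real.inv_rpow ht.le, ← Real.rpow_neg ht.le, neg_mul, ← div_eq_mul_inv] at h3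
  linarith

theorem IsSolP.barrier_le [NeZero N] {p : ℝ} (hp : 1 < p) {Ω : Set (EuclideanSpace ℝ (Fin N))}
    (hΩ : IsOpen Ω) {u : EuclideanSpace ℝ (Fin N) → ℝ → ℝ} (hu : IsSolP p Ω u)
    {C : ℝ} (hC : 0 < C) {z : EuclideanSpace ℝ (Fin N)} (hz : z ∉ closure Ω)
    (hfr : ∀ x ∈ frontier Ω, ∀ t, 0 < t →
      barrier C ((N + p - 2) / (2 * (p - 1))) (p / (4 * (p - 1))) z x t ≤ 1)
    {x₀ : EuclideanSpace ℝ (Fin N)} (hx₀ : x₀ ∈ closure Ω) {t₀ : ℝ} (ht₀ : 0 < t₀) :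
    barrier C ((N + p - 2) / (2 * (p - 1))) (p / (4 * (p - 1))) z x₀ t₀ ≤ u x₀ t₀ := by
  have hp0 : 0 < p := by linarith
  have hp1 : 0 < p - 1 := by linarith
  have hN1 : (1 : ℝ) ≤ N := by exact_mod_cast NeZero.one_le
  have ha : 0 < (N + p - 2) / (2 * (p - 1)) := by
    have : 0 < N + p - 2 := by linarith
    positivity
  have hk : 0 < p / (4 * (p - 1)) := by positivity
  by_contra! hlt
  set a := (N + p - 2) / (2 * (p - 1)) with had
  set k := p / (4 * (p - 1)) with hkd
  set β := (barrier C a k z x₀ t₀ - u x₀ t₀) / 2 with hβd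
  have hβ : 0 < β := by rw [hβd]; linarith
  set lam := β / t₀ with hlamd
  have hlam : 0 < lam := by positivity
  set G : EuclideanSpace ℝ (Fin N) × ℝ → ℝ :=
    fun q => u q.1 q.2 - (barrier C a k z q.1 q.2 - lam * q.2) with hG
  have hG₀ : G (x₀, t₀) = -β := by
    have : lam * t₀ = β := by rw [hlamd]; field_simp
    simp only [hG]
    rw [this]
    linarith
  have hzne : (closure Ω).Nonempty := ⟨x₀, hx₀⟩
  set ρ := infDist z (closure Ω) with hρd
  have hρ : 0 < ρ := (isClosed_closure.notMem_iff_infDist_pos hzne).mp hz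
  have hρx : ∀ x ∈ closure Ω, ρ ≤ ‖x - z‖ := fun x hx => by
    rw [← dist_eq_norm, dist_comm]
    exact infDist_le_dist_of_mem hx
  obtain ⟨τ, hτ, hτt⟩ := exists_time_bound (C := C) (a := a) (b := k * ρ ^ 2) (by positivity) hβ
  have hbig : ∀ q : EuclideanSpace ℝ (Fin N) × ℝ, q.1 ∈ closure Ω → 0 < q.2 → G q ≤ -β →
      β + lam * q.2 ≤ barrier C a k z q.1 q.2 := fun q h1 h2 h3 => by
    have := hu.nonneg hp hΩ h1 h2
    simp only [hG] at h3
    linarith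
  have hτG : ∀ q : EuclideanSpace ℝ (Fin N) × ℝ, q.1 ∈ closure Ω → 0 < q.2 → G q ≤ -β →
      τ ≤ q.2 := fun q h1 h2 h3 => by
    refine hτt q.2 h2 ?_
    have h4 := hbig q h1 h2 h3
    have h5 : 0 < lam * q.2 := by positivity
    have h6 : barrier C a k z q.1 q.2 ≤ C * (q.2 ^ (-a) * Real.exp (-(k * ρ ^ 2 / q.2))) := by
      have := hρx _ h1
      rw [barrier]
      gcongr
    linarith
  set T := C * τ ^ (-a) / lam with hTd
  have hb : ∀ q : EuclideanSpace ℝ (Fin N) × ℝ, q.1 ∈ closure Ω → 0 < q.2 → G q ≤ -β →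
      q.2 ≤ T ∧ ‖q.1 - z‖ ^ 2 ≤ C * τ ^ (-a) * T / (k * β) := fun q h1 h2 h3 => by
    have h4 := hbig q h1 h2 h3
    have h5 := hτG q h1 h2 h3
    have h6 : q.2 ^ (-a) ≤ τ ^ (-a) := Real.rpow_le_rpow_of_nonpos hτ h5 (by linarith)
    have h7 : barrier C a k z q.1 q.2
        ≤ C * (τ ^ (-a) * Real.exp (-(k * ‖q.1 - z‖ ^ 2 / q.2))) := by
      rw [barrier]; gcongr
    have h8 : Real.exp (-(k * ‖q.1 - z‖ ^ 2 / q.2)) ≤ 1 :=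
      Real.exp_le_one_iff.mpr (neg_nonpos.mpr (by positivity))
    have hτa : 0 < τ ^ (-a) := by positivity
    have hT : q.2 ≤ T := by
      rw [hTd, le_div_iff₀ hlam]
      have h9 : C * (τ ^ (-a) * Real.exp (-(k * ‖q.1 - z‖ ^ 2 / q.2))) ≤ C * (τ ^ (-a) * 1) := by
        gcongr
      linarith
    refine ⟨hT, ?_⟩
    set y := k * ‖q.1 - z‖ ^ 2 / q.2 with hy
    have hy0 : 0 ≤ y := by positivity
    have h9 : y * Real.exp (-y) ≤ 1 := by
      have := Real.add_one_le_exp y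
      calc y * Real.exp (-y) ≤ Real.exp y * Real.exp (-y) := by gcongr; linarith
        _ = 1 := by rw [← Real.exp_add]; simp
    have h10 : 0 < lam * q.2 := by positivity
    have h11 : β * y ≤ C * τ ^ (-a) := by
      calc β * y ≤ (C * (τ ^ (-a) * Real.exp (-y))) * y := by gcongr; linarith
        _ = C * τ ^ (-a) * (y * Real.exp (-y)) := by ring
        _ ≤ C * τ ^ (-a) * 1 := by gcongr
        _ = _ := mul_one _
    rw [le_div_iff₀ (by positivity)]
    have h12 : ‖q.1 - z‖ ^ 2 * (k * β) = β * y * q.2 := by rw [hy]; field_simp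
    rw [h12]
    gcongr
  set D : Set (EuclideanSpace ℝ (Fin N) × ℝ) := closure Ω ×ˢ Ici τ with hD
  have hDpos : ∀ q ∈ D, 0 < q.2 := fun q hq => hτ.trans_le hq.2
  have hGc : ContinuousOn G D := by
    refine ContinuousOn.sub (fun q hq => ?_) (((continuousOn_barrier C a k z).mono hDpos).sub
      (by fun_prop))
    exact (hu.2.1 q.1 hq.1 q.2 (hDpos q hq).le fun h => (hDpos q hq).ne' h.2).mono
      (prod_mono_right (Ici_subset_Ici.mpr hτ.le))
  have hKc : IsClosed (D ∩ G ⁻¹' Iic (-β)) :=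
    hGc.preimage_isClosed_of_isClosed (isClosed_closure.prod isClosed_Ici) isClosed_Iic
  have hKb : Bornology.IsBounded (D ∩ G ⁻¹' Iic (-β)) := by
    refine ((isBounded_closedBall (x := z) (r := 1 + C * τ ^ (-a) * T / (k * β))).prod
      (isBounded_Icc (0 : ℝ) T)).subset fun q hq => ?_
    obtain ⟨h1, h2⟩ := hb q hq.1.1 (hDpos q hq.1) hq.2
    refine ⟨?_, (hDpos q hq.1).le, h1⟩
    rw [mem_closedBall, dist_eq_norm]
    nlinarith [sq_nonneg (‖q.1 - z‖ - 1)]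
  have hm₀ : (x₀, t₀) ∈ D ∩ G ⁻¹' Iic (-β) :=
    ⟨⟨hx₀, hτG (x₀, t₀) hx₀ ht₀ hG₀.le⟩, hG₀.le⟩
  obtain ⟨⟨x, t⟩, ⟨hxt, hGx⟩, hmin⟩ := (Metric.isCompact_of_isClosed_isBounded hKc hKb).exists_isMinOn
    ⟨_, hm₀⟩ (hGc.mono inter_subset_left)
  have ht : 0 < t := hDpos _ hxt
  have hxc : x ∈ closure Ω := hxt.1
  have hbx := hbig (x, t) hxc ht hGx
  have hx : x ∈ Ω := by
    by_contra h
    have hf : x ∈ frontier Ω := by rw [hΩ.frontier_eq]; exact ⟨hxc, h⟩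
    have h1 := hu.2.2.2.2 x hf t ht
    have h2 := hfr x hf t ht
    have h3 : u x t - (barrier C a k z x t - lam * t) ≤ -β := hGx
    have h4 : 0 < lam * t := by positivity
    linarith
  have hmin' : ∀ q : EuclideanSpace ℝ (Fin N) × ℝ, q.1 ∈ closure Ω → 0 < q.2 → G (x, t) ≤ G q :=
    fun q h1 h2 => by
    by_cases h : G q ≤ -β
    · exact hmin ⟨⟨h1, hτG q h1 h2 h⟩, h⟩
    · exact hGx.trans (not_le.mp h).le
  refine no_interior_touching hp hu.2.2.1 hC hlam (z := z) hx
    (fun h => hz (h ▸ hxc)) ht ?_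
  have ho : IsOpen {v : SpaceTime N | v.fst ∈ Ω ∧ 0 < v.snd} :=
    (hΩ.prod isOpen_Ioi).preimage continuous_spaceTime_prod
  filter_upwards [ho.mem_nhds (show stPoint x t ∈ _ from ⟨hx, ht⟩)] with v hv
  exact hmin' (v.fst, v.snd) (subset_closure hv.1) hv.2
end

/-- the barrier from below `U^z ≤ u` on `Ω̄ × (0,∞)`. -/
theorem stmt7 (N : ℕ) (hN : 2 ≤ N) (p : ℝ) (hp : 1 < p)
    (Ω : Set (EuclideanSpace ℝ (Fin N))) (hΩo : IsOpen Ω) (hΩc : IsConnected Ω)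
    (hΓ : (frontier Ω).Nonempty)
    (z : EuclideanSpace ℝ (Fin N)) (hz : z ∉ closure Ω)
    (u : EuclideanSpace ℝ (Fin N) → ℝ → ℝ) (hu : IsSolP p Ω u) :
    ∀ x ∈ closure Ω, ∀ t : ℝ, 0 < t →
      (p * Real.exp 1 / (2*((N:ℝ) + p - 2))) ^ (((N:ℝ) + p - 2)/(2*(p-1))) *
        (Metric.infDist z (frontier Ω)) ^ (((N:ℝ) + p - 2)/(p-1)) *
        (t ^ (-(((N:ℝ) + p - 2)/(2*(p-1)))) * Real.exp (-(p/(p-1)) * ‖x - z‖^2 / (4*t)))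
      ≤ u x t := by
  intro x hx t ht
  have : NeZero N := ⟨by omega⟩
  have hp1 : 0 < p - 1 := by linarith
  have hp0 : 0 < p := by linarith
  have hN2 : (2 : ℝ) ≤ N := by exact_mod_cast hN
  have hNp : 0 < (N : ℝ) + p - 2 := by linarith
  set d := infDist z (frontier Ω) with hd
  have hd0 : 0 < d := (isClosed_frontier.notMem_iff_infDist_pos hΓ).mp
    fun h => hz (frontier_subset_closure h)
  have ha : 0 < ((N : ℝ) + p - 2) / (2 * (p - 1)) := by positivity
  have hk : 0 < p / (4 * (p - 1)) := by positivity
  have hA : p * Real.exp 1 / (2 * ((N : ℝ) + p - 2))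
      = p / (4 * (p - 1)) / (((N : ℝ) + p - 2) / (2 * (p - 1))) * Real.exp 1 := by
    field_simp
    norm_num
  have hE : ((N : ℝ) + p - 2) / (p - 1) = 2 * (((N : ℝ) + p - 2) / (2 * (p - 1))) := by
    field_simp
  have hX : -(p / (p - 1)) * ‖x - z‖ ^ 2 / (4 * t) = -(p / (4 * (p - 1)) * ‖x - z‖ ^ 2 / t) := by
    field_simp
  rw [hA, hE, hX]
  refine hu.barrier_le hp hΩo (by positivity) hz (fun y hy s hs => ?_) hx ht
  have hdy : d ≤ ‖y - z‖ := by
    rw [← dist_eq_norm, dist_comm]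
    exact infDist_le_dist_of_mem hy
  refine le_trans ?_ (rpow_mul_exp_le_one ha hk hd0 hs)
  rw [barrier]
  gcongr

end
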